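/- Fix A > 1 and define f_A(z,θ) := 1_{[A,∞)}(Im z)·h(Re z,θ). For every δ ∈ (0,1/2) and every ε > 0 there exists y₀ > 0 such that for all y with 0 < y ≤ y₀ and all real numbers α < β with β − α ≥ y^{1/2−δ}: | (1/(β−α))·∫_α^β Φ_{f_A}(x+iy,0) dx − (3/(2π²·A))·∫₀^{2π}∫₀¹ h(x,θ) dx dθ | ≤ ε. -/

import Mathlib

open MeasureTheory

/-- `e(w) := exp(2πiw)`. -/
noncomputable def e (w : ℂ) : ℂ := Complex.exp (2 * Real.pi * Complex.I * w)

/-- Automorphic lift over `PSL(2,ℤ)` at the cusp `∞`; `a c d`, `b c d` are a choice of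
integers with `a·d − b·c = 1` for coprime `(c,d)`, `c ≥ 1`. -/
noncomputable def lift (a b : ℕ → ℤ → ℤ) (f : ℂ → ℝ → ℂ) (z : ℂ) (θ : ℝ) : ℂ :=
  f z θ + ∑' c : ℕ, ∑' d : ℤ,
    if 1 ≤ c ∧ Int.gcd (c : ℤ) d = 1 then
      f (((a c d : ℂ) * z + (b c d : ℂ)) / ((c : ℂ) * z + (d : ℂ)))
        (θ - 2 * Complex.arg ((c : ℂ) * z + (d : ℂ)))
    else 0

/-- `f_A(z,θ) := 1_{[A,∞)}(Im z) · h(Re z, θ)`. -/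
noncomputable def fA (A : ℝ) (h : ℝ → ℝ → ℂ) (z : ℂ) (θ : ℝ) : ℂ :=
  if A ≤ z.im then h z.re θ else 0

namespace Horocycle

lemma succ_pow_four_le (k : ℕ) : (k + 1) ^ 4 ≤ 100 * 2 ^ k := by
  rcases lt_or_ge k 5 with hk | hk
  · interval_cases k <;> norm_num
  · induction k, hk using Nat.le_induction with
    | base => norm_num
    | succ k hk ih =>
      obtain ⟨j, rfl⟩ := Nat.exists_eq_add_of_le hk
      have : (5 + j + 1 + 1) ^ 4 ≤ 2 * (5 + j + 1) ^ 4 := by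
        ring_nf; nlinarith [Nat.zero_le j]
      calc _ ≤ _ := this
        _ ≤ 2 * (100 * 2 ^ (5 + j)) := by gcongr
        _ = _ := by ring

lemma card_divisors_pow_four_le (n : ℕ) (hn : n ≠ 0) :
    n.divisors.card ^ 4 ≤ 100 ^ 16 * n := by
  have hb : ∀ p ∈ n.primeFactors, (n.factorization p + 1) ^ 4 ≤
      (if p < 16 then 100 else 1) * p ^ n.factorization p := by
    intro p hp
    have hp2 := (Nat.prime_of_mem_primeFactors hp).two_le
    split_ifs with h
    · exact (succ_pow_four_le _).trans (by gcongr)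
    · have h1 : n.factorization p + 1 ≤ 2 ^ n.factorization p := Nat.lt_two_pow_self
      calc (n.factorization p + 1) ^ 4 ≤ (2 ^ n.factorization p) ^ 4 := by gcongr
        _ = 16 ^ n.factorization p := by rw [← pow_mul, mul_comm, pow_mul]; norm_num
        _ ≤ 1 * p ^ n.factorization p := by
          rw [one_mul]; gcongr; omega
  have hprod : ∏ p ∈ n.primeFactors, (if p < 16 then 100 else 1) ≤ 100 ^ 16 := by
    rw [Finset.prod_ite]
    simp only [Finset.prod_const, one_pow, mul_one]
    gcongr
    · norm_num
    · calc _ ≤ (Finset.range 16).card := Finset.card_le_card (by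
            intro p hp; simp at hp ⊢; omega)
        _ = 16 := by simp
  calc n.divisors.card ^ 4 = ∏ p ∈ n.primeFactors, (n.factorization p + 1) ^ 4 := by
        rw [Nat.card_divisors hn, Finset.prod_pow]
    _ ≤ ∏ p ∈ n.primeFactors, ((if p < 16 then 100 else 1) * p ^ n.factorization p) :=
        Finset.prod_le_prod' hb
    _ = (∏ p ∈ n.primeFactors, (if p < 16 then 100 else 1)) * n := by
        rw [Finset.prod_mul_distrib]
        congr 1
        exact Nat.prod_factorization_pow_eq_self hn
    _ ≤ _ := by gcongr

lemma le_card_divisors_mul_totient (n : ℕ) (hn : n ≠ 0) :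
    n ≤ n.divisors.card * n.totient := by
  calc n = ∑ d ∈ n.divisors, d.totient := (Nat.sum_totient n).symm
    _ ≤ ∑ d ∈ n.divisors, n.totient := Finset.sum_le_sum fun d hd =>
        Nat.le_of_dvd (Nat.totient_pos.2 (Nat.pos_of_ne_zero hn))
          (Nat.totient_dvd_of_dvd (Nat.dvd_of_mem_divisors hd))
    _ = _ := by simp

/-- The number of `x` in `ZMod K` with `y * x = t` is at most `gcd(y, K)`. -/
lemma card_mul_eq_le {K : ℕ} [NeZero K] (y : ℕ) (t : ZMod K) :
    (Finset.univ.filter fun x : ZMod K => (y : ZMod K) * x = t).card ≤ Nat.gcd y K := by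
  classical
  have hker : Nat.card (nsmulAddMonoidHom y : ZMod K →+ ZMod K).ker = Nat.gcd y K := by
    rw [IsAddCyclic.card_nsmulAddMonoidHom_ker, Nat.card_zmod, Nat.gcd_comm]
  rcases (Finset.univ.filter fun x : ZMod K => (y : ZMod K) * x = t).eq_empty_or_nonempty with h | ⟨x₀, hx₀⟩
  · simp [h]
  · rw [← hker, Nat.card_eq_fintype_card, ← Finset.card_univ]
    refine Finset.card_le_card_of_injOn
      (fun x => if hx : (y : ZMod K) * x = t then
        ⟨x - x₀, by
          simp only [Finset.mem_filter, Finset.mem_univ, true_and] at hx₀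
          simp [AddMonoidHom.mem_ker, mul_sub, hx, hx₀]⟩ else 0) (fun _ _ => by simp) ?_
    intro a ha b hb hab
    simp only [Finset.coe_filter, Finset.mem_univ, true_and, Set.mem_ofPred_eq] at ha hb
    simpa [ha, hb] using hab

lemma sum_gcd_le (K : ℕ) [NeZero K] :
    ∑ v : ZMod K, Nat.gcd v.val K ≤ K * K.divisors.card := by
  have hK : K ≠ 0 := NeZero.ne K
  have h1 : ∀ v : ZMod K, Nat.gcd v.val K ≤ ∑ d ∈ K.divisors, if d ∣ v.val then d else 0 := by
    intro v
    refine le_trans (le_of_eq ?_) (Finset.single_le_sum (f := fun d => if d ∣ v.val then d else 0)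
      (fun _ _ => Nat.zero_le _) (Nat.mem_divisors.2 ⟨Nat.gcd_dvd_right v.val K, hK⟩))
    simp [Nat.gcd_dvd_left]
  refine (Finset.sum_le_sum fun v _ => h1 v).trans ?_
  rw [Finset.sum_comm, mul_comm, ← smul_eq_mul]
  refine Finset.sum_le_card_nsmul _ _ _ fun d hd => ?_
  have hdK := Nat.dvd_of_mem_divisors hd
  have hd0 : d ≠ 0 := by rintro rfl; simp at hdK; exact hK hdK
  rw [Finset.sum_ite]
  simp only [Finset.sum_const, smul_eq_mul, mul_zero, add_zero]
  have : (Finset.univ.filter fun v : ZMod K => d ∣ v.val).card ≤ (Finset.range (K / d)).card := by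
    refine Finset.card_le_card_of_injOn (fun v => v.val / d) ?_ ?_
    · intro v hv
      simp only [Finset.coe_filter, Finset.mem_univ, true_and, Set.mem_ofPred_eq] at hv
      simp only [Finset.coe_range, Set.mem_Iio]
      exact Nat.div_lt_div_of_lt_of_dvd hdK (ZMod.val_lt v)
    · intro v hv w hw h
      simp only [Finset.coe_filter, Finset.mem_univ, true_and, Set.mem_ofPred_eq] at hv hw
      apply ZMod.val_injective K
      exact (Nat.div_left_inj hv hw).1 h
  rw [Finset.card_range] at this
  calc _ ≤ K / d * d := by gcongr
    _ = K := Nat.div_mul_cancel hdK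

/-- The Kloosterman sum modulo `K`. -/
noncomputable def kloosterman (K : ℕ) [NeZero K] (m n : ZMod K) : ℂ :=
  ∑ x : (ZMod K)ˣ, ZMod.stdAddChar (m * (x : ZMod K) + n * ((x⁻¹ : (ZMod K)ˣ) : ZMod K))

lemma sum_stdAddChar_mul (K : ℕ) [NeZero K] (b : ZMod K) :
    ∑ m : ZMod K, ZMod.stdAddChar (m * b) = if b = 0 then (K : ℂ) else 0 := by
  have := AddChar.sum_mulShift b (ZMod.isPrimitive_stdAddChar K)
  rw [this]; simp [ZMod.card]

lemma sum_sum_norm_sq (K : ℕ) [NeZero K] {W : Type*} [Fintype W] (p q : W → ZMod K) :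
    ∑ m : ZMod K, ∑ n : ZMod K, ‖∑ w : W, ZMod.stdAddChar (m * p w + n * q w)‖ ^ 2 =
      (K : ℝ) ^ 2 * (Finset.univ.filter fun w : W × W => p w.1 = p w.2 ∧ q w.1 = q w.2).card := by
  have key : ∀ m n : ZMod K,
      ((‖∑ w : W, ZMod.stdAddChar (m * p w + n * q w)‖ ^ 2 : ℝ) : ℂ) =
      ∑ w : W × W, ZMod.stdAddChar (m * (p w.1 - p w.2)) * ZMod.stdAddChar (n * (q w.1 - q w.2)) := by
    intro m n
    push_cast
    rw [← Complex.mul_conj', map_sum, Finset.sum_mul_sum, Fintype.sum_prod_type]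
    refine Finset.sum_congr rfl fun w _ => Finset.sum_congr rfl fun w' _ => ?_
    rw [← AddChar.map_neg_eq_conj, ← AddChar.map_add_eq_mul, ← AddChar.map_add_eq_mul]
    congr 1; ring
  apply Complex.ofReal_injective
  rw [Complex.ofReal_sum]
  simp_rw [Complex.ofReal_sum, key]
  calc ∑ m : ZMod K, ∑ n : ZMod K, ∑ w : W × W,
        ZMod.stdAddChar (m * (p w.1 - p w.2)) * ZMod.stdAddChar (n * (q w.1 - q w.2))
      = ∑ w : W × W, (∑ m : ZMod K, ZMod.stdAddChar (m * (p w.1 - p w.2))) *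
          (∑ n : ZMod K, ZMod.stdAddChar (n * (q w.1 - q w.2))) := by
        simp_rw [Finset.sum_mul_sum]
        rw [Finset.sum_comm]
        rw [Finset.sum_congr rfl fun n _ => Finset.sum_comm]
        rw [Finset.sum_comm]
        refine Finset.sum_congr rfl fun w _ => Finset.sum_comm
    _ = ∑ w : W × W, if p w.1 = p w.2 ∧ q w.1 = q w.2 then (K : ℂ) ^ 2 else 0 := by
        refine Finset.sum_congr rfl fun w _ => ?_
        rw [sum_stdAddChar_mul, sum_stdAddChar_mul]
        simp only [sub_eq_zero]
        split_ifs <;> simp_all [sq]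
    _ = _ := by
        rw [← Finset.sum_filter]
        simp [mul_comm]

lemma card_triples_le (K : ℕ) [NeZero K] :
    (Finset.univ.filter fun t : ZMod K × ZMod K × ZMod K =>
      (t.1 + t.2.1) * (t.2.2 - t.1) * (t.2.1 - t.2.2) = 0).card ≤
      2 * (K * K.divisors.card) ^ 2 := by
  have h1 : (Finset.univ.filter fun t : ZMod K × ZMod K × ZMod K =>
      (t.1 + t.2.1) * (t.2.2 - t.1) * (t.2.1 - t.2.2) = 0).card ≤
      (Finset.univ.filter fun t : ZMod K × ZMod K × ZMod K =>
      ((2 * t.1.val * t.2.1.val : ℕ) : ZMod K) * t.2.2 = - (t.1 + t.2.1) * t.1 * t.2.1).card := by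
    refine Finset.card_le_card_of_injOn (fun t => (t.2.2 - t.1, t.2.1 - t.2.2, t.1)) ?_ ?_
    · rintro ⟨x, y, z⟩ h
      simp only [Finset.coe_filter, Finset.mem_univ, true_and, Set.mem_ofPred_eq] at h ⊢
      push_cast
      rw [ZMod.natCast_zmod_val, ZMod.natCast_zmod_val]
      linear_combination h
    · rintro ⟨x, y, z⟩ _ ⟨x', y', z'⟩ _ h
      simp only [Prod.mk.injEq] at h ⊢
      obtain ⟨a, b, rfl⟩ := h
      have : z = z' := by simpa using a
      subst this
      simpa using b
  refine h1.trans ?_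
  have h2 : (Finset.univ.filter fun t : ZMod K × ZMod K × ZMod K =>
      ((2 * t.1.val * t.2.1.val : ℕ) : ZMod K) * t.2.2 = - (t.1 + t.2.1) * t.1 * t.2.1).card =
      ∑ v : ZMod K, ∑ w : ZMod K, (Finset.univ.filter fun x : ZMod K =>
        ((2 * v.val * w.val : ℕ) : ZMod K) * x = - (v + w) * v * w).card := by
    simp_rw [Finset.card_filter]
    rw [Fintype.sum_prod_type]
    refine Finset.sum_congr rfl fun v _ => ?_
    rw [Fintype.sum_prod_type]
  rw [h2]
  calc _ ≤ ∑ v : ZMod K, ∑ w : ZMod K, 2 * (Nat.gcd v.val K * Nat.gcd w.val K) := by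
        refine Finset.sum_le_sum fun v _ => Finset.sum_le_sum fun w _ => ?_
        refine (card_mul_eq_le _ _).trans ?_
        have hK := Nat.pos_of_ne_zero (NeZero.ne K)
        refine Nat.le_of_dvd (by have := Nat.gcd_pos_of_pos_right v.val hK
                                 have := Nat.gcd_pos_of_pos_right w.val hK; positivity) ?_
        calc Nat.gcd (2 * v.val * w.val) K ∣ Nat.gcd (2 * v.val) K * Nat.gcd w.val K :=
              Nat.gcd_mul_left_dvd_mul_gcd ..
          _ ∣ (Nat.gcd 2 K * Nat.gcd v.val K) * Nat.gcd w.val K :=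
              Nat.mul_dvd_mul_right (Nat.gcd_mul_left_dvd_mul_gcd ..) _
          _ ∣ _ := by
              rw [mul_assoc]; exact Nat.mul_dvd_mul_right (Nat.gcd_dvd_left _ _) _
    _ = 2 * ((∑ v : ZMod K, Nat.gcd v.val K) * (∑ v : ZMod K, Nat.gcd v.val K)) := by
        simp_rw [← Finset.mul_sum, Finset.sum_mul_sum, ← Finset.mul_sum]
    _ ≤ _ := by
        rw [sq]; have := sum_gcd_le K; gcongr

lemma sum_kloosterman_pow_four_le (K : ℕ) [NeZero K] :
    ∑ m : ZMod K, ∑ n : ZMod K, ‖kloosterman K m n‖ ^ 4 ≤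
      (K : ℝ) ^ 2 * (2 * (K * K.divisors.card) ^ 2) := by
  have h1 : ∀ m n : ZMod K, ‖kloosterman K m n‖ ^ 4 =
      ‖∑ w : (ZMod K)ˣ × (ZMod K)ˣ, ZMod.stdAddChar (m * ((w.1 : ZMod K) + (w.2 : ZMod K)) +
        n * (((w.1⁻¹ : (ZMod K)ˣ) : ZMod K) + ((w.2⁻¹ : (ZMod K)ˣ) : ZMod K)))‖ ^ 2 := by
    intro m n
    rw [show (4 : ℕ) = 2 * 2 from rfl, pow_mul, ← norm_pow, sq (kloosterman K m n), kloosterman,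
      Finset.sum_mul_sum, Fintype.sum_prod_type]
    congr 2
    refine Finset.sum_congr rfl fun w _ => Finset.sum_congr rfl fun w' _ => ?_
    rw [← AddChar.map_add_eq_mul]
    congr 1; ring
  simp_rw [h1]
  rw [sum_sum_norm_sq]
  gcongr
  refine le_trans ?_ (Nat.cast_le.2 (card_triples_le K)) |>.trans (by push_cast; rfl)
  refine Nat.cast_le.2 (Finset.card_le_card_of_injOn
    (fun w => ((w.1.1 : ZMod K), (w.1.2 : ZMod K), (w.2.1 : ZMod K))) ?_ ?_)
  · rintro ⟨⟨x, y⟩, z, u⟩ h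
    simp only [Finset.coe_filter, Finset.mem_univ, true_and, Set.mem_ofPred_eq] at h ⊢
    obtain ⟨h, h'⟩ := h
    have hu : (u : ZMod K) = x + y - z := by rw [h]; ring
    have hx := x.mul_inv
    have hy := y.mul_inv
    have hz := z.mul_inv
    have hu' := u.mul_inv
    set x' := ((x⁻¹ : (ZMod K)ˣ) : ZMod K)
    set y' := ((y⁻¹ : (ZMod K)ˣ) : ZMod K)
    set z' := ((z⁻¹ : (ZMod K)ˣ) : ZMod K)
    set u' := ((u⁻¹ : (ZMod K)ˣ) : ZMod K)
    have e1 : ((x : ZMod K) + y) * (z * u) = (z + u) * (x * y) := by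
      have a1 : ((x : ZMod K) * y * z * u) * (x' + y') = (x + y) * (z * u) := by
        linear_combination (y * z * u : ZMod K) * hx + (x * z * u : ZMod K) * hy
      have a2 : ((x : ZMod K) * y * z * u) * (z' + u') = (z + u) * (x * y) := by
        linear_combination (x * y * u : ZMod K) * hz + (x * y * z : ZMod K) * hu'
      rw [← a1, ← a2, h']
    rw [hu] at e1
    linear_combination e1
  · rintro ⟨⟨x, y⟩, z, u⟩ h ⟨⟨x', y'⟩, z', u'⟩ h2 h3
    simp only [Finset.coe_filter, Finset.mem_univ, true_and, Set.mem_ofPred_eq] at h h2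
    simp only [Prod.mk.injEq, Units.val_inj] at h3 ⊢
    obtain ⟨rfl, rfl, rfl⟩ := h3
    refine ⟨⟨rfl, rfl⟩, rfl, ?_⟩
    apply Units.ext
    have := h.1.symm.trans h2.1
    simpa using this

lemma kloosterman_mul_units (K : ℕ) [NeZero K] (m n : ZMod K) (u : (ZMod K)ˣ) :
    kloosterman K (m * (u : ZMod K)) (n * ((u⁻¹ : (ZMod K)ˣ) : ZMod K)) = kloosterman K m n := by
  unfold kloosterman
  refine Fintype.sum_equiv (Equiv.mulLeft u) _ _ fun x => ?_
  simp only [Equiv.coe_mulLeft, mul_inv, Units.val_mul]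
  congr 1; ring

lemma card_intCast_mul_eq_le {K : ℕ} [NeZero K] {n : ℤ} (hn : n ≠ 0) (t : ZMod K) :
    (Finset.univ.filter fun x : ZMod K => (n : ZMod K) * x = t).card ≤ n.natAbs := by
  have h : ∀ t : ZMod K, (Finset.univ.filter fun x : ZMod K =>
      ((n.natAbs : ℕ) : ZMod K) * x = t).card ≤ n.natAbs := fun t =>
    (card_mul_eq_le _ _).trans (Nat.gcd_le_left _ (Int.natAbs_pos.2 hn))
  rcases Int.natAbs_eq n with h1 | h1
  · have : (n : ZMod K) = ((n.natAbs : ℕ) : ZMod K) := by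
      conv_lhs => rw [h1]
      simp
    rw [this]; exact h t
  · have : (n : ZMod K) = -((n.natAbs : ℕ) : ZMod K) := by
      conv_lhs => rw [h1]
      simp
    rw [this]
    simp_rw [neg_mul, neg_eq_iff_eq_neg]
    exact h (-t)

lemma totient_mul_kloosterman_pow_le (K : ℕ) [NeZero K] (m : ZMod K) {n : ℤ} (hn : n ≠ 0) :
    (K.totient : ℝ) * ‖kloosterman K m n‖ ^ 4 ≤
      n.natAbs * ((K : ℝ) ^ 2 * (2 * (K * K.divisors.card) ^ 2)) := by
  set f : ZMod K → ℝ := fun y => ∑ m : ZMod K, ‖kloosterman K m y‖ ^ 4 with hf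
  have hf0 : ∀ y, 0 ≤ f y := fun y => Finset.sum_nonneg fun _ _ => by positivity
  calc (K.totient : ℝ) * ‖kloosterman K m n‖ ^ 4
      = ∑ u : (ZMod K)ˣ, ‖kloosterman K (m * (u : ZMod K))
          (n * ((u⁻¹ : (ZMod K)ˣ) : ZMod K))‖ ^ 4 := by
        simp_rw [kloosterman_mul_units]
        simp [ZMod.card_units_eq_totient]
    _ ≤ ∑ u : (ZMod K)ˣ, f (n * ((u⁻¹ : (ZMod K)ˣ) : ZMod K)) :=
        Finset.sum_le_sum fun u _ => Finset.single_le_sum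
          (f := fun m => ‖kloosterman K m (n * ((u⁻¹ : (ZMod K)ˣ) : ZMod K))‖ ^ 4)
          (fun _ _ => by positivity) (Finset.mem_univ _)
    _ = ∑ u : (ZMod K)ˣ, f (n * (u : ZMod K)) :=
        Fintype.sum_equiv (Equiv.inv _) _ _ fun u => rfl
    _ = ∑ x ∈ Finset.univ.image (fun u : (ZMod K)ˣ => (u : ZMod K)), f (n * x) := by
        rw [Finset.sum_image (fun _ _ _ _ h => Units.ext h)]
    _ ≤ ∑ x : ZMod K, f (n * x) :=
        Finset.sum_le_sum_of_subset_of_nonneg (Finset.subset_univ _) fun _ _ _ => hf0 _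
    _ = ∑ y : ZMod K, ∑ x ∈ Finset.univ.filter (fun x : ZMod K => (n : ZMod K) * x = y), f y := by
        rw [← Finset.sum_fiberwise (s := Finset.univ) (g := fun x : ZMod K => (n : ZMod K) * x)]
        refine Finset.sum_congr rfl fun y _ => Finset.sum_congr rfl fun x hx => ?_
        rw [(Finset.mem_filter.1 hx).2]
    _ ≤ ∑ y : ZMod K, n.natAbs * f y := by
        refine Finset.sum_le_sum fun y _ => ?_
        rw [Finset.sum_const, nsmul_eq_mul]
        exact mul_le_mul_of_nonneg_right (Nat.cast_le.2 (card_intCast_mul_eq_le hn y)) (hf0 y)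
    _ ≤ _ := by
        rw [← Finset.mul_sum, hf, Finset.sum_comm]
        exact mul_le_mul_of_nonneg_left (sum_kloosterman_pow_four_le K) (Nat.cast_nonneg _)

lemma kloosterman_pow_sixteen_le (K : ℕ) [NeZero K] (m : ZMod K) {n : ℤ} (hn : n ≠ 0) :
    (‖kloosterman K m n‖ / K) ^ 16 ≤ 16 * (n.natAbs : ℝ) ^ 4 * (100 ^ 16) ^ 3 / K := by
  have hK : (0 : ℝ) < K := Nat.cast_pos.2 (Nat.pos_of_ne_zero (NeZero.ne K))
  set T : ℝ := ((K.divisors.card : ℕ) : ℝ) with hT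
  have hT0 : 0 ≤ T := Nat.cast_nonneg _
  set k := ‖kloosterman K m n‖
  have h1 : (K : ℝ) ≤ T * K.totient := by
    rw [hT]; exact_mod_cast le_card_divisors_mul_totient K (NeZero.ne K)
  have h2 := totient_mul_kloosterman_pow_le K m hn
  have h3 : T ^ 4 ≤ 100 ^ 16 * K := by
    rw [hT]; exact_mod_cast card_divisors_pow_four_le K (NeZero.ne K)
  have h4 : (k / K) ^ 4 ≤ 2 * n.natAbs * T ^ 3 / K := by
    rw [div_pow, div_le_div_iff₀ (by positivity) hK]
    calc k ^ 4 * K ≤ k ^ 4 * (T * K.totient) := by gcongr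
      _ = T * (K.totient * k ^ 4) := by ring
      _ ≤ T * (n.natAbs * ((K : ℝ) ^ 2 * (2 * (K * T) ^ 2))) := by gcongr
      _ = _ := by ring
  calc (k / K) ^ 16 = ((k / K) ^ 4) ^ 4 := by ring
    _ ≤ (2 * n.natAbs * T ^ 3 / K) ^ 4 := by gcongr
    _ = 16 * n.natAbs ^ 4 * (T ^ 4) ^ 3 / K ^ 4 := by ring
    _ ≤ 16 * n.natAbs ^ 4 * (100 ^ 16 * K) ^ 3 / K ^ 4 := by gcongr
    _ = _ := by field_simp

/-- Kloosterman sums with nonzero second frequency are `o(K)`, uniformly in the first. -/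
lemma exists_kloosterman_le {n : ℤ} (hn : n ≠ 0) {ε : ℝ} (hε : 0 < ε) :
    ∃ K₀ : ℕ, ∀ (K : ℕ) [NeZero K], K₀ ≤ K → ∀ m : ZMod K, ‖kloosterman K m n‖ ≤ ε * K := by
  obtain ⟨K₀, hK₀⟩ := exists_nat_ge (16 * (n.natAbs : ℝ) ^ 4 * (100 ^ 16) ^ 3 / ε ^ 16)
  refine ⟨K₀, fun K _ hK m => ?_⟩
  have hKpos : (0 : ℝ) < K := Nat.cast_pos.2 (Nat.pos_of_ne_zero (NeZero.ne K))
  rw [← div_le_iff₀ hKpos]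
  refine le_of_pow_le_pow_left₀ (n := 16) (by norm_num) hε.le
    ((kloosterman_pow_sixteen_le K m hn).trans ?_)
  rw [div_le_iff₀ hKpos]
  have : (K₀ : ℝ) ≤ K := Nat.cast_le.2 hK
  rw [div_le_iff₀ (by positivity)] at hK₀
  nlinarith [pow_pos hε 16]

lemma sum_norm_sq_stdAddChar (K : ℕ) [NeZero K] (S : Finset (ZMod K)) :
    ∑ m : ZMod K, ‖∑ s ∈ S, ZMod.stdAddChar (-(m * s))‖ ^ 2 = (K : ℝ) * S.card := by
  have key : ∀ m : ZMod K, ((‖∑ s ∈ S, ZMod.stdAddChar (-(m * s))‖ ^ 2 : ℝ) : ℂ) =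
      ∑ s ∈ S, ∑ s' ∈ S, ZMod.stdAddChar (m * (s' - s)) := by
    intro m
    push_cast
    rw [← Complex.mul_conj', map_sum, Finset.sum_mul_sum]
    refine Finset.sum_congr rfl fun s _ => Finset.sum_congr rfl fun s' _ => ?_
    rw [← AddChar.map_neg_eq_conj, ← AddChar.map_add_eq_mul]
    congr 1; ring
  apply Complex.ofReal_injective
  rw [Complex.ofReal_sum]
  simp_rw [key]
  rw [Finset.sum_comm, Finset.sum_congr rfl fun s _ => Finset.sum_comm]
  simp_rw [sum_stdAddChar_mul, sub_eq_zero]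
  simp [mul_comm]

/-- The inverse phase `ψ(n x⁻¹)` on `ZMod K`, extended by zero off the units. -/
noncomputable def zmodPhase (K : ℕ) [NeZero K] (n x : ZMod K) : ℂ :=
  ∑ u : (ZMod K)ˣ, if (u : ZMod K) = x then
    ZMod.stdAddChar (n * ((u⁻¹ : (ZMod K)ˣ) : ZMod K)) else 0

lemma zmodPhase_units (K : ℕ) [NeZero K] (n : ZMod K) (u : (ZMod K)ˣ) :
    zmodPhase K n u = ZMod.stdAddChar (n * ((u⁻¹ : (ZMod K)ˣ) : ZMod K)) := by
  simp [zmodPhase, Units.val_inj]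

lemma zmodPhase_of_not_isUnit (K : ℕ) [NeZero K] (n : ZMod K) {x : ZMod K} (hx : ¬ IsUnit x) :
    zmodPhase K n x = 0 := by
  refine Finset.sum_eq_zero fun u _ => if_neg ?_
  rintro rfl
  exact hx u.isUnit

lemma norm_zmodPhase_le (K : ℕ) [NeZero K] (n x : ZMod K) : ‖zmodPhase K n x‖ ≤ 1 := by
  by_cases hx : IsUnit x
  · obtain ⟨u, rfl⟩ := hx
    rw [zmodPhase_units, AddChar.norm_apply]
  · simp [zmodPhase_of_not_isUnit K n hx]

lemma mul_zmodPhase (K : ℕ) [NeZero K] (n x : ZMod K) :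
    (K : ℂ) * zmodPhase K n x = ∑ m : ZMod K, kloosterman K m n * ZMod.stdAddChar (-(m * x)) := by
  simp_rw [kloosterman, Finset.sum_mul]
  rw [Finset.sum_comm, zmodPhase, Finset.mul_sum]
  refine Finset.sum_congr rfl fun u _ => ?_
  have : ∀ m : ZMod K, ZMod.stdAddChar (m * (u : ZMod K) + n * ((u⁻¹ : (ZMod K)ˣ) : ZMod K)) *
      ZMod.stdAddChar (-(m * x)) = ZMod.stdAddChar (n * ((u⁻¹ : (ZMod K)ˣ) : ZMod K)) *
      ZMod.stdAddChar (m * ((u : ZMod K) - x)) := by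
    intro m
    rw [← AddChar.map_add_eq_mul, ← AddChar.map_add_eq_mul]
    congr 1; ring
  simp_rw [this, ← Finset.mul_sum, sum_stdAddChar_mul, sub_eq_zero]
  split_ifs <;> simp [mul_comm]

lemma norm_bilinear_zmodPhase_le (K : ℕ) [NeZero K] (n : ZMod K) {E : ℝ}
    (hE : ∀ m, ‖kloosterman K m n‖ ≤ E) (S T : Finset (ZMod K)) :
    ‖∑ s ∈ S, ∑ t ∈ T, zmodPhase K n (s + t)‖ ≤ E * √(S.card * T.card) := by
  have hK : (0 : ℝ) < K := Nat.cast_pos.2 (Nat.pos_of_ne_zero (NeZero.ne K))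
  have hE0 : 0 ≤ E := (norm_nonneg _).trans (hE 0)
  have h1 : (K : ℂ) * ∑ s ∈ S, ∑ t ∈ T, zmodPhase K n (s + t) =
      ∑ m : ZMod K, kloosterman K m n * ((∑ s ∈ S, ZMod.stdAddChar (-(m * s))) *
        (∑ t ∈ T, ZMod.stdAddChar (-(m * t)))) := by
    simp_rw [Finset.mul_sum, mul_zmodPhase]
    rw [Finset.sum_congr rfl fun s _ => Finset.sum_comm, Finset.sum_comm]
    refine Finset.sum_congr rfl fun m _ => ?_
    rw [Finset.sum_comm]
    refine Finset.sum_congr rfl fun t _ => ?_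
    rw [Finset.sum_mul, Finset.mul_sum]
    refine Finset.sum_congr rfl fun s _ => ?_
    rw [← AddChar.map_add_eq_mul]
    congr 2; ring
  have h2 : (K : ℝ) * ‖∑ s ∈ S, ∑ t ∈ T, zmodPhase K n (s + t)‖ ≤
      K * (E * √(S.card * T.card)) := by
    calc (K : ℝ) * ‖∑ s ∈ S, ∑ t ∈ T, zmodPhase K n (s + t)‖
        = ‖(K : ℂ) * ∑ s ∈ S, ∑ t ∈ T, zmodPhase K n (s + t)‖ := by simp
      _ ≤ ∑ m : ZMod K, E * (‖∑ s ∈ S, ZMod.stdAddChar (-(m * s))‖ *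
            ‖∑ t ∈ T, ZMod.stdAddChar (-(m * t))‖) := by
          rw [h1]
          refine (norm_sum_le _ _).trans (Finset.sum_le_sum fun m _ => ?_)
          rw [norm_mul, norm_mul]
          exact mul_le_mul_of_nonneg_right (hE m) (by positivity)
      _ = E * ∑ m : ZMod K, ‖∑ s ∈ S, ZMod.stdAddChar (-(m * s))‖ *
            ‖∑ t ∈ T, ZMod.stdAddChar (-(m * t))‖ := by rw [Finset.mul_sum]
      _ ≤ E * (√(∑ m : ZMod K, ‖∑ s ∈ S, ZMod.stdAddChar (-(m * s))‖ ^ 2) *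
            √(∑ m : ZMod K, ‖∑ t ∈ T, ZMod.stdAddChar (-(m * t))‖ ^ 2)) := by
          gcongr
          exact Real.sum_mul_le_sqrt_mul_sqrt _ _ _
      _ = K * (E * √(S.card * T.card)) := by
          rw [sum_norm_sq_stdAddChar, sum_norm_sq_stdAddChar, ← Real.sqrt_mul (by positivity),
            show (K : ℝ) * S.card * (K * T.card) = K ^ 2 * (S.card * T.card) by ring,
            Real.sqrt_mul (by positivity), Real.sqrt_sq hK.le]
          ring
  exact le_of_mul_le_mul_left h2 hK

lemma norm_sum_range_sub_shift_le (f : ℕ → ℂ) (hf : ∀ j, ‖f j‖ ≤ 1) (M h : ℕ) :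
    ‖∑ j ∈ Finset.range M, f j - ∑ j ∈ Finset.range M, f (j + h)‖ ≤ 2 * h := by
  have h1 := Finset.sum_range_add f M h
  have h2 := Finset.sum_range_add f h M
  rw [add_comm h M] at h2
  have h3 : ∑ j ∈ Finset.range M, f j - ∑ j ∈ Finset.range M, f (j + h) =
      ∑ j ∈ Finset.range h, f j - ∑ j ∈ Finset.range h, f (M + j) := by
    simp_rw [add_comm _ h]
    linear_combination h2 - h1
  rw [h3]
  have h4 : ∀ g : ℕ → ℂ, (∀ j, ‖g j‖ ≤ 1) → ‖∑ j ∈ Finset.range h, g j‖ ≤ h := fun g hg =>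
    (norm_sum_le_of_le _ fun j _ => hg j).trans (by simp)
  calc _ ≤ _ := norm_sub_le _ _
    _ ≤ (h : ℝ) + h := add_le_add (h4 _ hf) (h4 _ fun j => hf _)
    _ = _ := by ring

lemma natCast_injOn_range {K M : ℕ} [NeZero K] (hM : M ≤ K) (j₀ : ZMod K) :
    Set.InjOn (fun j : ℕ => j₀ + (j : ZMod K)) (Finset.range M) := by
  intro a ha b hb hab
  simp only [Finset.coe_range, Set.mem_Iio] at ha hb
  have : (a : ZMod K) = b := by simpa using hab
  rw [ZMod.natCast_eq_natCast_iff'] at this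
  rwa [Nat.mod_eq_of_lt (by omega), Nat.mod_eq_of_lt (by omega)] at this

lemma exists_short_sum_zmodPhase_le {n : ℤ} (hn : n ≠ 0) {ε : ℝ} (hε : 0 < ε) :
    ∃ K₀ : ℕ, ∀ (K : ℕ) [NeZero K], K₀ ≤ K → ∀ (j₀ : ZMod K) (M : ℕ), M ≤ K →
      ‖∑ j ∈ Finset.range M, zmodPhase K n (j₀ + (j : ZMod K))‖ ≤ ε * K := by
  set η : ℝ := min ε 1 / 8 with hη
  have hη0 : 0 < η := by positivity
  have hη1 : η ≤ 1 := by have := min_le_right ε 1; linarith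
  have hηε : 5 * η ≤ ε := by have := min_le_left ε 1; linarith
  obtain ⟨K₁, hK₁⟩ := exists_kloosterman_le hn (ε := η ^ 2) (by positivity)
  obtain ⟨K₂, hK₂⟩ := exists_nat_ge (1 / η)
  refine ⟨max K₁ K₂, fun K _ hK j₀ M hM => ?_⟩
  have hKK₂ : (K₂ : ℝ) ≤ K := Nat.cast_le.2 ((le_max_right _ _).trans hK)
  have hηK : 1 ≤ η * K := by
    rw [div_le_iff₀ hη0] at hK₂
    nlinarith
  have hKpos : (0 : ℝ) < K := Nat.cast_pos.2 (Nat.pos_of_ne_zero (NeZero.ne K))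
  set H : ℕ := ⌈η * K⌉₊ with hH
  have hH1 : η * K ≤ H := Nat.le_ceil _
  have hH2 : (H : ℝ) < η * K + 1 := Nat.ceil_lt_add_one (by positivity)
  have hHK : H ≤ K := Nat.ceil_le.2 (by nlinarith)
  have hHpos : (0 : ℝ) < H := lt_of_lt_of_le (by positivity) hH1
  set f : ℕ → ℂ := fun j => zmodPhase K n (j₀ + (j : ZMod K)) with hf
  have hf1 : ∀ j, ‖f j‖ ≤ 1 := fun j => norm_zmodPhase_le _ _ _
  have hbil : ‖∑ h ∈ Finset.range H, ∑ j ∈ Finset.range M, f (j + h)‖ ≤ η * K * H := by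
    have h1 := norm_bilinear_zmodPhase_le K n (hK₁ K ((le_max_left _ _).trans hK))
      ((Finset.range H).image fun h : ℕ => (0 : ZMod K) + (h : ZMod K))
      ((Finset.range M).image fun j : ℕ => j₀ + (j : ZMod K))
    rw [Finset.sum_image (natCast_injOn_range hHK 0),
      Finset.card_image_of_injOn (natCast_injOn_range hHK 0),
      Finset.card_image_of_injOn (natCast_injOn_range hM j₀)] at h1
    simp_rw [Finset.sum_image (natCast_injOn_range hM j₀)] at h1
    simp only [Finset.card_range] at h1
    have h2 : ∑ h ∈ Finset.range H, ∑ j ∈ Finset.range M, f (j + h) =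
        ∑ h ∈ Finset.range H, ∑ j ∈ Finset.range M,
          zmodPhase K n (0 + (h : ZMod K) + (j₀ + (j : ZMod K))) := by
      refine Finset.sum_congr rfl fun h _ => Finset.sum_congr rfl fun j _ => ?_
      simp only [hf]
      congr 1; push_cast; ring
    rw [h2]
    refine h1.trans ?_
    have h3 : √((H : ℝ) * M) ≤ H / η := by
      rw [Real.sqrt_le_left (by positivity), div_pow, le_div_iff₀ (by positivity)]
      have : (M : ℝ) ≤ K := Nat.cast_le.2 hM
      calc (H : ℝ) * M * η ^ 2 ≤ H * K * η ^ 2 := by gcongr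
        _ = H * (η * K) * η := by ring
        _ ≤ H * H * 1 := by gcongr
        _ = _ := by ring
    calc _ ≤ η ^ 2 * K * (H / η) := by gcongr
      _ = _ := by field_simp
  have hdiff : ‖(H : ℂ) * ∑ j ∈ Finset.range M, f j -
      ∑ h ∈ Finset.range H, ∑ j ∈ Finset.range M, f (j + h)‖ ≤ H * (2 * H) := by
    have : (H : ℂ) * ∑ j ∈ Finset.range M, f j = ∑ h ∈ Finset.range H, ∑ j ∈ Finset.range M, f j := by
      simp
    rw [this, ← Finset.sum_sub_distrib]
    refine (norm_sum_le_of_le _ (f := fun h => ∑ j ∈ Finset.range M, f j -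
      ∑ j ∈ Finset.range M, f (j + h)) (n := fun _ => 2 * (H : ℝ)) fun h hh => ?_).trans (by simp)
    refine (norm_sum_range_sub_shift_le f hf1 M h).trans ?_
    have : (h : ℝ) ≤ H := Nat.cast_le.2 (Finset.mem_range.1 hh).le
    linarith
  have htot : (H : ℝ) * ‖∑ j ∈ Finset.range M, f j‖ ≤ H * (ε * K) := by
    calc (H : ℝ) * ‖∑ j ∈ Finset.range M, f j‖ = ‖(H : ℂ) * ∑ j ∈ Finset.range M, f j‖ := by simp
      _ ≤ _ := norm_le_norm_sub_add _ (∑ h ∈ Finset.range H, ∑ j ∈ Finset.range M, f (j + h))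
      _ ≤ H * (2 * H) + η * K * H := add_le_add hdiff hbil
      _ = H * (2 * H + η * K) := by ring
      _ ≤ H * (ε * K) := by
        gcongr
        nlinarith
  exact le_of_mul_le_mul_left htot hHpos

/-- Sums of the inverse phase over arbitrary intervals of integers are `o(K + M)`. -/
lemma exists_sum_zmodPhase_le {n : ℤ} (hn : n ≠ 0) {ε : ℝ} (hε : 0 < ε) :
    ∃ K₀ : ℕ, ∀ (K : ℕ) [NeZero K], K₀ ≤ K → ∀ (M : ℕ) (j₀ : ZMod K),
      ‖∑ j ∈ Finset.range M, zmodPhase K n (j₀ + (j : ZMod K))‖ ≤ ε * (K + M) := by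
  obtain ⟨K₀, h⟩ := exists_short_sum_zmodPhase_le hn hε
  refine ⟨K₀, fun K _ hK M => ?_⟩
  induction M using Nat.strong_induction_on with
  | _ M ih =>
    intro j₀
    rcases le_or_gt M K with hM | hM
    · refine (h K hK j₀ M hM).trans ?_
      gcongr
      simp
    · obtain ⟨N, rfl⟩ := Nat.exists_eq_add_of_le hM.le
      rw [Finset.sum_range_add]
      have hKpos := Nat.pos_of_ne_zero (NeZero.ne K)
      have h1 := ih N (by omega) j₀
      have h2 := h K hK j₀ K le_rfl
      have h3 : ∑ j ∈ Finset.range N, zmodPhase K n (j₀ + ((K + j : ℕ) : ZMod K)) =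
          ∑ j ∈ Finset.range N, zmodPhase K n (j₀ + (j : ZMod K)) := by simp
      rw [h3]
      refine (norm_add_le _ _).trans ((add_le_add h2 h1).trans (le_of_eq ?_))
      push_cast; ring

/-- The phase `exp (2πi n d̄ / c)`, where `d̄` is an inverse of `d` modulo `c`; it is zero when `c`
and `d` are not coprime. -/
noncomputable def intPhase (n c d : ℤ) : ℂ :=
  if Int.gcd c d = 1 then Complex.exp (2 * Real.pi * Complex.I * (n * Int.gcdB c d / c)) else 0

lemma norm_intPhase_le (n c d : ℤ) : ‖intPhase n c d‖ ≤ 1 := by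
  unfold intPhase
  split_ifs
  · rw [show (2 * Real.pi * Complex.I * (n * Int.gcdB c d / c) : ℂ) =
      ((2 * Real.pi * (n * Int.gcdB c d / c) : ℝ) : ℂ) * Complex.I by push_cast; ring,
      Complex.norm_exp_ofReal_mul_I]
  · simp

lemma exp_two_pi_mul_div_congr {c m m' : ℤ} (hc : c ≠ 0) (h : c ∣ m' - m) :
    Complex.exp (2 * Real.pi * Complex.I * ((m : ℂ) / c)) =
      Complex.exp (2 * Real.pi * Complex.I * ((m' : ℂ) / c)) := by
  obtain ⟨l, hl⟩ := h
  have hc' : (c : ℂ) ≠ 0 := by exact_mod_cast hc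
  have h' : (m' : ℂ) = m + c * l := by
    have : m' = m + c * l := by linarith
    exact_mod_cast this
  refine Complex.exp_eq_exp_iff_exists_int.2 ⟨-l, ?_⟩
  rw [h']
  field_simp
  push_cast
  ring

lemma intPhase_eq {n c d a b : ℤ} (hc : c ≠ 0) (h : a * d - b * c = 1) :
    intPhase n c d = Complex.exp (2 * Real.pi * Complex.I * (n * a / c)) := by
  have hg : Int.gcd c d = 1 := by
    rw [← Int.isCoprime_iff_gcd_eq_one]
    exact ⟨-b, a, by linarith⟩
  rw [intPhase, if_pos hg]
  have h1 := Int.gcd_eq_gcd_ab c d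
  rw [hg] at h1
  push_cast at h1
  have := exp_two_pi_mul_div_congr (m := n * Int.gcdB c d) (m' := n * a) hc ?_
  · push_cast at this; exact this
  · refine ⟨n * (a * Int.gcdA c d + b * Int.gcdB c d) , ?_⟩
    generalize Int.gcdB c d = x at *
    generalize Int.gcdA c d = z at *
    have : a - x = c * (a * z + b * x) := by
      linear_combination a * h1 + x * h
    linear_combination n * this

lemma intPhase_of_gcd_ne_one {n c d : ℤ} (h : Int.gcd c d ≠ 1) : intPhase n c d = 0 := if_neg h

lemma intPhase_neg_left (n : ℤ) {c : ℤ} (hc : c ≠ 0) (d : ℤ) :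
    intPhase n (-c) d = intPhase (-n) c d := by
  by_cases hg : Int.gcd c d = 1
  · obtain ⟨u, v, huv⟩ := Int.isCoprime_iff_gcd_eq_one.2 hg
    rw [intPhase_eq (a := v) (b := u) (neg_ne_zero.2 hc) (by linarith),
      intPhase_eq (a := v) (b := -u) hc (by linarith)]
    push_cast
    rw [div_neg, neg_mul, neg_div]
  · rw [intPhase_of_gcd_ne_one hg, intPhase_of_gcd_ne_one (by rwa [Int.neg_gcd])]

lemma intPhase_neg_right (n : ℤ) {c : ℤ} (hc : c ≠ 0) (d : ℤ) :
    intPhase n c (-d) = intPhase (-n) c d := by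
  by_cases hg : Int.gcd c d = 1
  · obtain ⟨u, v, huv⟩ := Int.isCoprime_iff_gcd_eq_one.2 hg
    rw [intPhase_eq (a := -v) (b := -u) hc (by linarith),
      intPhase_eq (a := v) (b := -u) hc (by linarith)]
    push_cast
    rw [neg_mul, mul_neg]
  · rw [intPhase_of_gcd_ne_one hg, intPhase_of_gcd_ne_one (by rwa [Int.gcd_neg])]

lemma intPhase_eq_zmodPhase (K : ℕ) [NeZero K] (n d : ℤ) :
    intPhase n K d = zmodPhase K n (d : ZMod K) := by
  have hK : (K : ℤ) ≠ 0 := by exact_mod_cast NeZero.ne K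
  by_cases hg : Int.gcd K d = 1
  · obtain ⟨u, v, huv⟩ := Int.isCoprime_iff_gcd_eq_one.2 hg
    have h1 : (d : ZMod K) * (v : ZMod K) = 1 := by
      have := congrArg (Int.cast : ℤ → ZMod K) huv
      push_cast at this
      simpa [mul_comm] using this
    let w : (ZMod K)ˣ := ⟨d, v, h1, by rw [mul_comm]; exact h1⟩
    have h2 : (d : ZMod K) = (w : ZMod K) := rfl
    have h3 : ((w⁻¹ : (ZMod K)ˣ) : ZMod K) = (v : ZMod K) := rfl
    rw [h2, zmodPhase_units, h3, intPhase_eq (a := v) (b := -u) hK (by linarith)]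
    rw [show (n : ZMod K) * (v : ZMod K) = ((n * v : ℤ) : ZMod K) by push_cast; rfl,
      ZMod.stdAddChar_coe]
    push_cast
    congr 1
    ring
  · rw [intPhase_of_gcd_ne_one hg, zmodPhase_of_not_isUnit]
    intro hu
    apply hg
    rw [Int.gcd_comm]
    exact Int.isCoprime_iff_gcd_eq_one.1 ((ZMod.coe_int_isUnit_iff_isCoprime d K).1 hu).symm

/-- The effect of a unimodular substitution on the phase. -/
lemma intPhase_unimodular {n k j q r s t : ℤ} (hM : r * t - s * q = 1) (hk : k ≠ 0)
    (hc : j * q - k * t ≠ 0) :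
    intPhase n (j * q - k * t) (j * r - k * s) =
      intPhase (-n) k j * Complex.exp (2 * Real.pi * Complex.I * (n * q / (k * (j * q - k * t : ℤ)))) := by
  by_cases hg : Int.gcd k j = 1
  · obtain ⟨v, u, huv⟩ := Int.isCoprime_iff_gcd_eq_one.2 hg
    rw [intPhase_eq (a := q * v + u * t) (b := r * v + u * s) hc (by
      linear_combination (v * k + u * j) * hM + huv),
      intPhase_eq (a := u) (b := -v) hk (by linarith), ← Complex.exp_add]
    congr 1
    have hk' : (k : ℂ) ≠ 0 := by exact_mod_cast hk
    have hc' : ((j * q - k * t : ℤ) : ℂ) ≠ 0 := by exact_mod_cast hc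
    have huv' : (v * k + u * j : ℂ) = 1 := by exact_mod_cast huv
    have h2 : (((q * v + u * t : ℤ)) : ℂ) * k = q - u * (j * q - k * t : ℤ) := by
      push_cast
      linear_combination q * huv'
    generalize (j * q - k * t : ℤ) = c at *
    generalize (q * v + u * t : ℤ) = a at *
    rw [← mul_add]
    congr 1
    rw [eq_comm, ← eq_sub_iff_add_eq']
    field_simp
    push_cast
    linear_combination -n * h2
  · rw [intPhase_of_gcd_ne_one hg, zero_mul, intPhase_of_gcd_ne_one]
    intro h
    apply hg
    obtain ⟨u, v, huv⟩ := Int.isCoprime_iff_gcd_eq_one.2 h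
    exact Int.isCoprime_iff_gcd_eq_one.1 ⟨-(u * t) - v * s, u * q + v * r, by
      linear_combination huv⟩

lemma exists_eq_image_range_of_ordConnected {J : Finset ℤ} (hJ : (J : Set ℤ).OrdConnected) :
    ∃ m : ℤ, J = (Finset.range J.card).image fun i : ℕ => m + i := by
  rcases J.eq_empty_or_nonempty with rfl | hne
  · exact ⟨0, by simp⟩
  · refine ⟨J.min' hne, ?_⟩
    have hJ' : J = Finset.Icc (J.min' hne) (J.max' hne) := by
      ext x
      rw [Finset.mem_Icc]
      exact ⟨fun hx => ⟨J.min'_le x hx, J.le_max' x hx⟩, fun hx =>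
        hJ.out (J.min'_mem hne) (J.max'_mem hne) hx⟩
    have hle : J.min' hne ≤ J.max' hne := J.min'_le _ (J.max'_mem hne)
    have hcard : (J.card : ℤ) = J.max' hne + 1 - J.min' hne := by
      conv_lhs => rw [hJ']
      rw [Int.card_Icc, Int.toNat_of_nonneg (by linarith)]
    conv_lhs => rw [hJ']
    ext x
    simp only [Finset.mem_Icc, Finset.mem_image, Finset.mem_range]
    constructor
    · rintro ⟨h1, h2⟩
      exact ⟨(x - J.min' hne).toNat, by omega, by omega⟩
    · rintro ⟨i, hi, rfl⟩
      omega

lemma exists_sum_intPhase_le {n : ℤ} (hn : n ≠ 0) {ε : ℝ} (hε : 0 < ε) :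
    ∃ K₀ : ℕ, 1 ≤ K₀ ∧ ∀ k : ℤ, (K₀ : ℤ) ≤ |k| → ∀ J : Finset ℤ, (J : Set ℤ).OrdConnected →
      ‖∑ j ∈ J, intPhase n k j‖ ≤ ε * (|(k : ℝ)| + J.card) := by
  obtain ⟨K₁, h₁⟩ := exists_sum_zmodPhase_le hn hε
  obtain ⟨K₂, h₂⟩ := exists_sum_zmodPhase_le (neg_ne_zero.2 hn) hε
  refine ⟨max 1 (max K₁ K₂), le_max_left _ _, fun k hk J hJ => ?_⟩
  have key : ∀ (n' : ℤ) (K : ℕ), 1 ≤ K → (∀ [NeZero K], ∀ (M : ℕ) (j₀ : ZMod K),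
      ‖∑ j ∈ Finset.range M, zmodPhase K n' (j₀ + (j : ZMod K))‖ ≤ ε * (K + M)) →
      ‖∑ j ∈ J, intPhase n' K j‖ ≤ ε * ((K : ℝ) + J.card) := by
    intro n' K hK h
    have : NeZero K := ⟨by omega⟩
    obtain ⟨m, hm⟩ := exists_eq_image_range_of_ordConnected hJ
    have := h J.card (m : ZMod K)
    rw [show ∑ j ∈ J, intPhase n' K j = ∑ j ∈ Finset.range J.card, zmodPhase K n'
      ((m : ZMod K) + (j : ZMod K)) by
        conv_lhs => rw [hm]
        rw [Finset.sum_image (by intro x _ y _ hxy; simpa using hxy)]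
        refine Finset.sum_congr rfl fun i _ => ?_
        rw [intPhase_eq_zmodPhase]; push_cast; rfl]
    exact this
  have hk' : max 1 (max K₁ K₂) ≤ k.natAbs := by
    rw [Int.abs_eq_natAbs] at hk; exact_mod_cast hk
  simp only [max_le_iff] at hk'
  have habs : |(k : ℝ)| = (k.natAbs : ℝ) := by rw [Nat.cast_natAbs]; push_cast; rfl
  rw [habs]
  rcases Int.natAbs_eq k with h | h
  · have := key n k.natAbs hk'.1 (fun M j₀ => h₁ _ hk'.2.1 M j₀)
    rwa [← h] at this
  · have := key (-n) k.natAbs hk'.1 (fun M j₀ => h₂ _ hk'.2.2 M j₀)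
    rwa [Finset.sum_congr rfl fun j _ => show intPhase (-n) k.natAbs j = intPhase n k j by
      conv_rhs => rw [h]
      exact (intPhase_neg_left _ (by omega) _).symm] at this

/-- The sum of the phases of denominator `c` over the fractions `d / c` in `(α, β]`. -/
noncomputable def window (n : ℤ) (α β : ℝ) (c : ℕ) : ℂ :=
  ∑ d ∈ Finset.Ioc ⌊(c : ℝ) * α⌋ ⌊(c : ℝ) * β⌋, intPhase n c d

lemma card_window_le {α β : ℝ} (h : α ≤ β) (c : ℕ) :
    ((Finset.Ioc ⌊(c : ℝ) * α⌋ ⌊(c : ℝ) * β⌋).card : ℝ) ≤ c * (β - α) + 1 := by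
  have hle : ⌊(c : ℝ) * α⌋ ≤ ⌊(c : ℝ) * β⌋ :=
    Int.floor_le_floor (mul_le_mul_of_nonneg_left h (Nat.cast_nonneg c))
  have h1 : (((Finset.Ioc ⌊(c : ℝ) * α⌋ ⌊(c : ℝ) * β⌋).card : ℤ) : ℝ) =
      (⌊(c : ℝ) * β⌋ : ℝ) - ⌊(c : ℝ) * α⌋ := by
    rw [Int.card_Ioc, Int.toNat_of_nonneg (by linarith)]
    push_cast; ring
  have h2 := Int.floor_le ((c : ℝ) * β)
  have h3 := Int.lt_floor_add_one ((c : ℝ) * α)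
  have h4 : ((Finset.Ioc ⌊(c : ℝ) * α⌋ ⌊(c : ℝ) * β⌋).card : ℝ) =
    (((Finset.Ioc ⌊(c : ℝ) * α⌋ ⌊(c : ℝ) * β⌋).card : ℤ) : ℝ) := by push_cast; rfl
  rw [h4, h1]
  linarith

lemma norm_window_le (n : ℤ) {α β : ℝ} (h : α ≤ β) (c : ℕ) :
    ‖window n α β c‖ ≤ c * (β - α) + 1 := by
  refine le_trans ?_ (card_window_le h c)
  refine (norm_sum_le _ _).trans ((Finset.sum_le_sum fun _ _ => norm_intPhase_le _ _ _).trans ?_)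
  simp

lemma mem_window {α β : ℝ} {c : ℕ} {d : ℤ} :
    d ∈ Finset.Ioc ⌊(c : ℝ) * α⌋ ⌊(c : ℝ) * β⌋ ↔ (c : ℝ) * α < d ∧ (d : ℝ) ≤ c * β := by
  rw [Finset.mem_Ioc, Int.floor_lt, Int.le_floor]

/-- The fractions with denominator at most `X` in `(α, β]`, as pairs. -/
noncomputable def points (X : ℕ) (α β : ℝ) : Finset (Σ _ : ℕ, ℤ) :=
  (Finset.Icc 1 X).sigma fun c : ℕ => Finset.Ioc ⌊(c : ℝ) * α⌋ ⌊(c : ℝ) * β⌋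

lemma mem_points {X : ℕ} {α β : ℝ} {p : Σ _ : ℕ, ℤ} :
    p ∈ points X α β ↔ (1 ≤ p.1 ∧ p.1 ≤ X) ∧ (p.1 : ℝ) * α < p.2 ∧ (p.2 : ℝ) ≤ p.1 * β := by
  rw [points, Finset.mem_sigma, mem_window, Finset.mem_Icc]

lemma card_points_le {α β : ℝ} (h : α ≤ β) (X : ℕ) :
    ((points X α β).card : ℝ) ≤ (β - α) * X ^ 2 + X := by
  rw [points, Finset.card_sigma, Nat.cast_sum]
  calc ∑ c ∈ Finset.Icc 1 X, ((Finset.Ioc ⌊(c : ℝ) * α⌋ ⌊(c : ℝ) * β⌋).card : ℝ)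
      ≤ ∑ c ∈ Finset.Icc 1 X, (X * (β - α) + 1) := by
        refine Finset.sum_le_sum fun c hc => (card_window_le h c).trans ?_
        have : (c : ℝ) ≤ X := by exact_mod_cast (Finset.mem_Icc.1 hc).2
        have h0 : 0 ≤ β - α := sub_nonneg.2 h
        gcongr
    _ = _ := by
        rw [Finset.sum_const, Nat.card_Icc, nsmul_eq_mul, Nat.add_sub_cancel]; ring

lemma sum_window_eq (n : ℤ) (α β : ℝ) (X : ℕ) :
    ∑ c ∈ Finset.Icc 1 X, window n α β c = ∑ p ∈ points X α β, intPhase n p.1 p.2 := by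
  rw [points, Finset.sum_sigma]; rfl

lemma add_mul_mem_of_le {u v x y z : ℝ} (hxy : x ≤ y) (hyz : y ≤ z) {b : ℝ} :
    (b < u + x * v → b < u + z * v → b < u + y * v) ∧
      (u + x * v ≤ b → u + z * v ≤ b → u + y * v ≤ b) := by
  rcases le_total 0 v with h | h
  · have h1 := mul_le_mul_of_nonneg_right hxy h
    have h2 := mul_le_mul_of_nonneg_right hyz h
    exact ⟨fun _ _ => by linarith, fun _ _ => by linarith⟩
  · have h1 := mul_le_mul_of_nonpos_right hxy h
    have h2 := mul_le_mul_of_nonpos_right hyz h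
    exact ⟨fun _ _ => by linarith, fun _ _ => by linarith⟩

section fiber

variable {q r s t : ℤ}

/-- Points on the line `d q - c r = k`. -/
noncomputable def fiber (X : ℕ) (α β : ℝ) (q r k : ℤ) : Finset (Σ _ : ℕ, ℤ) :=
  (points X α β).filter fun p => p.2 * q - p.1 * r = k

lemma card_fiber_le (X : ℕ) (α β : ℝ) (hq : 1 ≤ q) (k : ℤ) :
    (fiber X α β q r k).card ≤ X := by
  have h : (fiber X α β q r k).card ≤ (Finset.Icc 1 X).card := by
    refine Finset.card_le_card_of_injOn (fun p => p.1) (fun p hp => ?_) ?_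
    · simpa using (mem_points.1 (Finset.mem_filter.1 hp).1).1
    · rintro ⟨c, d⟩ hp ⟨c', d'⟩ hp' (h : c = c')
      subst h
      have h1 := (Finset.mem_filter.1 hp).2
      have h2 := (Finset.mem_filter.1 hp').2
      simp only at h1 h2
      have h3 : d * q = d' * q := by linarith
      rw [mul_right_cancel₀ (by omega) h3]
  simpa using h

lemma eq_of_mem_fiber {X : ℕ} {α β : ℝ} (hM : r * t - s * q = 1) {k : ℤ} {p : Σ _ : ℕ, ℤ}
    (hp : p ∈ fiber X α β q r k) :
    (p.1 : ℤ) = (p.2 * t - p.1 * s) * q - k * t ∧ p.2 = (p.2 * t - p.1 * s) * r - k * s := by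
  have h1 := (Finset.mem_filter.1 hp).2
  constructor
  · linear_combination -(p.1 : ℤ) * hM - t * h1
  · linear_combination -(p.2 : ℤ) * hM - s * h1

lemma injOn_fiber (X : ℕ) (α β : ℝ) (hM : r * t - s * q = 1) (k : ℤ) :
    Set.InjOn (fun p : Σ _ : ℕ, ℤ => p.2 * t - p.1 * s) (fiber X α β q r k) := by
  intro p hp p' hp' h
  have h1 := eq_of_mem_fiber hM hp
  have h2 := eq_of_mem_fiber hM hp'
  simp only at h
  rw [h] at h1
  have h3 : (p.1 : ℤ) = p'.1 := h1.1.trans h2.1.symm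
  have h4 : p.2 = p'.2 := h1.2.trans h2.2.symm
  exact Sigma.ext (by exact_mod_cast h3) (heq_of_eq h4)

lemma ordConnected_image_fiber (X : ℕ) (α β : ℝ) (hq : 1 ≤ q) (hM : r * t - s * q = 1) (k : ℤ) :
    (((fiber X α β q r k).image fun p => p.2 * t - p.1 * s : Finset ℤ) : Set ℤ).OrdConnected := by
  have key : ∀ p ∈ fiber X α β q r k, ∀ p' ∈ fiber X α β q r k, ∀ x : ℤ,
      p.2 * t - p.1 * s ≤ x → x ≤ p'.2 * t - p'.1 * s →
      ∃ p'' ∈ fiber X α β q r k, p''.2 * t - p''.1 * s = x := by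
    intro p hp p' hp' x h1 h2
    obtain ⟨a1, a2⟩ := eq_of_mem_fiber hM hp
    obtain ⟨b1, b2⟩ := eq_of_mem_fiber hM hp'
    obtain ⟨⟨a3, a4⟩, a5, a6⟩ := mem_points.1 (Finset.mem_filter.1 hp).1
    obtain ⟨⟨b3, b4⟩, b5, b6⟩ := mem_points.1 (Finset.mem_filter.1 hp').1
    generalize p.2 * t - p.1 * s = y at *
    generalize p'.2 * t - p'.1 * s = z at *
    have c1 : 1 ≤ x * q - k * t := by
      have : y * q ≤ x * q := mul_le_mul_of_nonneg_right h1 (by omega)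
      have : (1 : ℤ) ≤ p.1 := by exact_mod_cast a3
      linarith
    have c2 : x * q - k * t ≤ X := by
      have : x * q ≤ z * q := mul_le_mul_of_nonneg_right h2 (by omega)
      have : (p'.1 : ℤ) ≤ X := by exact_mod_cast b4
      linarith
    obtain ⟨c, hc⟩ := Int.eq_ofNat_of_zero_le (show 0 ≤ x * q - k * t by omega)
    have a1' : (p.1 : ℝ) = y * q - k * t := by exact_mod_cast a1
    have a2' : (p.2 : ℝ) = y * r - k * s := by exact_mod_cast a2
    have b1' : (p'.1 : ℝ) = z * q - k * t := by exact_mod_cast b1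
    have b2' : (p'.2 : ℝ) = z * r - k * s := by exact_mod_cast b2
    have hc' : (c : ℝ) = x * q - k * t := by exact_mod_cast hc.symm
    rw [a1', a2'] at a5 a6
    rw [b1', b2'] at b5 b6
    have h1' : (y : ℝ) ≤ x := by exact_mod_cast h1
    have h2' : (x : ℝ) ≤ z := by exact_mod_cast h2
    refine ⟨⟨c, x * r - k * s⟩, Finset.mem_filter.2 ⟨mem_points.2 ⟨⟨?_, ?_⟩, ?_, ?_⟩, ?_⟩, ?_⟩
    · zify; rw [← hc]; exact c1
    · zify; rw [← hc]; exact c2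
    · have := (add_mul_mem_of_le (u := k * t * α - k * s) (v := r - q * α) (b := 0) h1' h2').1
        (by linarith) (by linarith)
      push_cast
      rw [hc']
      linarith
    · have := (add_mul_mem_of_le (u := k * t * β - k * s) (v := r - q * β) (b := 0) h1' h2').2
        (by linarith) (by linarith)
      push_cast
      rw [hc']
      linarith
    · simp only
      linear_combination k * hM + r * hc
    · simp only
      linear_combination x * hM + s * hc
  refine ⟨fun y hy z hz x hx => ?_⟩
  simp only [Finset.coe_image, Set.mem_image, Finset.mem_coe] at hy hz ⊢
  obtain ⟨p, hp, rfl⟩ := hy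
  obtain ⟨p', hp', rfl⟩ := hz
  exact key p hp p' hp' x hx.1 hx.2

lemma norm_sum_fiber_le {n : ℤ} {ε : ℝ} {K₀ : ℕ} (hK₀ : 1 ≤ K₀)
    (hK : ∀ k : ℤ, (K₀ : ℤ) ≤ |k| → ∀ J : Finset ℤ, (J : Set ℤ).OrdConnected →
      ‖∑ j ∈ J, intPhase (-n) k j‖ ≤ ε * (|(k : ℝ)| + J.card))
    (hKn : 4 * Real.pi * |(n : ℝ)| ≤ ε * K₀) (X : ℕ) (α β : ℝ) (hq : 1 ≤ q)
    (hM : r * t - s * q = 1) {V : ℝ} (hqV : q * V ≤ 2)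
    (hV : ∀ p ∈ points X α β, |(p.2 : ℝ) * q - p.1 * r| ≤ p.1 * V) (k : ℤ)
    (hk : (K₀ : ℤ) ≤ |k|) :
    ‖∑ p ∈ fiber X α β q r k, intPhase n p.1 p.2‖ ≤
      ε * (|(k : ℝ)| + 2 * (fiber X α β q r k).card) := by
  have hk0 : k ≠ 0 := by
    rintro rfl
    simp at hk
    omega
  have h1 := hK k hk _ (ordConnected_image_fiber (q := q) (r := r) X α β hq hM k)
  rw [Finset.sum_image (injOn_fiber X α β hM k), Finset.card_image_of_injOn (injOn_fiber X α β hM k)]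
    at h1
  have h2 : ∀ p ∈ fiber X α β q r k,
      ‖intPhase n p.1 p.2 - intPhase (-n) k (p.2 * t - p.1 * s)‖ ≤ ε := by
    intro p hp
    obtain ⟨a1, a2⟩ := eq_of_mem_fiber hM hp
    have hp1 := (Finset.mem_filter.1 hp).1
    have hc := (mem_points.1 hp1).1.1
    have hV' := hV p hp1
    have hk' : ((p.2 : ℝ) * q - p.1 * r) = k := by exact_mod_cast (Finset.mem_filter.1 hp).2
    rw [hk'] at hV'
    have hu := intPhase_unimodular (n := n) (k := k) (j := p.2 * t - p.1 * s) hM hk0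
      (by rw [← a1]; exact_mod_cast (by omega : p.1 ≠ 0))
    rw [← a1, ← a2] at hu
    rw [hu, ← mul_sub_one, norm_mul]
    refine (mul_le_of_le_one_left (norm_nonneg _) (norm_intPhase_le _ _ _)).trans ?_
    rw [show (2 * Real.pi * Complex.I * (n * q / (k * ((p.1 : ℤ) : ℂ))) : ℂ) =
      Complex.I * ((2 * Real.pi * (n * q / (k * p.1)) : ℝ) : ℂ) by push_cast; ring]
    refine (Real.norm_exp_I_mul_ofReal_sub_one_le).trans ?_
    have hkpos : (0 : ℝ) < |(k : ℝ)| := abs_pos.2 (by exact_mod_cast hk0)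
    have hcpos : (0 : ℝ) < (p.1 : ℝ) := by exact_mod_cast hc
    have hqpos : (0 : ℝ) < (q : ℝ) := by exact_mod_cast hq
    have hkK : (K₀ : ℝ) ≤ |(k : ℝ)| := by exact_mod_cast hk
    have hK1 : (1 : ℝ) ≤ K₀ := by exact_mod_cast hK₀
    have hqk : q * |(k : ℝ)| ≤ p.1 * 2 :=
      calc q * |(k : ℝ)| ≤ q * (p.1 * V) := by gcongr
        _ = p.1 * (q * V) := by ring
        _ ≤ p.1 * 2 := by gcongr
    rw [Real.norm_eq_abs, abs_mul, abs_div, abs_mul (n : ℝ), abs_mul (k : ℝ), abs_of_pos hqpos,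
      abs_of_pos hcpos, abs_of_pos (by positivity : 0 < 2 * Real.pi), ← mul_div_assoc,
      div_le_iff₀ (by positivity)]
    have hε : 0 ≤ ε := by
      have : 0 ≤ ε * K₀ := le_trans (by positivity) hKn
      exact nonneg_of_mul_nonneg_left this (by linarith)
    have h3 : 2 * Real.pi * |(n : ℝ)| * (q * |(k : ℝ)|) ≤ ε * K₀ * p.1 := by
      calc 2 * Real.pi * |(n : ℝ)| * (q * |(k : ℝ)|) ≤ 2 * Real.pi * |(n : ℝ)| * (p.1 * 2) := by
            gcongr
        _ = (4 * Real.pi * |(n : ℝ)|) * p.1 := by ring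
        _ ≤ _ := by gcongr
    have h4 : ε * K₀ * p.1 ≤ ε * |(k : ℝ)| * p.1 * |(k : ℝ)| := by
      calc ε * K₀ * p.1 ≤ ε * |(k : ℝ)| * p.1 * 1 := by rw [mul_one]; gcongr
        _ ≤ ε * |(k : ℝ)| * p.1 * |(k : ℝ)| := by gcongr; linarith
    have h5 : 2 * Real.pi * |(n : ℝ)| * q * |(k : ℝ)| ≤ ε * (|(k : ℝ)| * p.1) * |(k : ℝ)| := by
      linarith
    have := le_of_mul_le_mul_right h5 hkpos
    linarith
  calc ‖∑ p ∈ fiber X α β q r k, intPhase n p.1 p.2‖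
      = ‖∑ p ∈ fiber X α β q r k, intPhase (-n) k (p.2 * t - p.1 * s) +
          ∑ p ∈ fiber X α β q r k,
            (intPhase n p.1 p.2 - intPhase (-n) k (p.2 * t - p.1 * s))‖ := by
        rw [← Finset.sum_add_distrib]; simp
    _ ≤ ε * (|(k : ℝ)| + (fiber X α β q r k).card) + ε * (fiber X α β q r k).card := by
        refine (norm_add_le _ _).trans (add_le_add h1 ?_)
        refine (norm_sum_le _ _).trans ((Finset.sum_le_sum h2).trans ?_)
        rw [Finset.sum_const, nsmul_eq_mul, mul_comm]
    _ = _ := by ring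

end fiber

lemma norm_sum_window_le_of_approx {n : ℤ} {ε : ℝ} (hε : 0 ≤ ε) {K₀ : ℕ} (hK₀ : 1 ≤ K₀)
    (hK : ∀ k : ℤ, (K₀ : ℤ) ≤ |k| → ∀ J : Finset ℤ, (J : Set ℤ).OrdConnected →
      ‖∑ j ∈ J, intPhase (-n) k j‖ ≤ ε * (|(k : ℝ)| + J.card))
    (hKn : 4 * Real.pi * |(n : ℝ)| ≤ ε * K₀) (X : ℕ) (α β : ℝ) {q r s t : ℤ} (hq : 1 ≤ q)
    (hM : r * t - s * q = 1) {V : ℝ} (hqV : q * V ≤ 2)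
    (hV : ∀ p ∈ points X α β, |(p.2 : ℝ) * q - p.1 * r| ≤ p.1 * V) :
    ‖∑ c ∈ Finset.Icc 1 X, window n α β c‖ ≤
      (2 * K₀ + 1) * X + ε * (3 * (⌊X * V⌋₊ : ℝ) ^ 2) + 2 * ε * (points X α β).card := by
  set U := ⌊X * V⌋₊ with hU
  rw [sum_window_eq]
  have hmaps : ∀ p ∈ points X α β, p.2 * q - p.1 * r ∈ Finset.Icc (-(U : ℤ)) U := by
    intro p hp
    have h1 := hV p hp
    have hp' := (mem_points.1 hp).1
    have hV0 : 0 ≤ V := by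
      have : (0 : ℝ) < p.1 := by exact_mod_cast hp'.1
      exact nonneg_of_mul_nonneg_right ((abs_nonneg _).trans h1) this
    have h2 : |(p.2 : ℝ) * q - p.1 * r| ≤ X * V := h1.trans (by
      have : (p.1 : ℝ) ≤ X := by exact_mod_cast hp'.2
      gcongr)
    have h3 : (((p.2 * q - p.1 * r).natAbs : ℕ) : ℝ) ≤ X * V := by
      rw [Nat.cast_natAbs]; push_cast; exact h2
    have h4 : (p.2 * q - p.1 * r).natAbs ≤ U := Nat.le_floor h3
    rw [Finset.mem_Icc]
    omega
  have hsum : ∑ k ∈ Finset.Icc (-(U : ℤ)) U, ((fiber X α β q r k).card : ℝ) =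
      (points X α β).card := by
    rw [Finset.card_eq_sum_card_fiberwise hmaps]
    push_cast
    rfl
  rw [← Finset.sum_fiberwise_of_maps_to hmaps]
  calc ‖∑ k ∈ Finset.Icc (-(U : ℤ)) U,
        ∑ p ∈ (points X α β).filter (fun p => p.2 * q - p.1 * r = k), intPhase n p.1 p.2‖
      ≤ ∑ k ∈ Finset.Icc (-(U : ℤ)) U, ((if |k| < K₀ then (X : ℝ) else 0) +
          (ε * U + 2 * ε * (fiber X α β q r k).card)) := by
        refine (norm_sum_le _ _).trans (Finset.sum_le_sum fun k hk => ?_)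
        change ‖∑ p ∈ fiber X α β q r k, intPhase n p.1 p.2‖ ≤ _
        split_ifs with hlt
        · refine le_add_of_le_of_nonneg ?_ (by positivity)
          refine (norm_sum_le _ _).trans ((Finset.sum_le_sum fun _ _ =>
            norm_intPhase_le _ _ _).trans ?_)
          rw [Finset.sum_const, nsmul_eq_mul, mul_one]
          exact_mod_cast card_fiber_le X α β hq k
        · refine (norm_sum_fiber_le hK₀ hK hKn X α β hq hM hqV hV k (not_lt.1 hlt)).trans ?_
          have : |(k : ℝ)| ≤ U := by
            rw [Finset.mem_Icc] at hk
            exact_mod_cast abs_le.2 hk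
          rw [mul_add, zero_add]
          have := mul_le_mul_of_nonneg_left this hε
          linarith
    _ ≤ _ := by
        rw [Finset.sum_add_distrib, Finset.sum_add_distrib, ← Finset.mul_sum _ _ (2 * ε), hsum,
          Finset.sum_const, ← Finset.sum_filter, Finset.sum_const, nsmul_eq_mul, nsmul_eq_mul,
          ← add_assoc]
        have hU2 : (U : ℝ) ≤ U ^ 2 := by exact_mod_cast Nat.le_self_pow two_ne_zero U
        have hcard1 : ((Finset.Icc (-(U : ℤ)) U).card : ℝ) = 2 * U + 1 := by
          rw [Int.card_Icc, show ((U : ℤ) + 1 - -(U : ℤ)).toNat = 2 * U + 1 by omega]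
          push_cast; ring
        have hcard2 : (((Finset.Icc (-(U : ℤ)) U).filter fun k : ℤ => |k| < (K₀ : ℤ)).card : ℝ) ≤
            2 * K₀ + 1 := by
          have : ((Finset.Icc (-(U : ℤ)) U).filter fun k : ℤ => |k| < (K₀ : ℤ)) ⊆
              Finset.Icc (-(K₀ : ℤ)) K₀ := by
            intro k hk
            rw [Finset.mem_filter, abs_lt] at hk
            rw [Finset.mem_Icc]
            omega
          have := Finset.card_le_card this
          rw [Int.card_Icc, show ((K₀ : ℤ) + 1 - -(K₀ : ℤ)).toNat = 2 * K₀ + 1 by omega] at this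
          exact_mod_cast this
        refine add_le_add (add_le_add ?_ ?_) le_rfl
        · exact mul_le_mul_of_nonneg_right hcard2 (Nat.cast_nonneg X)
        · rw [hcard1]
          calc (2 * (U : ℝ) + 1) * (ε * U) = ε * (2 * U ^ 2 + U) := by ring
            _ ≤ ε * (3 * U ^ 2) := by gcongr; linarith

lemma exists_approx {α ℓ : ℝ} (hℓ0 : 0 < ℓ) (hℓ1 : ℓ ≤ 1) :
    ∃ q r s t : ℤ, 1 ≤ q ∧ r * t - s * q = 1 ∧ (q : ℝ) * (2 * √ℓ) ≤ 2 ∧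
      ∀ c d : ℝ, 0 < c → c * α < d → d ≤ c * (α + ℓ) → |d * q - c * r| ≤ c * (2 * √ℓ) := by
  have hs : 0 < √ℓ := Real.sqrt_pos.2 hℓ0
  have hs1 : √ℓ ≤ 1 := Real.sqrt_le_one.2 hℓ1
  have hss : √ℓ * √ℓ = ℓ := Real.mul_self_sqrt hℓ0.le
  set Q := ⌊1 / √ℓ⌋₊ with hQ
  have hQ1 : 0 < Q := Nat.floor_pos.2 (by rw [le_div_iff₀ hs]; linarith)
  have hQle : (Q : ℝ) ≤ 1 / √ℓ := Nat.floor_le (by positivity)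
  have hQlt : 1 / √ℓ < Q + 1 := Nat.lt_floor_add_one _
  obtain ⟨R, hR, hRQ⟩ := Real.exists_rat_abs_sub_le_and_den_le α hQ1
  obtain ⟨u, v, huv⟩ := (Int.isCoprime_iff_gcd_eq_one.2 (by
    rw [Int.gcd, Int.natAbs_natCast]; exact R.reduced) : IsCoprime R.num (R.den : ℤ))
  have hden : (0 : ℝ) < R.den := by exact_mod_cast R.den_pos
  have hqs : (R.den : ℝ) * √ℓ ≤ 1 := by
    have : (R.den : ℝ) ≤ 1 / √ℓ := le_trans (by exact_mod_cast hRQ) hQle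
    rwa [le_div_iff₀ hs] at this
  refine ⟨R.den, R.num, -v, u, by exact_mod_cast R.den_pos, by linarith, by push_cast; linarith,
    fun c d hc h1 h2 => ?_⟩
  have hRat : (R : ℝ) * R.den = R.num := by exact_mod_cast Rat.mul_den_eq_num R
  have hR' : |α - R| * R.den ≤ √ℓ := by
    rw [le_div_iff₀ (by positivity)] at hR
    have h3 : |α - R| * R.den * (Q + 1) ≤ 1 := by linarith
    have h4 : 1 ≤ √ℓ * (Q + 1) := by rw [div_lt_iff₀ hs] at hQlt; linarith
    have h5 : (0 : ℝ) < Q + 1 := by positivity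
    exact le_of_mul_le_mul_right (h3.trans h4) h5
  have h3 : d * (R.den : ℝ) - c * R.num = (d - c * α) * R.den + c * ((α - R) * R.den) := by
    rw [← hRat]; ring
  push_cast
  rw [h3]
  refine (abs_add_le _ _).trans ?_
  rw [abs_mul, abs_mul c, abs_mul _ (R.den : ℝ), abs_of_pos hden, abs_of_pos hc,
    abs_of_pos (by linarith : 0 < d - c * α)]
  have h4 : (d - c * α) * R.den ≤ c * √ℓ := by
    calc (d - c * α) * R.den ≤ (c * (√ℓ * √ℓ)) * R.den := by gcongr; rw [hss]; linarith
      _ = c * √ℓ * (R.den * √ℓ) := by ring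
      _ ≤ c * √ℓ * 1 := by gcongr
      _ = _ := mul_one _
  have h5 : c * (|α - R| * R.den) ≤ c * √ℓ := by gcongr
  linarith

lemma exists_sum_window_le {n : ℤ} (hn : n ≠ 0) {ε : ℝ} (hε : 0 < ε) :
    ∃ T : ℝ, ∀ (X : ℕ) (α β : ℝ), α < β → β - α ≤ 1 → T ≤ (β - α) * X →
      ‖∑ c ∈ Finset.Icc 1 X, window n α β c‖ ≤ ε * ((β - α) * X ^ 2) := by
  obtain ⟨K₁, hK₁, hK⟩ := exists_sum_intPhase_le (neg_ne_zero.2 hn) (ε := ε / 30) (by positivity)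
  set η := ε / 30 with hη
  have hη0 : 0 < η := by positivity
  set K₀ := max K₁ ⌈4 * Real.pi * |(n : ℝ)| / η⌉₊ with hK₀
  refine ⟨(2 * K₀ + 1 + 2 * η) / η, fun X α β hαβ hℓ hT => ?_⟩
  set ℓ := β - α with hℓdef
  have hℓ0 : 0 < ℓ := sub_pos.2 hαβ
  obtain ⟨q, r, s, t, hq, hM, hqV, hV⟩ := exists_approx (α := α) hℓ0 hℓ
  have h1 := norm_sum_window_le_of_approx (n := n) hη0.le (hK₁.trans (le_max_left _ _ : K₁ ≤ K₀))
    (fun k hk => hK k (le_trans (by exact_mod_cast le_max_left _ _) hk)) ?_ X α β hq hM hqV ?_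
  · refine h1.trans ?_
    have h2 := card_points_le hαβ.le X
    have h3 : (⌊X * (2 * √ℓ)⌋₊ : ℝ) ^ 2 ≤ 4 * (ℓ * X ^ 2) := by
      calc (⌊X * (2 * √ℓ)⌋₊ : ℝ) ^ 2 ≤ (X * (2 * √ℓ)) ^ 2 := by
            gcongr; exact Nat.floor_le (by positivity)
        _ = 4 * (√ℓ ^ 2 * X ^ 2) := by ring
        _ = _ := by rw [Real.sq_sqrt hℓ0.le]
    have h4 : (2 * K₀ + 1 + 2 * η) * X ≤ η * (ℓ * X ^ 2) := by
      rw [div_le_iff₀ hη0] at hT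
      calc (2 * K₀ + 1 + 2 * η) * X ≤ (ℓ * X * η) * X := by gcongr
        _ = _ := by ring
    have h5 := mul_le_mul_of_nonneg_left h3 hη0.le
    have h6 := mul_le_mul_of_nonneg_left h2 hη0.le
    have h7 : 0 ≤ η * (ℓ * X ^ 2) := by positivity
    have h8 : ε * (ℓ * X ^ 2) = 30 * (η * (ℓ * X ^ 2)) := by rw [hη]; ring
    rw [h8]
    linarith
  · have := (Nat.le_ceil (4 * Real.pi * |(n : ℝ)| / η)).trans
      (Nat.cast_le.2 (le_max_right K₁ _) : ((⌈4 * Real.pi * |(n : ℝ)| / η⌉₊ : ℕ) : ℝ) ≤ K₀)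
    rw [div_le_iff₀ hη0] at this
    linarith
  · intro p hp
    obtain ⟨⟨a1, -⟩, a3, a4⟩ := mem_points.1 hp
    exact hV _ _ (by exact_mod_cast a1) a3 (by rw [hℓdef]; simpa using a4)

open ArithmeticFunction in
lemma tendsto_sum_moebius_div_sq :
    Filter.Tendsto (fun X : ℕ => ∑ e ∈ Finset.Ioc 0 X, (moebius e : ℝ) / (e : ℝ) ^ 2) Filter.atTop
      (nhds (6 / Real.pi ^ 2)) := by
  have h2 : (1 : ℝ) < (2 : ℂ).re := by norm_num
  have h1 := (LSeriesSummable_moebius_iff.2 h2).hasSum.tendsto_sum_nat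
  have hL : LSeries (fun n => ((moebius n : ℤ) : ℂ)) 2 = ((6 / Real.pi ^ 2 : ℝ) : ℂ) := by
    have h3 := LSeries_zeta_mul_Lseries_moebius h2
    have hz : LSeries (fun n => ((zeta n : ℕ) : ℂ)) 2 = Real.pi ^ 2 / 6 := by
      rw [← riemannZeta_two]
      exact LSeries_zeta_eq_riemannZeta h2
    rw [hz] at h3
    have hpi : (Real.pi : ℂ) ≠ 0 := by exact_mod_cast Real.pi_ne_zero
    push_cast
    field_simp at h3 ⊢
    linear_combination h3
  change Filter.Tendsto _ _ (nhds (LSeries (fun n => ((moebius n : ℤ) : ℂ)) 2)) at h1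
  rw [hL] at h1
  have h4 := (Complex.continuous_re.tendsto _).comp (h1.comp (Filter.tendsto_add_atTop_nat 1))
  rw [Complex.ofReal_re] at h4
  refine h4.congr fun X => ?_
  simp only [Function.comp]
  rw [Finset.sum_range_succ', LSeries.term_zero, add_zero, Complex.re_sum,
    show Finset.Ioc 0 X = Finset.Ico 1 (X + 1) from rfl, Finset.sum_Ico_eq_sum_range,
    Nat.add_sub_cancel]
  refine Finset.sum_congr rfl fun e _ => ?_
  rw [LSeries.term_of_ne_zero (by omega), add_comm 1 e]
  have : (((e + 1 : ℕ) : ℂ) ^ (2 : ℂ)) = (((e + 1 : ℕ) : ℝ) ^ 2 : ℝ) := by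
    rw [show (2 : ℂ) = ((2 : ℕ) : ℂ) by norm_num, Complex.cpow_natCast]; push_cast; rfl
  rw [this, ← Complex.ofReal_intCast, ← Complex.ofReal_div, Complex.ofReal_re]

lemma abs_card_multiples_sub_le {x y : ℝ} (hxy : x ≤ y) {e : ℕ} (he : 0 < e) :
    |(((Finset.Ioc ⌊x⌋ ⌊y⌋).filter fun d : ℤ => (e : ℤ) ∣ d).card : ℝ) - (y - x) / e| ≤ 2 := by
  have he' : (0 : ℝ) < e := by exact_mod_cast he
  have h1 := Int.Ioc_filter_dvd_card ⌊x⌋ ⌊y⌋ (r := (e : ℤ)) (by exact_mod_cast he)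
  have hle : ⌊(⌊x⌋ : ℚ) / ((e : ℤ) : ℚ)⌋ ≤ ⌊(⌊y⌋ : ℚ) / ((e : ℤ) : ℚ)⌋ := by
    apply Int.floor_le_floor
    gcongr
  rw [max_eq_left (by linarith)] at h1
  have key : ∀ z : ℝ, (⌊(⌊z⌋ : ℚ) / ((e : ℤ) : ℚ)⌋ : ℝ) ≤ z / e ∧
      z / e - 2 ≤ (⌊(⌊z⌋ : ℚ) / ((e : ℤ) : ℚ)⌋ : ℝ) := by
    intro z
    have a1 : ((⌊(⌊z⌋ : ℚ) / ((e : ℤ) : ℚ)⌋ : ℚ) : ℝ) ≤ (((⌊z⌋ : ℚ) / ((e : ℤ) : ℚ) : ℚ) : ℝ) := by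
      exact_mod_cast Int.floor_le _
    have a2 : (((⌊z⌋ : ℚ) / ((e : ℤ) : ℚ) : ℚ) : ℝ) ≤ ((⌊(⌊z⌋ : ℚ) / ((e : ℤ) : ℚ)⌋ + 1 : ℚ) : ℝ) := by
      exact_mod_cast (Int.lt_floor_add_one ((⌊z⌋ : ℚ) / ((e : ℤ) : ℚ))).le
    push_cast at a1 a2
    have b1 := Int.floor_le z
    have b2 := Int.lt_floor_add_one z
    have c1 : (⌊z⌋ : ℝ) / e ≤ z / e := by gcongr
    have c2 : z / e - 1 ≤ (⌊z⌋ : ℝ) / e := by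
      have : (1 : ℝ) ≤ e := by exact_mod_cast he
      rw [sub_le_iff_le_add, div_add_one he'.ne']
      gcongr; linarith
    simp only [Int.cast_natCast]
    exact ⟨a1.trans c1, by linarith⟩
  have h2 : (((Finset.Ioc ⌊x⌋ ⌊y⌋).filter fun d : ℤ => (e : ℤ) ∣ d).card : ℝ) =
      (⌊(⌊y⌋ : ℚ) / ((e : ℤ) : ℚ)⌋ : ℝ) - (⌊(⌊x⌋ : ℚ) / ((e : ℤ) : ℚ)⌋ : ℝ) := by
    exact_mod_cast h1
  rw [h2, sub_div, abs_le]
  obtain ⟨k1, k2⟩ := key x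
  obtain ⟨k3, k4⟩ := key y
  constructor <;> linarith

open ArithmeticFunction in
lemma ite_gcd_eq_sum_moebius {c : ℕ} (hc : 0 < c) (d : ℤ) :
    (if Int.gcd c d = 1 then (1 : ℝ) else 0) =
      ∑ e ∈ c.divisors, if (e : ℤ) ∣ d then (moebius e : ℝ) else 0 := by
  have hg : 0 < Int.gcd c d := Int.gcd_pos_of_ne_zero_left d (by exact_mod_cast hc.ne')
  have h1 : ((moebius * zeta : ArithmeticFunction ℤ) (Int.gcd c d)) =
      (1 : ArithmeticFunction ℤ) (Int.gcd c d) := by rw [moebius_mul_coe_zeta]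
  rw [coe_mul_zeta_apply, one_apply] at h1
  have h2 : (if Int.gcd c d = 1 then (1 : ℝ) else 0) =
      ((if Int.gcd c d = 1 then 1 else 0 : ℤ) : ℝ) := by split_ifs <;> simp
  rw [h2, ← h1, Int.cast_sum, ← Finset.sum_filter]
  refine Finset.sum_congr ?_ fun _ _ => rfl
  ext e
  rw [Finset.mem_filter, Nat.mem_divisors, Nat.mem_divisors, ← Int.natCast_dvd_natCast (m := e),
    ← Int.natCast_dvd_natCast (m := e), Int.dvd_coe_gcd_iff]
  constructor
  · rintro ⟨⟨a, b⟩, -⟩; exact ⟨⟨a, hc.ne'⟩, b⟩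
  · rintro ⟨⟨a, -⟩, b⟩; exact ⟨⟨a, b⟩, hg.ne'⟩

open ArithmeticFunction in
lemma norm_window_zero_sub_le {α β : ℝ} (h : α ≤ β) {c : ℕ} (hc : 0 < c) :
    ‖window 0 α β c - (((β - α) * ∑ e ∈ c.divisors, (moebius e : ℝ) * ((c / e : ℕ) : ℝ) : ℝ) : ℂ)‖ ≤
      2 * (sigma 0 c : ℕ) := by
  have h1 : window 0 α β c = ((∑ e ∈ c.divisors, (moebius e : ℝ) *
      (((Finset.Ioc ⌊(c : ℝ) * α⌋ ⌊(c : ℝ) * β⌋).filter fun d : ℤ => (e : ℤ) ∣ d).card : ℝ) : ℝ) : ℂ) := by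
    have : window 0 α β c = ((∑ d ∈ Finset.Ioc ⌊(c : ℝ) * α⌋ ⌊(c : ℝ) * β⌋,
        (if Int.gcd c d = 1 then (1 : ℝ) else 0) : ℝ) : ℂ) := by
      rw [window]
      push_cast
      refine Finset.sum_congr rfl fun d _ => ?_
      unfold intPhase
      split_ifs <;> simp
    rw [this]
    congr 1
    rw [Finset.sum_congr rfl fun d _ => ite_gcd_eq_sum_moebius hc d, Finset.sum_comm]
    refine Finset.sum_congr rfl fun e _ => ?_
    rw [← Finset.sum_filter, Finset.sum_const, nsmul_eq_mul, mul_comm]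
  rw [h1, ← Complex.ofReal_sub, Complex.norm_real, Real.norm_eq_abs, Finset.mul_sum,
    ← Finset.sum_sub_distrib]
  refine (Finset.abs_sum_le_sum_abs _ _).trans ?_
  rw [sigma_zero_apply]
  refine (Finset.sum_le_card_nsmul _ _ 2 fun e he => ?_).trans_eq (by
    rw [nsmul_eq_mul, mul_comm])
  have hed := Nat.dvd_of_mem_divisors he
  have he0 : 0 < e := Nat.pos_of_dvd_of_pos hed hc
  have hmu : |(moebius e : ℝ)| ≤ 1 := by exact_mod_cast abs_moebius_le_one (n := e)
  rw [Nat.cast_div hed (by exact_mod_cast he0.ne')]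
  have h2 := abs_card_multiples_sub_le (mul_le_mul_of_nonneg_left h (Nat.cast_nonneg c)) he0
  rw [show ∀ u v : ℝ, v * u - (β - α) * (v * (c / e)) = v * (u - (c * β - c * α) / e) by
    intros; ring, abs_mul]
  exact (mul_le_of_le_one_left (abs_nonneg _) hmu).trans h2

lemma sum_div_le (X : ℕ) : ∑ e ∈ Finset.Ioc 0 X, ((X : ℝ) / e) ≤ X * (1 + Real.log X) := by
  have h := harmonic_le_one_add_log X
  rw [harmonic_eq_sum_Icc] at h
  push_cast at h
  simp_rw [div_eq_mul_inv]
  rw [← Finset.mul_sum]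
  exact mul_le_mul_of_nonneg_left h (Nat.cast_nonneg X)

lemma abs_sum_Ioc_sub_le (X e : ℕ) (he : 0 < e) :
    |∑ m ∈ Finset.Ioc 0 (X / e), (m : ℝ) - (X : ℝ) ^ 2 / (2 * (e : ℝ) ^ 2)| ≤ (X : ℝ) / e := by
  have he' : (0 : ℝ) < e := by exact_mod_cast he
  have h1 : ∀ M : ℕ, ∑ m ∈ Finset.Ioc 0 M, (m : ℝ) = M * (M + 1) / 2 := by
    intro M
    induction M with
    | zero => simp
    | succ M ih => rw [← Finset.insert_Ioc_right_eq_Ioc_add_one (Nat.zero_le M), Finset.sum_insert (by simp), ih]; push_cast; ring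
  have h2 : ((X / e : ℕ) : ℝ) ≤ X / e := Nat.cast_div_le
  have h3 : (X : ℝ) / e ≤ ((X / e : ℕ) : ℝ) + 1 := by
    rw [div_le_iff₀ he']
    exact_mod_cast (Nat.lt_div_mul_add he (a := X)).le.trans (by rw [add_mul, one_mul])
  rw [h1, show (X : ℝ) ^ 2 / (2 * (e : ℝ) ^ 2) = (X / e) ^ 2 / 2 by field_simp]
  generalize (X : ℝ) / e = x at *
  have h0 : (0 : ℝ) ≤ ((X / e : ℕ) : ℝ) := Nat.cast_nonneg _
  generalize ((X / e : ℕ) : ℝ) = m at *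
  rw [abs_le]
  constructor <;> nlinarith

open ArithmeticFunction in
lemma norm_sum_window_zero_sub_le {α β : ℝ} (h : α ≤ β) (hℓ : β - α ≤ 1) (X : ℕ) :
    ‖∑ c ∈ Finset.Icc 1 X, window 0 α β c - (((β - α) * X ^ 2 / 2 *
      ∑ e ∈ Finset.Ioc 0 X, (moebius e : ℝ) / (e : ℝ) ^ 2 : ℝ) : ℂ)‖ ≤
      3 * (X * (1 + Real.log X)) := by
  have hℓ0 : 0 ≤ β - α := sub_nonneg.2 h
  have hIcc : Finset.Icc 1 X = Finset.Ioc 0 X := rfl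
  have h1 : ‖∑ c ∈ Finset.Icc 1 X, (window 0 α β c -
      (((β - α) * ∑ e ∈ c.divisors, (moebius e : ℝ) * ((c / e : ℕ) : ℝ) : ℝ) : ℂ))‖ ≤
      2 * (X * (1 + Real.log X)) := by
    refine (norm_sum_le _ _).trans ((Finset.sum_le_sum fun c hc =>
      norm_window_zero_sub_le h (Finset.mem_Icc.1 hc).1).trans ?_)
    rw [← Finset.mul_sum, hIcc]
    refine mul_le_mul_of_nonneg_left ?_ (by norm_num)
    refine le_trans ?_ (sum_div_le X)
    rw [← Nat.cast_sum, sum_Ioc_sigma0_eq_sum_div, Nat.cast_sum]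
    exact Finset.sum_le_sum fun e _ => Nat.cast_div_le
  have h2 : ∑ c ∈ Finset.Ioc 0 X, ∑ e ∈ c.divisors, (moebius e : ℝ) * ((c / e : ℕ) : ℝ) =
      ∑ e ∈ Finset.Ioc 0 X, (moebius e : ℝ) * ∑ m ∈ Finset.Ioc 0 (X / e), (m : ℝ) := by
    have := sum_Ioc_mul_eq_sum_sum ((moebius : ArithmeticFunction ℤ) : ArithmeticFunction ℝ)
      ((ArithmeticFunction.id : ArithmeticFunction ℕ) : ArithmeticFunction ℝ) X
    simp only [intCoe_apply, natCoe_apply, id_apply] at this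
    rw [← this]
    refine Finset.sum_congr rfl fun c _ => ?_
    rw [mul_apply, Nat.sum_divisorsAntidiagonal (fun i j => ((moebius : ArithmeticFunction ℤ) : ArithmeticFunction ℝ) i *
      ((ArithmeticFunction.id : ArithmeticFunction ℕ) : ArithmeticFunction ℝ) j)]
    simp only [intCoe_apply, natCoe_apply, id_apply]
  have h3 : ‖(((β - α) * ∑ e ∈ Finset.Ioc 0 X, (moebius e : ℝ) *
      ∑ m ∈ Finset.Ioc 0 (X / e), (m : ℝ) : ℝ) : ℂ) - (((β - α) * X ^ 2 / 2 *
      ∑ e ∈ Finset.Ioc 0 X, (moebius e : ℝ) / (e : ℝ) ^ 2 : ℝ) : ℂ)‖ ≤ X * (1 + Real.log X) := by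
    rw [← Complex.ofReal_sub, Complex.norm_real, Real.norm_eq_abs, mul_div_assoc, mul_assoc,
      ← mul_sub, abs_mul, abs_of_nonneg hℓ0, Finset.mul_sum, ← Finset.sum_sub_distrib]
    refine (mul_le_of_le_one_left (abs_nonneg _) hℓ).trans ?_
    refine (Finset.abs_sum_le_sum_abs _ _).trans (le_trans ?_ (sum_div_le X))
    refine Finset.sum_le_sum fun e he => ?_
    have hmu : |(moebius e : ℝ)| ≤ 1 := by exact_mod_cast abs_moebius_le_one (n := e)
    rw [show ∀ u v : ℝ, v * u - (X : ℝ) ^ 2 / 2 * (v / (e : ℝ) ^ 2) =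
      v * (u - (X : ℝ) ^ 2 / (2 * (e : ℝ) ^ 2)) by intros; field_simp, abs_mul]
    exact (mul_le_of_le_one_left (abs_nonneg _) hmu).trans
      (abs_sum_Ioc_sub_le X e (Finset.mem_Ioc.1 he).1)
  rw [Finset.sum_sub_distrib, ← Complex.ofReal_sum, ← Finset.mul_sum, hIcc, h2] at h1
  rw [hIcc]
  refine (norm_sub_le_norm_sub_add_norm_sub _ _ _).trans ((add_le_add h1 h3).trans_eq ?_)
  ring

/-- The asymptotic density of the phases: fractions equidistribute when `n = 0`, and cancel
otherwise. -/
noncomputable def density (n : ℤ) : ℝ := if n = 0 then 3 / Real.pi ^ 2 else 0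

lemma exists_sum_window_sub_le (n : ℤ) {ε : ℝ} (hε : 0 < ε) :
    ∃ T : ℝ, ∀ (X : ℕ) (α β : ℝ), α < β → β - α ≤ 1 → T * (1 + Real.log X) ≤ (β - α) * X →
      ‖∑ c ∈ Finset.Icc 1 X, window n α β c - ((density n * ((β - α) * X ^ 2) : ℝ) : ℂ)‖ ≤
        ε * ((β - α) * X ^ 2) := by
  by_cases hn : n = 0
  · subst hn
    rw [density, if_pos rfl]
    obtain ⟨X₀, hX₀⟩ := Metric.tendsto_atTop.1 tendsto_sum_moebius_div_sq ε hε
    refine ⟨max X₀ (6 / ε), fun X α β hαβ hℓ hT => ?_⟩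
    rcases Nat.eq_zero_or_pos X with rfl | hX
    · simp
    have hℓ0 : 0 < β - α := sub_pos.2 hαβ
    have hX1 : (1 : ℝ) ≤ X := by exact_mod_cast hX
    have hlog : 0 ≤ Real.log X := Real.log_nonneg hX1
    have hXX : X₀ ≤ X := by
      have h1 : (X₀ : ℝ) * 1 ≤ max (X₀ : ℝ) (6 / ε) * (1 + Real.log X) :=
        mul_le_mul (le_max_left _ _) (by linarith) zero_le_one (le_max_of_le_left (Nat.cast_nonneg _))
      have h2 : (β - α) * X ≤ 1 * X := by gcongr
      have : (X₀ : ℝ) ≤ X := by linarith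
      exact_mod_cast this
    have h3 := (hX₀ X hXX).le
    rw [Real.dist_eq] at h3
    have h4 := norm_sum_window_zero_sub_le hαβ.le hℓ X
    have h5 : 3 * (X * (1 + Real.log X)) ≤ ε / 2 * ((β - α) * X ^ 2) := by
      have h6 : 6 / ε * (1 + Real.log X) ≤ (β - α) * X :=
        le_trans (mul_le_mul_of_nonneg_right (le_max_right _ _) (by linarith)) hT
      rw [div_mul_eq_mul_div, div_le_iff₀ hε] at h6
      have := mul_le_mul_of_nonneg_right h6 (by linarith : (0 : ℝ) ≤ X)
      nlinarith
    refine (norm_sub_le_norm_sub_add_norm_sub _ _ _).trans ((add_le_add h4 le_rfl).trans ?_)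
    rw [← Complex.ofReal_sub, Complex.norm_real, Real.norm_eq_abs]
    have h7 : ∀ s : ℝ, (β - α) * X ^ 2 / 2 * s - 3 / Real.pi ^ 2 * ((β - α) * X ^ 2) =
        (β - α) * X ^ 2 / 2 * (s - 6 / Real.pi ^ 2) := by intro s; ring
    rw [h7, abs_mul, abs_of_nonneg (by positivity : 0 ≤ (β - α) * (X : ℝ) ^ 2 / 2)]
    have := mul_le_mul_of_nonneg_left h3 (by positivity : 0 ≤ (β - α) * (X : ℝ) ^ 2 / 2)
    linarith
  · rw [density, if_neg hn]
    obtain ⟨T, hT⟩ := exists_sum_window_le hn hε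
    refine ⟨max T 0, fun X α β hαβ hℓ h => ?_⟩
    rcases Nat.eq_zero_or_pos X with rfl | hX
    · simp
    rw [zero_mul, Complex.ofReal_zero, sub_zero]
    refine hT X α β hαβ hℓ (le_trans ?_ h)
    have hlog : 0 ≤ Real.log X := Real.log_nonneg (by exact_mod_cast hX)
    calc T ≤ max T 0 * 1 := by rw [mul_one]; exact le_max_left _ _
      _ ≤ _ := mul_le_mul_of_nonneg_left (by linarith) (le_max_right _ _)

lemma sum_Ioc_floor_eq {F : ℕ → ℂ} {g : ℕ → ℕ} (hg : Monotone g) (h0 : g 0 = 0) (m : ℕ) :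
    ∑ c ∈ Finset.Ioc 0 (g m), F c =
      ∑ i ∈ Finset.range m, ∑ c ∈ Finset.Ioc (g i) (g (i + 1)), F c := by
  induction m with
  | zero => simp [h0]
  | succ m ih =>
    rw [Finset.sum_range_succ, ← ih, Finset.sum_Ioc_consecutive _ (Nat.zero_le _)
      (hg (Nat.le_succ m))]

open Filter Topology in
/-- If the partial sums of the weights `v i` behave like `κ t ^ 2`, then the weights integrate
continuous functions against `κ d(p ^ 2)` in the limit. -/
lemma tendsto_weighted_sum {ι : Type*} {l : Filter ι} {r : ι → ℝ} {v : ι → ℕ → ℂ} {κ B : ℝ}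
    (hr : ∀ᶠ i in l, 0 < r i)
    (hB : ∀ᶠ i in l, ∑ c ∈ Finset.Ioc 0 ⌊1 / r i⌋₊, ‖v i c‖ ≤ B)
    (hv : ∀ t : ℝ, 0 ≤ t → t ≤ 1 →
      Tendsto (fun i => ∑ c ∈ Finset.Ioc 0 ⌊t / r i⌋₊, v i c) l (𝓝 ((κ * t ^ 2 : ℝ) : ℂ)))
    {f : ℝ → ℂ} (hf : Continuous f) :
    Tendsto (fun i => ∑ c ∈ Finset.Ioc 0 ⌊1 / r i⌋₊, v i c * f (c * r i)) l
      (𝓝 ((κ : ℂ) * ∫ p in (0 : ℝ)..1, f p * ((2 * p : ℝ) : ℂ))) := by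
  rw [Metric.tendsto_nhds]
  intro ε hε
  set ω := ε / (2 * (|B| + |κ| + 1)) with hω
  have hω0 : 0 < ω := by positivity
  obtain ⟨η, hη, hfη⟩ := Metric.uniformContinuousOn_iff.1
    (isCompact_Icc.uniformContinuousOn_of_continuous (hf.continuousOn (s := Set.Icc (0 : ℝ) 1))) ω hω0
  obtain ⟨J', hJ'⟩ := exists_nat_one_div_lt hη
  set J := J' + 1 with hJ
  have hJ0 : (0 : ℝ) < J := by rw [hJ]; positivity
  have hJη : 1 / (J : ℝ) < η := by rw [hJ]; push_cast; exact hJ'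
  set t : ℕ → ℝ := fun i => i / J with ht
  have ht0 : ∀ i, 0 ≤ t i := fun i => by positivity
  have ht1 : ∀ i, i ≤ J → t i ≤ 1 := fun i hi => by
    rw [ht]; exact div_le_one_of_le₀ (by exact_mod_cast hi) hJ0.le
  have htm : ∀ i, t i ≤ t (i + 1) := fun i => by
    simp only [ht]; gcongr; simp
  have hclose : ∀ i < J, ∀ p, t i ≤ p → p ≤ t (i + 1) → ‖f p - f (t (i + 1))‖ ≤ ω := by
    intro i hi p h1 h2
    rw [← dist_eq_norm]
    refine (hfη p ⟨(ht0 i).trans h1, h2.trans (ht1 _ hi)⟩ _ ⟨ht0 _, ht1 _ hi⟩ ?_).le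
    rw [Real.dist_eq, abs_sub_comm, abs_of_nonneg (by linarith)]
    refine lt_of_le_of_lt ?_ hJη
    have : t (i + 1) = t i + 1 / J := by simp only [ht]; push_cast; ring
    linarith
  -- the limit of the step sums
  have hstep : Tendsto (fun i => ∑ j ∈ Finset.range J, f (t (j + 1)) *
      (∑ c ∈ Finset.Ioc 0 ⌊t (j + 1) / r i⌋₊, v i c - ∑ c ∈ Finset.Ioc 0 ⌊t j / r i⌋₊, v i c)) l
      (𝓝 (∑ j ∈ Finset.range J, f (t (j + 1)) *
        (((κ * t (j + 1) ^ 2 : ℝ) : ℂ) - ((κ * t j ^ 2 : ℝ) : ℂ)))) := by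
    refine tendsto_finsetSum _ fun j hj => ?_
    have hj := Finset.mem_range.1 hj
    exact ((hv _ (ht0 _) (ht1 _ hj)).sub (hv _ (ht0 _) (ht1 _ hj.le))).const_mul _
  have h_int : ‖(κ : ℂ) * (∫ p in (0 : ℝ)..1, f p * ((2 * p : ℝ) : ℂ)) -
      ∑ j ∈ Finset.range J, f (t (j + 1)) *
        (((κ * t (j + 1) ^ 2 : ℝ) : ℂ) - ((κ * t j ^ 2 : ℝ) : ℂ))‖ ≤ |κ| * ω := by
    have hc : Continuous fun p : ℝ => f p * ((2 * p : ℝ) : ℂ) := by fun_prop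
    have h1 := intervalIntegral.sum_integral_adjacent_intervals (μ := volume)
      (f := fun p : ℝ => f p * ((2 * p : ℝ) : ℂ)) (a := t) (n := J)
      (fun j _ => hc.intervalIntegrable _ _)
    have hJt : t J = 1 := by simp only [ht]; exact div_self hJ0.ne'
    have h0t : t 0 = 0 := by simp [ht]
    rw [hJt, h0t] at h1
    have h2 : ∀ j ∈ Finset.range J, ‖(∫ p in t j..t (j + 1), f p * ((2 * p : ℝ) : ℂ)) -
        f (t (j + 1)) * (((t (j + 1) ^ 2 - t j ^ 2 : ℝ)) : ℂ)‖ ≤ ω * (t (j + 1) ^ 2 - t j ^ 2) := by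
      intro j hj
      have hj := Finset.mem_range.1 hj
      have h3 : (((t (j + 1) ^ 2 - t j ^ 2 : ℝ)) : ℂ) =
          ∫ p in t j..t (j + 1), ((2 * p : ℝ) : ℂ) := by
        rw [intervalIntegral.integral_ofReal, intervalIntegral.integral_const_mul, integral_id]
        congr 1; ring
      have h4 : t (j + 1) ^ 2 - t j ^ 2 = ∫ p in t j..t (j + 1), 2 * p := by
        rw [intervalIntegral.integral_const_mul, integral_id]; ring
      rw [h3, ← intervalIntegral.integral_const_mul, ← intervalIntegral.integral_sub
        (hc.intervalIntegrable _ _) (Continuous.intervalIntegrable (by fun_prop) _ _), h4,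
        ← intervalIntegral.integral_const_mul]
      refine intervalIntegral.norm_integral_le_of_norm_le (htm j) (.of_forall fun p hp => ?_)
        (Continuous.intervalIntegrable (by fun_prop) _ _)
      rw [← sub_mul, norm_mul, Complex.norm_real, Real.norm_eq_abs,
        abs_of_nonneg (by have := ht0 j; have := hp.1; linarith : 0 ≤ 2 * p)]
      have := hp.1; have := ht0 j
      gcongr
      · linarith
      · exact hclose j hj p hp.1.le hp.2
    have h5 : (κ : ℂ) * (∫ p in (0 : ℝ)..1, f p * ((2 * p : ℝ) : ℂ)) -
      ∑ j ∈ Finset.range J, f (t (j + 1)) *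
        (((κ * t (j + 1) ^ 2 : ℝ) : ℂ) - ((κ * t j ^ 2 : ℝ) : ℂ)) =
        κ * ∑ j ∈ Finset.range J, ((∫ p in t j..t (j + 1), f p * ((2 * p : ℝ) : ℂ)) -
        f (t (j + 1)) * (((t (j + 1) ^ 2 - t j ^ 2 : ℝ)) : ℂ)) := by
      rw [← h1, Finset.sum_sub_distrib, mul_sub]
      congr 1
      rw [Finset.mul_sum]
      refine Finset.sum_congr rfl fun j _ => ?_
      push_cast; ring
    rw [h5, norm_mul, Complex.norm_real, Real.norm_eq_abs]
    refine mul_le_mul_of_nonneg_left ?_ (abs_nonneg _)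
    refine (norm_sum_le _ _).trans ((Finset.sum_le_sum h2).trans ?_)
    rw [← Finset.mul_sum, Finset.sum_range_sub (fun j => t j ^ 2), hJt, h0t]
    simp
  filter_upwards [hr, hB, Metric.tendsto_nhds.1 hstep (ε / 2) (by positivity)] with i hri hBi hsi
  set g : ℕ → ℕ := fun j => ⌊t j / r i⌋₊ with hg
  have hgm : Monotone g := monotone_nat_of_le_succ fun j => Nat.floor_le_floor (by
    have := htm j; gcongr)
  have hg0 : g 0 = 0 := by simp [hg, ht]
  have hgJ : g J = ⌊1 / r i⌋₊ := by
    simp only [hg, ht]; rw [div_self hJ0.ne']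
  have hdiff : ‖∑ c ∈ Finset.Ioc 0 ⌊1 / r i⌋₊, v i c * f (c * r i) -
      ∑ j ∈ Finset.range J, f (t (j + 1)) *
      (∑ c ∈ Finset.Ioc 0 ⌊t (j + 1) / r i⌋₊, v i c - ∑ c ∈ Finset.Ioc 0 ⌊t j / r i⌋₊, v i c)‖ ≤
      |B| * ω := by
    have h1 : ∀ j, ∑ c ∈ Finset.Ioc 0 ⌊t (j + 1) / r i⌋₊, v i c -
        ∑ c ∈ Finset.Ioc 0 ⌊t j / r i⌋₊, v i c = ∑ c ∈ Finset.Ioc (g j) (g (j + 1)), v i c := by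
      intro j
      rw [sub_eq_iff_eq_add', Finset.sum_Ioc_consecutive _ (Nat.zero_le _) (hgm (Nat.le_succ j))]
    simp_rw [h1]
    have h2 : |B| * ω ≥ ω * ∑ j ∈ Finset.range J, ∑ c ∈ Finset.Ioc (g j) (g (j + 1)), ‖v i c‖ := by
      rw [mul_comm |B|]
      refine mul_le_mul_of_nonneg_left (le_trans (le_of_eq ?_) (hBi.trans (le_abs_self B))) hω0.le
      have := sum_Ioc_floor_eq (F := fun c => ((‖v i c‖ : ℝ) : ℂ)) hgm hg0 J
      rw [hgJ] at this
      exact_mod_cast this.symm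
    rw [← hgJ, sum_Ioc_floor_eq hgm hg0, ← Finset.sum_sub_distrib]
    refine (norm_sum_le _ _).trans (le_trans ?_ h2)
    rw [Finset.mul_sum]
    refine Finset.sum_le_sum fun j hj => ?_
    have hj := Finset.mem_range.1 hj
    rw [Finset.mul_sum, Finset.mul_sum, ← Finset.sum_sub_distrib]
    refine (norm_sum_le _ _).trans (Finset.sum_le_sum fun c hc => ?_)
    rw [Finset.mem_Ioc] at hc
    rw [mul_comm (f _), ← mul_sub, norm_mul, mul_comm ω]
    refine mul_le_mul_of_nonneg_left (hclose j hj _ ?_ ?_) (norm_nonneg _)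
    · exact ((div_le_iff₀ hri).1 (Nat.lt_of_floor_lt hc.1).le)
    · exact (le_div_iff₀ hri).1 ((Nat.le_floor_iff (by have := ht0 (j + 1); positivity)).1 hc.2)
  rw [dist_eq_norm] at hsi ⊢
  have h3 : (|B| + |κ|) * ω < ε / 2 := by
    rw [hω, mul_div_assoc', div_lt_iff₀ (by positivity)]
    nlinarith [abs_nonneg B, abs_nonneg κ]
  set a := ∑ c ∈ Finset.Ioc 0 ⌊1 / r i⌋₊, v i c * f (c * r i)
  set b := ∑ j ∈ Finset.range J, f (t (j + 1)) *
      (∑ c ∈ Finset.Ioc 0 ⌊t (j + 1) / r i⌋₊, v i c - ∑ c ∈ Finset.Ioc 0 ⌊t j / r i⌋₊, v i c)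
  set c := ∑ j ∈ Finset.range J, f (t (j + 1)) *
        (((κ * t (j + 1) ^ 2 : ℝ) : ℂ) - ((κ * t j ^ 2 : ℝ) : ℂ))
  rw [norm_sub_rev] at h_int
  have h4 := norm_sub_le_norm_sub_add_norm_sub a b
    ((κ : ℂ) * ∫ p in (0 : ℝ)..1, f p * ((2 * p : ℝ) : ℂ))
  have h5 := norm_sub_le_norm_sub_add_norm_sub b c
    ((κ : ℂ) * ∫ p in (0 : ℝ)..1, f p * ((2 * p : ℝ) : ℂ))
  linarith

open Filter Topology

/-- Triples `(y, α, β)` with `y → 0⁺` and `y ^ (1 / 2 - δ) ≤ β - α ≤ 1`. -/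
def horo (δ : ℝ) : Filter (ℝ × ℝ × ℝ) :=
  comap Prod.fst (𝓝[>] 0) ⊓
    𝓟 {p | p.1 ^ ((1 : ℝ) / 2 - δ) ≤ p.2.2 - p.2.1 ∧ p.2.2 - p.2.1 ≤ 1}

lemma tendsto_fst_horo (δ : ℝ) : Tendsto Prod.fst (horo δ) (𝓝[>] 0) :=
  tendsto_comap.mono_left inf_le_left

lemma eventually_horo (δ : ℝ) : ∀ᶠ p in horo δ, 0 < p.1 ∧ 0 < √p.1 ∧ p.1 < 1 ∧
    p.1 ^ ((1 : ℝ) / 2 - δ) ≤ p.2.2 - p.2.1 ∧ 0 < p.2.2 - p.2.1 ∧ p.2.2 - p.2.1 ≤ 1 := by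
  have h1 : ∀ᶠ p in horo δ, p.1 ∈ Set.Ioo (0 : ℝ) 1 :=
    tendsto_fst_horo δ (Ioo_mem_nhdsGT one_pos)
  have h2 : ∀ᶠ p in horo δ, p ∈ {p : ℝ × ℝ × ℝ | p.1 ^ ((1 : ℝ) / 2 - δ) ≤ p.2.2 - p.2.1 ∧
      p.2.2 - p.2.1 ≤ 1} := mem_inf_of_right (mem_principal_self _)
  filter_upwards [h1, h2] with p hp1 hp2
  exact ⟨hp1.1, Real.sqrt_pos.2 hp1.1, hp1.2, hp2.1,
    (Real.rpow_pos_of_pos hp1.1 _).trans_le hp2.1, hp2.2⟩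

lemma exists_of_eventually_horo {δ : ℝ} {P : ℝ × ℝ × ℝ → Prop} (h : ∀ᶠ p in horo δ, P p) :
    ∃ y₀ > 0, ∀ y, 0 < y → y ≤ y₀ → ∀ α β : ℝ, y ^ ((1 : ℝ) / 2 - δ) ≤ β - α → β - α ≤ 1 →
      P (y, α, β) := by
  rw [horo, Filter.Eventually, mem_inf_principal, mem_comap] at h
  obtain ⟨t, ht, hsub⟩ := h
  obtain ⟨u, hu, hut⟩ := mem_nhdsGT_iff_exists_Ioc_subset.1 ht
  exact ⟨u, hu, fun y hy hyu α β h1 h2 => hsub (hut ⟨hy, hyu⟩ : (y, α, β) ∈ Prod.fst ⁻¹' t) ⟨h1, h2⟩⟩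

lemma tendsto_sqrt_mul_log_div {δ : ℝ} (hδ : 0 < δ) :
    Tendsto (fun p : ℝ × ℝ × ℝ => √p.1 * (1 + Real.log (1 / √p.1)) / (p.2.2 - p.2.1)) (horo δ)
      (𝓝 0) := by
  have h1 : Tendsto (fun y : ℝ => y ^ δ - (1 / 2) * (Real.log y * y ^ δ)) (𝓝[>] 0) (𝓝 0) := by
    have a1 : Tendsto (fun y : ℝ => y ^ δ) (𝓝[>] 0) (𝓝 0) := by
      have := (Real.continuousAt_rpow_const 0 δ (Or.inr hδ.le)).tendsto
      rw [Real.zero_rpow hδ.ne'] at this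
      exact this.mono_left nhdsWithin_le_nhds
    have := a1.sub ((tendsto_log_mul_rpow_nhdsGT_zero hδ).const_mul (1 / 2))
    simpa using this
  refine squeeze_zero' ?_ ?_ (h1.comp (tendsto_fst_horo δ))
  · filter_upwards [eventually_horo δ] with p ⟨h0, hs, h1, h2, h3, h4⟩
    have : 0 ≤ Real.log (1 / √p.1) := Real.log_nonneg (by
      rw [le_div_iff₀ hs, one_mul]; exact Real.sqrt_le_one.2 h1.le)
    positivity
  · filter_upwards [eventually_horo δ] with p ⟨h0, hs, h1, h2, h3, h4⟩
    have hlog : Real.log (1 / √p.1) = -(Real.log p.1 / 2) := by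
      rw [one_div, Real.log_inv, Real.log_sqrt h0.le]
    have hlog0 : 0 ≤ -(Real.log p.1 / 2) := by
      have := Real.log_nonpos h0.le h1.le; linarith
    rw [hlog, div_le_iff₀ h3]
    have : p.1 ^ δ * p.1 ^ ((1 : ℝ) / 2 - δ) = √p.1 := by
      rw [← Real.rpow_add h0, Real.sqrt_eq_rpow]; congr 1; ring
    simp only [Function.comp]
    calc √p.1 * (1 + -(Real.log p.1 / 2))
        = (p.1 ^ δ * (1 + -(Real.log p.1 / 2))) * p.1 ^ ((1 : ℝ) / 2 - δ) := by rw [← this]; ring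
      _ ≤ (p.1 ^ δ * (1 + -(Real.log p.1 / 2))) * (p.2.2 - p.2.1) := by
          refine mul_le_mul_of_nonneg_left h2 ?_
          have := Real.rpow_nonneg h0.le δ
          positivity
      _ = _ := by ring

lemma tendsto_sqrt_div {δ : ℝ} (hδ : 0 < δ) :
    Tendsto (fun p : ℝ × ℝ × ℝ => √p.1 / (p.2.2 - p.2.1)) (horo δ) (𝓝 0) := by
  refine squeeze_zero' ?_ ?_ (tendsto_sqrt_mul_log_div hδ)
  · filter_upwards [eventually_horo δ] with p ⟨h0, hs, h1, h2, h3, h4⟩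
    positivity
  · filter_upwards [eventually_horo δ] with p ⟨h0, hs, h1, h2, h3, h4⟩
    have : 0 ≤ Real.log (1 / √p.1) := Real.log_nonneg (by
      rw [le_div_iff₀ hs, one_mul]; exact Real.sqrt_le_one.2 h1.le)
    gcongr
    nlinarith

lemma tendsto_one_div_sqrt_atTop (δ : ℝ) :
    Tendsto (fun p : ℝ × ℝ × ℝ => 1 / √p.1) (horo δ) atTop := by
  simp_rw [one_div]
  refine tendsto_inv_nhdsGT_zero.comp ?_
  refine tendsto_nhdsWithin_iff.2 ⟨?_, ?_⟩
  · have h1 := (Real.continuous_sqrt.tendsto 0).comp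
      ((tendsto_fst_horo δ).mono_right nhdsWithin_le_nhds)
    rwa [Real.sqrt_zero] at h1
  · filter_upwards [eventually_horo δ] with p hp using hp.2.1

lemma tendsto_sum_window {δ : ℝ} (hδ : 0 < δ) (n : ℤ) {t : ℝ} (ht0 : 0 ≤ t) (ht1 : t ≤ 1) :
    Tendsto (fun p : ℝ × ℝ × ℝ => ∑ c ∈ Finset.Ioc 0 ⌊t / √p.1⌋₊,
      ((p.1 / (p.2.2 - p.2.1) : ℝ) : ℂ) * window n p.2.1 p.2.2 c) (horo δ)
      (𝓝 ((density n * t ^ 2 : ℝ) : ℂ)) := by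
  rcases ht0.eq_or_lt with rfl | ht
  · simpa using tendsto_const_nhds
  have hfl : Tendsto (fun p : ℝ × ℝ × ℝ => (⌊t / √p.1⌋₊ : ℝ) * √p.1) (horo δ) (𝓝 t) := by
    have := (tendsto_nat_floor_mul_div_atTop ht0).comp (tendsto_one_div_sqrt_atTop δ)
    refine this.congr fun p => ?_
    simp [div_eq_mul_inv]
  have hfl2 : Tendsto (fun p : ℝ × ℝ × ℝ => ((density n * ((⌊t / √p.1⌋₊ : ℝ) * √p.1) ^ 2 : ℝ) : ℂ))
      (horo δ) (𝓝 ((density n * t ^ 2 : ℝ) : ℂ)) :=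
    (Complex.continuous_ofReal.tendsto _).comp ((hfl.pow 2).const_mul _)
  suffices hd : Tendsto (fun p : ℝ × ℝ × ℝ => ∑ c ∈ Finset.Ioc 0 ⌊t / √p.1⌋₊,
      ((p.1 / (p.2.2 - p.2.1) : ℝ) : ℂ) * window n p.2.1 p.2.2 c -
      ((density n * ((⌊t / √p.1⌋₊ : ℝ) * √p.1) ^ 2 : ℝ) : ℂ)) (horo δ) (𝓝 0) by
    simpa using hd.add hfl2
  rw [Metric.tendsto_nhds]
  intro ε hε
  obtain ⟨T, hT⟩ := exists_sum_window_sub_le n (half_pos hε)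
  have hlim := (tendsto_sqrt_mul_log_div hδ).const_mul |T|
  rw [mul_zero] at hlim
  filter_upwards [eventually_horo δ, hlim.eventually_lt_const (half_pos ht),
    hfl.eventually_const_lt (half_lt_self ht)] with p ⟨h0, hs, h1, h2, h3, h4⟩ h5 h6
  rw [dist_zero_right]
  set X := ⌊t / √p.1⌋₊ with hX
  have hXle : (X : ℝ) * √p.1 ≤ t := by
    rw [← le_div_iff₀ hs]; exact Nat.floor_le (by positivity)
  have hX0 : (0 : ℝ) < X := by
    by_contra hcon
    have : (X : ℝ) * √p.1 ≤ 0 := mul_nonpos_of_nonpos_of_nonneg (not_lt.1 hcon) hs.le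
    linarith
  have hX1 : (1 : ℝ) ≤ X := by
    have : 0 < X := by exact_mod_cast hX0
    exact_mod_cast this
  have hlogX : Real.log X ≤ Real.log (1 / √p.1) := by
    refine Real.log_le_log hX0 ?_
    rw [le_div_iff₀ hs]; linarith
  have hlog0 : 0 ≤ Real.log X := Real.log_nonneg hX1
  have hcond : T * (1 + Real.log X) ≤ (p.2.2 - p.2.1) * X := by
    rw [← mul_div_assoc, div_lt_iff₀ h3] at h5
    have h7 : T * (1 + Real.log X) * √p.1 ≤ (p.2.2 - p.2.1) * X * √p.1 := by
      calc T * (1 + Real.log X) * √p.1 ≤ |T| * (1 + Real.log (1 / √p.1)) * √p.1 := by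
            refine mul_le_mul_of_nonneg_right (mul_le_mul (le_abs_self T) (by linarith)
              (by linarith) (abs_nonneg _)) hs.le
        _ ≤ t / 2 * (p.2.2 - p.2.1) := by linarith
        _ ≤ (X * √p.1) * (p.2.2 - p.2.1) := by gcongr
        _ = _ := by ring
    exact le_of_mul_le_mul_right h7 hs
  have hmain := hT X p.2.1 p.2.2 (by linarith) h4 hcond
  rw [← Finset.mul_sum]
  have hy : √p.1 * √p.1 = p.1 := Real.mul_self_sqrt h0.le
  have heq : ((density n * ((X : ℝ) * √p.1) ^ 2 : ℝ) : ℂ) = ((p.1 / (p.2.2 - p.2.1) : ℝ) : ℂ) *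
      ((density n * ((p.2.2 - p.2.1) * X ^ 2) : ℝ) : ℂ) := by
    rw [← Complex.ofReal_mul]
    congr 1
    rw [mul_pow, pow_two √p.1, hy]
    field_simp
  rw [heq, ← mul_sub, norm_mul, Complex.norm_real, Real.norm_eq_abs, abs_of_pos (by positivity)]
  calc p.1 / (p.2.2 - p.2.1) * _ ≤ p.1 / (p.2.2 - p.2.1) * (ε / 2 * ((p.2.2 - p.2.1) * X ^ 2)) :=
        mul_le_mul_of_nonneg_left hmain (by positivity)
    _ = ε / 2 * (X * √p.1) ^ 2 := by rw [mul_pow, pow_two √p.1, hy]; field_simp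
    _ ≤ ε / 2 * 1 := by gcongr; exact pow_le_one₀ (by positivity) (by linarith)
    _ < ε := by linarith

lemma sum_norm_window_le {δ : ℝ} (hδ : 0 < δ) (n : ℤ) :
    ∀ᶠ p in horo δ, ∑ c ∈ Finset.Ioc 0 ⌊1 / √p.1⌋₊,
      ‖((p.1 / (p.2.2 - p.2.1) : ℝ) : ℂ) * window n p.2.1 p.2.2 c‖ ≤ 2 := by
  filter_upwards [eventually_horo δ, (tendsto_sqrt_div hδ).eventually_le_const one_pos] with p
    ⟨h0, hs, h1, h2, h3, h4⟩ h5
  set X := ⌊1 / √p.1⌋₊ with hX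
  have hXle : (X : ℝ) * √p.1 ≤ 1 := by
    rw [← le_div_iff₀ hs]; exact Nat.floor_le (by positivity)
  have hy : √p.1 * √p.1 = p.1 := Real.mul_self_sqrt h0.le
  have h6 : ∀ c ∈ Finset.Ioc 0 X, ‖((p.1 / (p.2.2 - p.2.1) : ℝ) : ℂ) * window n p.2.1 p.2.2 c‖ ≤
      √p.1 * (√p.1 * X) + √p.1 * (√p.1 / (p.2.2 - p.2.1)) := by
    intro c hc
    have hcX : (c : ℝ) ≤ X := by exact_mod_cast (Finset.mem_Ioc.1 hc).2
    rw [norm_mul, Complex.norm_real, Real.norm_eq_abs, abs_of_pos (by positivity)]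
    calc p.1 / (p.2.2 - p.2.1) * ‖window n p.2.1 p.2.2 c‖
        ≤ p.1 / (p.2.2 - p.2.1) * (X * (p.2.2 - p.2.1) + 1) := by
          gcongr
          refine (norm_window_le n (by linarith) c).trans ?_
          gcongr
      _ = _ := by rw [← mul_assoc, ← mul_div_assoc, hy]; field_simp
  refine (Finset.sum_le_sum h6).trans ?_
  rw [Finset.sum_const, Nat.card_Ioc, nsmul_eq_mul, Nat.sub_zero]
  calc (X : ℝ) * (√p.1 * (√p.1 * X) + √p.1 * (√p.1 / (p.2.2 - p.2.1)))
      = (X * √p.1) * (X * √p.1) + (X * √p.1) * (√p.1 / (p.2.2 - p.2.1)) := by ring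
    _ ≤ 1 * 1 + 1 * 1 := by gcongr
    _ = 2 := by norm_num

lemma tendsto_weighted_window {δ : ℝ} (hδ : 0 < δ) (n : ℤ) {f : ℝ → ℂ} (hf : Continuous f) :
    Tendsto (fun p : ℝ × ℝ × ℝ => ∑ c ∈ Finset.Ioc 0 ⌊1 / √p.1⌋₊,
      ((p.1 / (p.2.2 - p.2.1) : ℝ) : ℂ) * window n p.2.1 p.2.2 c * f (c * √p.1)) (horo δ)
      (𝓝 ((density n : ℂ) * ∫ p in (0 : ℝ)..1, f p * ((2 * p : ℝ) : ℂ))) :=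
  tendsto_weighted_sum ((eventually_horo δ).mono fun _ h => h.2.1) (sum_norm_window_le hδ n)
    (fun _ h0 h1 => tendsto_sum_window hδ n h0 h1) hf

lemma intervalIntegrable_mul_id {g : ℝ → ℂ} {M : ℝ} (hg : ContinuousOn g (Set.Ioi 0))
    (hM : ∀ p, 0 < p → ‖g p‖ ≤ M / p) {a b : ℝ} (ha : 0 ≤ a) (hab : a ≤ b) :
    IntervalIntegrable (fun p => g p * ((2 * p : ℝ) : ℂ)) volume a b := by
  rw [intervalIntegrable_iff_integrableOn_Ioc_of_le hab]
  have hsub : Set.Ioc a b ⊆ Set.Ioi 0 := fun p hp => lt_of_le_of_lt ha hp.1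
  refine ⟨?_, .restrict_of_bounded (C := 2 * M) measure_Ioc_lt_top ?_⟩
  · refine ContinuousOn.aestronglyMeasurable ?_ measurableSet_Ioc
    exact (hg.mono hsub).mul (Continuous.continuousOn (by fun_prop))
  · refine (ae_restrict_mem measurableSet_Ioc).mono fun p hp => ?_
    have hp0 : 0 < p := hsub hp
    rw [norm_mul, Complex.norm_real, Real.norm_eq_abs, abs_of_pos (by positivity)]
    calc ‖g p‖ * (2 * p) ≤ M / p * (2 * p) := by gcongr; exact hM p hp0
      _ = 2 * M := by field_simp

lemma norm_integral_truncate_sub_le {g : ℝ → ℂ} {M η : ℝ} (hg : ContinuousOn g (Set.Ioi 0))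
    (hM : ∀ p, 0 < p → ‖g p‖ ≤ M / p) (hη0 : 0 < η) (hη1 : η ≤ 1) :
    ‖(∫ p in (0 : ℝ)..1, g (max p η) * ((2 * p : ℝ) : ℂ)) -
      ∫ p in (0 : ℝ)..1, g p * ((2 * p : ℝ) : ℂ)‖ ≤ 4 * M * η := by
  have hM0 : 0 ≤ M := by simpa using (norm_nonneg _).trans (hM 1 one_pos)
  have hf : Continuous fun p => g (max p η) :=
    hg.comp_continuous (by fun_prop) fun p => hη0.trans_le (le_max_right _ _)
  have hfi : ∀ a b, IntervalIntegrable (fun p => g (max p η) * ((2 * p : ℝ) : ℂ)) volume a b :=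
    fun a b => (hf.mul (by fun_prop)).intervalIntegrable _ _
  rw [← intervalIntegral.integral_sub (hfi _ _)
    (intervalIntegrable_mul_id hg hM le_rfl zero_le_one),
    ← intervalIntegral.integral_add_adjacent_intervals (b := η)
    ((hfi _ _).sub (intervalIntegrable_mul_id hg hM le_rfl hη0.le))
    ((hfi _ _).sub (intervalIntegrable_mul_id hg hM hη0.le hη1))]
  have h2 : ∫ p in η..1, (g (max p η) * ((2 * p : ℝ) : ℂ) - g p * ((2 * p : ℝ) : ℂ)) = 0 := by
    rw [← intervalIntegral.integral_zero (a := η) (b := 1)]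
    refine intervalIntegral.integral_congr fun p hp => ?_
    rw [Set.uIcc_of_le hη1] at hp
    simp [max_eq_left hp.1]
  rw [h2, add_zero]
  refine (intervalIntegral.norm_integral_le_of_norm_le_const (C := 4 * M) fun p hp => ?_).trans_eq
    (by rw [sub_zero, abs_of_pos hη0])
  rw [Set.uIoc_of_le hη0.le] at hp
  rw [← sub_mul, norm_mul, Complex.norm_real, Real.norm_eq_abs, abs_of_pos (by linarith [hp.1]),
    max_eq_right hp.2]
  have h3 : M / η ≤ M / p := by have := hp.1; have := hp.2; gcongr
  have hp0 := hp.1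
  calc ‖g η - g p‖ * (2 * p) ≤ (M / p + M / p) * (2 * p) := by
        gcongr
        exact (norm_sub_le _ _).trans (add_le_add ((hM η hη0).trans h3) (hM p hp0))
    _ = 4 * M := by field_simp; ring

lemma norm_sum_window_truncate_sub_le {g : ℝ → ℂ} {M η r : ℝ} (hM : ∀ p, 0 < p → ‖g p‖ ≤ M / p)
    (hη0 : 0 < η) (hr : 0 < r) (hr1 : r ≤ 1) (n : ℤ) {α β : ℝ} (hαβ : α < β) :
    ‖∑ c ∈ Finset.Ioc 0 ⌊1 / r⌋₊, ((r ^ 2 / (β - α) : ℝ) : ℂ) * window n α β c * g (c * r) -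
      ∑ c ∈ Finset.Ioc 0 ⌊1 / r⌋₊, ((r ^ 2 / (β - α) : ℝ) : ℂ) * window n α β c *
        g (max (c * r) η)‖ ≤
      2 * M * η + 2 * M * (r * (1 + Real.log (1 / r)) / (β - α)) := by
  have hM0 : 0 ≤ M := by simpa using (norm_nonneg _).trans (hM 1 one_pos)
  have hℓ : 0 < β - α := sub_pos.2 hαβ
  set X := ⌊1 / r⌋₊ with hX
  have hterm : ∀ c ∈ Finset.Ioc 0 X, ‖((r ^ 2 / (β - α) : ℝ) : ℂ) * window n α β c * g (c * r) -
      ((r ^ 2 / (β - α) : ℝ) : ℂ) * window n α β c * g (max (c * r) η)‖ ≤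
      2 * M * (if c ≤ ⌊η / r⌋₊ then r else 0) + 2 * M * (r / (β - α)) * (c : ℝ)⁻¹ := by
    intro c hc
    have hc0 : (0 : ℝ) < c := by exact_mod_cast (Finset.mem_Ioc.1 hc).1
    by_cases hcη : c * r ≤ η
    · have hfl : c ≤ ⌊η / r⌋₊ := Nat.le_floor ((le_div_iff₀ hr).2 hcη)
      rw [if_pos hfl, ← mul_sub, norm_mul, norm_mul, Complex.norm_real, Real.norm_eq_abs,
        abs_of_pos (by positivity), max_eq_right hcη]
      have hcr : 0 < c * r := by positivity
      have h3 : M / η ≤ M / (c * r) := by gcongr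
      calc r ^ 2 / (β - α) * ‖window n α β c‖ * ‖g (c * r) - g η‖
          ≤ r ^ 2 / (β - α) * (c * (β - α) + 1) * (M / (c * r) + M / (c * r)) := by
            gcongr
            · exact norm_window_le n hαβ.le c
            · exact (norm_sub_le _ _).trans (add_le_add (hM _ hcr) ((hM η hη0).trans h3))
        _ = _ := by field_simp; ring
    · rw [max_eq_left (not_le.1 hcη).le, sub_self, norm_zero]
      split_ifs <;> positivity
  rw [← Finset.sum_sub_distrib]
  refine (norm_sum_le _ _).trans ((Finset.sum_le_sum hterm).trans ?_)
  rw [Finset.sum_add_distrib, ← Finset.mul_sum, ← Finset.mul_sum]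
  have h1 : ∑ c ∈ Finset.Ioc 0 X, (if c ≤ ⌊η / r⌋₊ then r else 0) ≤ η := by
    rw [← Finset.sum_filter]
    calc ∑ c ∈ (Finset.Ioc 0 X).filter (fun c => c ≤ ⌊η / r⌋₊), r
        ≤ ∑ c ∈ Finset.Ioc 0 ⌊η / r⌋₊, r := by
          refine Finset.sum_le_sum_of_subset_of_nonneg (fun c hc => ?_) fun _ _ _ => hr.le
          simp only [Finset.mem_filter, Finset.mem_Ioc] at hc ⊢
          exact ⟨hc.1.1, hc.2⟩
      _ = ⌊η / r⌋₊ * r := by rw [Finset.sum_const, Nat.card_Ioc, nsmul_eq_mul, Nat.sub_zero]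
      _ ≤ η / r * r := by gcongr; exact Nat.floor_le (by positivity)
      _ = η := by field_simp
  have h2 : ∑ c ∈ Finset.Ioc 0 X, (c : ℝ)⁻¹ ≤ 1 + Real.log (1 / r) := by
    have h := harmonic_le_one_add_log X
    rw [harmonic_eq_sum_Icc] at h
    push_cast at h
    refine h.trans ?_
    have h1r : 1 ≤ 1 / r := by rw [le_div_iff₀ hr]; linarith
    have hX1 : (0 : ℝ) < X := by
      have : 0 < X := Nat.floor_pos.2 h1r
      exact_mod_cast this
    gcongr
    exact Nat.floor_le (by positivity)
  calc _ ≤ 2 * M * η + 2 * M * (r / (β - α)) * (1 + Real.log (1 / r)) := by gcongr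
    _ = _ := by ring

/-- A version of `tendsto_weighted_window` for weights with a simple pole at `0`. -/
lemma tendsto_weighted_window_of_le_div {δ : ℝ} (hδ : 0 < δ) (n : ℤ) {g : ℝ → ℂ} {M : ℝ}
    (hg : ContinuousOn g (Set.Ioi 0)) (hM : ∀ p, 0 < p → ‖g p‖ ≤ M / p) :
    Tendsto (fun p : ℝ × ℝ × ℝ => ∑ c ∈ Finset.Ioc 0 ⌊1 / √p.1⌋₊,
      ((p.1 / (p.2.2 - p.2.1) : ℝ) : ℂ) * window n p.2.1 p.2.2 c * g (c * √p.1)) (horo δ)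
      (𝓝 ((density n : ℂ) * ∫ p in (0 : ℝ)..1, g p * ((2 * p : ℝ) : ℂ))) := by
  have hM0 : 0 ≤ M := by simpa using (norm_nonneg _).trans (hM 1 one_pos)
  rw [Metric.tendsto_nhds]
  intro ε hε
  obtain ⟨η, hη0, hη1, hη2, hη3⟩ : ∃ η : ℝ, 0 < η ∧ η ≤ 1 ∧ 2 * M * η ≤ ε / 8 ∧
      |density n| * (4 * M * η) ≤ ε / 4 := by
    set K := 1 + 2 * M + |density n| * (4 * M) with hK
    have hK0 : 0 < K := by positivity
    have hp : 0 ≤ |density n| * (4 * M) := by positivity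
    set u := min 1 (ε / (8 * K)) with hu
    have hu0 : 0 < u := by positivity
    have hKu : K * u ≤ ε / 8 := by
      calc K * u ≤ K * (ε / (8 * K)) := by gcongr; exact min_le_right _ _
        _ = ε / 8 := by field_simp
    refine ⟨u, hu0, min_le_left _ _, ?_, ?_⟩
    · refine le_trans ?_ hKu
      gcongr; linarith
    · have : |density n| * (4 * M * u) ≤ K * u := by
        rw [← mul_assoc]; gcongr; linarith
      linarith
  have hf : Continuous fun p => g (max p η) :=
    hg.comp_continuous (by fun_prop) fun p => hη0.trans_le (le_max_right _ _)
  have h_int := norm_integral_truncate_sub_le hg hM hη0 hη1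
  have hlim := (tendsto_sqrt_mul_log_div hδ).const_mul (2 * M)
  rw [mul_zero] at hlim
  filter_upwards [eventually_horo δ, hlim.eventually_lt_const (show (0 : ℝ) < ε / 8 by positivity),
    Metric.tendsto_nhds.1 (tendsto_weighted_window hδ n hf) (ε / 4) (by positivity)] with p
    ⟨h0, hs, h1, h2, h3, h4⟩ h5 h6
  have h7 := norm_sum_window_truncate_sub_le hM hη0 hs (Real.sqrt_le_one.2 h1.le) n
    (sub_pos.1 h3)
  rw [Real.sq_sqrt h0.le] at h7
  rw [dist_eq_norm] at h6 ⊢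
  have h8 : ‖(density n : ℂ) * (∫ p in (0 : ℝ)..1, g (max p η) * ((2 * p : ℝ) : ℂ)) -
      (density n : ℂ) * ∫ p in (0 : ℝ)..1, g p * ((2 * p : ℝ) : ℂ)‖ ≤ ε / 4 := by
    rw [← mul_sub, norm_mul, Complex.norm_real, Real.norm_eq_abs]
    exact (mul_le_mul_of_nonneg_left h_int (abs_nonneg _)).trans hη3
  refine (norm_sub_le_norm_sub_add_norm_sub _ _ _).trans_lt
    ((add_le_add h7 ((norm_sub_le_norm_sub_add_norm_sub _ _ _).trans
      (add_le_add h6.le h8))).trans_lt ?_)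
  linarith

lemma eq_of_sq_add_sq_lt {x y : ℝ} (hy : 0 < y) {c c' : ℕ} {d d' : ℤ} (hc : 1 ≤ c) (hc' : 1 ≤ c')
    (hd : Int.gcd c d = 1) (hd' : Int.gcd c' d' = 1)
    (h : ((c : ℝ) * x + d) ^ 2 + ((c : ℝ) * y) ^ 2 < y)
    (h' : ((c' : ℝ) * x + d') ^ 2 + ((c' : ℝ) * y) ^ 2 < y) : c = c' ∧ d = d' := by
  have key : (c : ℤ) * d' - c' * d = 0 := by
    have h1 : (y * ((c : ℝ) * d' - c' * d)) ^ 2 < y ^ 2 := by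
      have e1 : (y * ((c : ℝ) * d' - c' * d)) ^ 2 +
          (((c : ℝ) * x + d) * ((c' : ℝ) * x + d') + ((c : ℝ) * y) * ((c' : ℝ) * y)) ^ 2 =
          (((c : ℝ) * x + d) ^ 2 + ((c : ℝ) * y) ^ 2) *
          (((c' : ℝ) * x + d') ^ 2 + ((c' : ℝ) * y) ^ 2) := by ring
      have e2 : (((c : ℝ) * x + d) ^ 2 + ((c : ℝ) * y) ^ 2) *
          (((c' : ℝ) * x + d') ^ 2 + ((c' : ℝ) * y) ^ 2) < y * y :=
        mul_lt_mul'' h h' (by positivity) (by positivity)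
      nlinarith [sq_nonneg (((c : ℝ) * x + d) * ((c' : ℝ) * x + d') + ((c : ℝ) * y) * ((c' : ℝ) * y))]
    rw [mul_pow] at h1
    have h2 : ((c : ℝ) * d' - c' * d) ^ 2 < 1 := by
      by_contra hcon
      have := mul_le_mul_of_nonneg_left (not_lt.1 hcon) (sq_nonneg y)
      linarith
    have h3 : ((c : ℤ) * d' - c' * d) ^ 2 < 1 := by exact_mod_cast h2
    have h4 : ((c : ℤ) * d' - c' * d) ^ 2 = 0 := by
      have := sq_nonneg ((c : ℤ) * d' - c' * d); omega
    exact pow_eq_zero_iff (two_ne_zero) |>.1 h4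
  have k1 : (c : ℤ) * d' = c' * d := sub_eq_zero.1 key
  have d1 : (c : ℤ) ∣ c' := (Int.isCoprime_iff_gcd_eq_one.2 hd).dvd_of_dvd_mul_right ⟨d', k1.symm⟩
  have d2 : (c' : ℤ) ∣ c := (Int.isCoprime_iff_gcd_eq_one.2 hd').dvd_of_dvd_mul_right ⟨d, k1⟩
  have hcc : c = c' := Nat.dvd_antisymm (Int.natCast_dvd_natCast.1 d1) (Int.natCast_dvd_natCast.1 d2)
  subst hcc
  refine ⟨rfl, ?_⟩
  exact (mul_left_cancel₀ (by exact_mod_cast (by omega : c ≠ 0)) k1).symm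

lemma im_moebius {a b c d : ℤ} (h : a * d - b * c = 1) (z : ℂ) :
    (((a : ℂ) * z + b) / ((c : ℂ) * z + d)).im =
      z.im / (((c : ℝ) * z.re + d) ^ 2 + ((c : ℝ) * z.im) ^ 2) := by
  have h' : (a : ℝ) * d - b * c = 1 := by exact_mod_cast h
  rw [Complex.div_im, Complex.normSq_apply, ← sub_div]
  simp only [Complex.add_re, Complex.mul_re, Complex.intCast_re, Complex.intCast_im, zero_mul,
    sub_zero, Complex.add_im, Complex.mul_im, add_zero]
  congr 1
  · linear_combination z.im * h'
  · ring

/-- Points of a low horocycle meet at most one translate of the cusp region. -/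
lemma lift_fA_cases {a b : ℕ → ℤ → ℤ} (hab : ∀ (c : ℕ) (d : ℤ), 1 ≤ c → Int.gcd (c : ℤ) d = 1 →
    a c d * d - b c d * (c : ℤ) = 1) {A : ℝ} (hA : 1 < A) {z : ℂ} (hz0 : 0 < z.im)
    (hzA : z.im < A) (θ : ℝ) :
    (∀ h : ℝ → ℝ → ℂ, lift a b (fA A h) z θ = 0) ∨
      ∃ ξ η : ℝ, ∀ h : ℝ → ℝ → ℂ, lift a b (fA A h) z θ = h ξ η := by
  set P : ℕ → ℤ → Prop := fun c d => (1 ≤ c ∧ Int.gcd (c : ℤ) d = 1) ∧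
    A ≤ (((a c d : ℂ) * z + (b c d : ℂ)) / ((c : ℂ) * z + (d : ℂ))).im with hP
  have hlt : ∀ c d, P c d → ((c : ℝ) * z.re + d) ^ 2 + ((c : ℝ) * z.im) ^ 2 < z.im := by
    rintro c d ⟨⟨h1, h2⟩, h3⟩
    have h4 := im_moebius (hab c d h1 h2) z
    rw [Int.cast_natCast, Int.cast_natCast] at h4
    rw [h4] at h3
    have hc : (0 : ℝ) < c := by exact_mod_cast h1
    have hq : 0 < ((c : ℝ) * z.re + d) ^ 2 + ((c : ℝ) * z.im) ^ 2 := by positivity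
    rw [le_div_iff₀ hq] at h3
    nlinarith
  have hzero : ∀ (h : ℝ → ℝ → ℂ) c d, ¬ P c d → (if 1 ≤ c ∧ Int.gcd (c : ℤ) d = 1 then
      fA A h (((a c d : ℂ) * z + (b c d : ℂ)) / ((c : ℂ) * z + (d : ℂ)))
        (θ - 2 * Complex.arg ((c : ℂ) * z + (d : ℂ))) else 0) = 0 := by
    intro h c d hnP
    split_ifs with h1
    · rw [fA, if_neg fun h2 => hnP ⟨h1, h2⟩]
    · rfl
  have hfirst : ∀ h : ℝ → ℝ → ℂ, fA A h z θ = 0 := fun h => by rw [fA, if_neg hzA.not_ge]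
  by_cases hex : ∃ c d, P c d
  · obtain ⟨c₀, d₀, h₀⟩ := hex
    right
    refine ⟨(((a c₀ d₀ : ℂ) * z + (b c₀ d₀ : ℂ)) / ((c₀ : ℂ) * z + (d₀ : ℂ))).re,
      θ - 2 * Complex.arg ((c₀ : ℂ) * z + (d₀ : ℂ)), fun h => ?_⟩
    have huniq : ∀ c d, P c d → c = c₀ ∧ d = d₀ := fun c d hcd =>
      eq_of_sq_add_sq_lt hz0 hcd.1.1 h₀.1.1 hcd.1.2 h₀.1.2 (hlt _ _ hcd) (hlt _ _ h₀)
    rw [lift, hfirst, zero_add, tsum_eq_single c₀, tsum_eq_single d₀, if_pos h₀.1, fA, if_pos h₀.2]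
    · exact fun d hd => hzero _ _ _ fun hp => hd (huniq _ _ hp).2
    · intro c hc
      rw [tsum_congr fun d => hzero h c d fun hp => hc (huniq _ _ hp).1, tsum_zero]
  · left
    push Not at hex
    intro h
    rw [lift, hfirst, zero_add, tsum_congr fun c => (tsum_congr fun d => hzero h c d (hex c d)).trans
      tsum_zero, tsum_zero]

/-- The profile of a cuspidal mode `e(nx) φ(θ)` seen along a horocycle, after rescaling. -/
noncomputable def profile (A : ℝ) (n : ℤ) (φ : ℝ → ℂ) (t s : ℝ) : ℂ :=
  if s ^ 2 + t ^ 2 ≤ 1 / A then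
    Complex.exp (-(2 * Real.pi * Complex.I * n * ((s / (t * (s ^ 2 + t ^ 2)) : ℝ) : ℂ))) *
      φ (-(2 * Complex.arg ((s : ℂ) + t * Complex.I)))
  else 0

/-- The function `e(nx) φ(θ)`. -/
noncomputable def mode (n : ℤ) (φ : ℝ → ℂ) (x θ : ℝ) : ℂ :=
  Complex.exp (2 * Real.pi * Complex.I * n * x) * φ θ

lemma fA_mode_moebius {A : ℝ} (hA : 0 < A) (n : ℤ) (φ : ℝ → ℂ) {y : ℝ} (hy : 0 < y) (x : ℝ) {c : ℕ}
    (hc : 1 ≤ c) {a b d : ℤ} (h : a * d - b * c = 1) :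
    fA A (mode n φ) (((a : ℂ) * (x + y * Complex.I) + b) / ((c : ℂ) * (x + y * Complex.I) + d))
      (0 - 2 * Complex.arg ((c : ℂ) * (x + y * Complex.I) + d)) =
    intPhase n c d * profile A n φ (c * √y) ((c * x + d) / √y) := by
  have hr : 0 < √y := Real.sqrt_pos.2 hy
  have hy2 : y = √y ^ 2 := (Real.sq_sqrt hy.le).symm
  have hc0 : (0 : ℝ) < c := by exact_mod_cast hc
  set r := √y with hrdef
  set t : ℝ := c * r with ht
  set s : ℝ := (c * x + d) / r with hs
  have ht0 : 0 < t := by positivity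
  have hq : 0 < s ^ 2 + t ^ 2 := by positivity
  have hx : (c : ℝ) * x + d = r * s := by rw [hs]; field_simp
  have hh : (a : ℝ) * d - b * c = 1 := by exact_mod_cast h
  have hw : (c : ℂ) * (x + y * Complex.I) + d = (r : ℂ) * (s + t * Complex.I) := by
    apply Complex.ext
    · simp [← hx]
    · simp [ht]; rw [hy2]; ring
  have hst : (s : ℂ) + t * Complex.I ≠ 0 := fun h0 => by
    have := congrArg Complex.im h0
    simp at this
    exact ht0.ne' this
  have hquot : ((a : ℂ) * (x + y * Complex.I) + b) / ((c : ℂ) * (x + y * Complex.I) + d) =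
      ((a / c - s / (t * (s ^ 2 + t ^ 2)) : ℝ) : ℂ) + ((1 / (s ^ 2 + t ^ 2) : ℝ) : ℂ) * Complex.I := by
    rw [hw, div_eq_iff (mul_ne_zero (by exact_mod_cast hr.ne') hst)]
    apply Complex.ext
    · have e1 : (a : ℝ) * x + b = (a * (r * s) - 1) / c := by
        rw [← hx, eq_div_iff hc0.ne']; linear_combination -hh
      have e2 : (a / c - s / (t * (s ^ 2 + t ^ 2))) * (r * s) - 1 / (s ^ 2 + t ^ 2) * (r * t) =
          (a * (r * s) - 1) / c := by
        rw [ht] at hq ⊢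
        field_simp
        ring
      simp only [Complex.add_re, Complex.mul_re, Complex.intCast_re, Complex.intCast_im,
        Complex.ofReal_re, Complex.ofReal_im, Complex.I_re, Complex.I_im, Complex.add_im,
        Complex.mul_im, zero_mul, mul_zero, sub_zero, add_zero, zero_add, mul_one]
      rw [e1, ← e2]
    · have e2 : (a / c - s / (t * (s ^ 2 + t ^ 2))) * (r * t) + 1 / (s ^ 2 + t ^ 2) * (r * s) =
          a * r ^ 2 := by
        rw [ht] at hq ⊢
        field_simp
        ring
      simp only [Complex.add_re, Complex.mul_re, Complex.intCast_re, Complex.intCast_im,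
        Complex.ofReal_re, Complex.ofReal_im, Complex.I_re, Complex.I_im, Complex.add_im,
        Complex.mul_im, zero_mul, mul_zero, sub_zero, add_zero, zero_add, mul_one]
      rw [e2, hy2]
  have harg : Complex.arg ((c : ℂ) * (x + y * Complex.I) + d) =
      Complex.arg ((s : ℂ) + t * Complex.I) := by
    rw [hw, Complex.arg_real_mul _ hr]
  have hcond : A ≤ 1 / (s ^ 2 + t ^ 2) ↔ s ^ 2 + t ^ 2 ≤ 1 / A := le_one_div hA hq
  rw [fA, profile, harg, hquot, intPhase_eq (by exact_mod_cast hc0.ne') h]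
  have him : ∀ u v : ℝ, ((u : ℂ) + v * Complex.I).im = v := by simp
  have hre : ∀ u v : ℝ, ((u : ℂ) + v * Complex.I).re = u := by simp
  rw [him, hre]
  by_cases hle : s ^ 2 + t ^ 2 ≤ 1 / A
  · rw [if_pos (hcond.2 hle), if_pos hle, mode, zero_sub, ← mul_assoc, ← Complex.exp_add]
    congr 2
    push_cast
    ring
  · rw [if_neg fun h1 => hle (hcond.1 h1), if_neg hle, mul_zero]

lemma profile_eq_zero {A : ℝ} (hA : 1 < A) (n : ℤ) (φ : ℝ → ℂ) {t s : ℝ} (h : 1 ≤ s ^ 2 + t ^ 2) :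
    profile A n φ t s = 0 := by
  have : 1 / A < 1 := by rw [div_lt_one (by linarith)]; exact hA
  rw [profile, if_neg (by linarith)]

lemma norm_profile_le (A : ℝ) (n : ℤ) {φ : ℝ → ℂ} {M : ℝ} (hM : ∀ θ, ‖φ θ‖ ≤ M) (t s : ℝ) :
    ‖profile A n φ t s‖ ≤ M := by
  rw [profile]
  split_ifs
  · have : -(2 * Real.pi * Complex.I * n * ((s / (t * (s ^ 2 + t ^ 2)) : ℝ) : ℂ)) =
        ((-(2 * Real.pi * n * (s / (t * (s ^ 2 + t ^ 2)))) : ℝ) : ℂ) * Complex.I := by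
      push_cast; ring
    rw [norm_mul, this, Complex.norm_exp_ofReal_mul_I, one_mul]
    exact hM _
  · simpa using (norm_nonneg _).trans (hM 0)

lemma measurable_profile (A : ℝ) (n : ℤ) {φ : ℝ → ℂ} (hφ : Measurable φ) :
    Measurable fun p : ℝ × ℝ => profile A n φ p.1 p.2 := by
  unfold profile
  refine Measurable.ite (measurableSet_le (by fun_prop) (by fun_prop)) ?_ (by fun_prop)
  refine Measurable.mul (by fun_prop) (hφ.comp ?_)
  refine ((Complex.measurable_arg.comp ?_).const_mul 2).neg
  fun_prop

lemma norm_profile_le_indicator {A : ℝ} (hA : 1 < A) (n : ℤ) {φ : ℝ → ℂ} {M : ℝ}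
    (hM : ∀ θ, ‖φ θ‖ ≤ M) (t s : ℝ) :
    ‖profile A n φ t s‖ ≤ (Set.Icc (-1 : ℝ) 1).indicator (fun _ => M) s := by
  by_cases hs : s ∈ Set.Icc (-1 : ℝ) 1
  · rw [Set.indicator_of_mem hs]; exact norm_profile_le A n hM t s
  · rw [Set.indicator_of_notMem hs, profile_eq_zero hA, norm_zero]
    rw [Set.mem_Icc, ← abs_le, not_le] at hs
    have : 1 < s ^ 2 := by rw [← sq_abs]; nlinarith
    nlinarith [sq_nonneg t]

lemma integrable_indicator_Icc (a b M : ℝ) :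
    Integrable ((Set.Icc a b).indicator fun _ => M) (volume : Measure ℝ) :=
  (integrable_indicator_iff measurableSet_Icc).2 (integrableOn_const (by simp))

lemma integrable_profile {A : ℝ} (hA : 1 < A) (n : ℤ) {φ : ℝ → ℂ} (hφ : Measurable φ) {M : ℝ}
    (hM : ∀ θ, ‖φ θ‖ ≤ M) (t : ℝ) : Integrable (profile A n φ t) :=
  (integrable_indicator_Icc (-1) 1 M).mono'
    ((measurable_profile A n hφ).comp (by fun_prop : Measurable fun s => (t, s))).aestronglyMeasurable
    (.of_forall (norm_profile_le_indicator hA n hM t))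

lemma norm_integral_profile_le {A : ℝ} (hA : 1 < A) (n : ℤ) {φ : ℝ → ℂ} {M : ℝ}
    (hM : ∀ θ, ‖φ θ‖ ≤ M) (t : ℝ) : ‖∫ s, profile A n φ t s‖ ≤ 2 * M := by
  refine (norm_integral_le_of_norm_le (integrable_indicator_Icc (-1) 1 M)
    (.of_forall (norm_profile_le_indicator hA n hM t))).trans_eq ?_
  rw [integral_indicator measurableSet_Icc, setIntegral_const, Real.volume_real_Icc]
  norm_num

lemma continuousOn_integral_profile {A : ℝ} (hA : 1 < A) (n : ℤ) {φ : ℝ → ℂ} (hφ : Continuous φ)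
    {M : ℝ} (hM : ∀ θ, ‖φ θ‖ ≤ M) :
    ContinuousOn (fun t => ∫ s, profile A n φ t s) (Set.Ioi 0) := by
  intro t (ht : 0 < t)
  refine ContinuousAt.continuousWithinAt ?_
  refine continuousAt_of_dominated (bound := (Set.Icc (-1 : ℝ) 1).indicator fun _ => M)
    (.of_forall fun t' => (integrable_profile hA n hφ.measurable hM t').aestronglyMeasurable)
    (.of_forall fun t' => .of_forall (norm_profile_le_indicator hA n hM t'))
    (integrable_indicator_Icc _ _ _) ?_
  have hfin : ({√(1 / A - t ^ 2), -√(1 / A - t ^ 2)} : Set ℝ).Finite := by simp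
  filter_upwards [hfin.countable.ae_notMem volume] with s hs
  have hne : s ^ 2 + t ^ 2 ≠ 1 / A := by
    intro h
    have h1 : √(1 / A - t ^ 2) = |s| := by rw [← Real.sqrt_sq_eq_abs]; congr 1; linarith
    rw [h1] at hs
    rcases abs_choice s with h2 | h2 <;> simp [h2] at hs
  have hcont : ContinuousAt (fun t : ℝ => s ^ 2 + t ^ 2) t := by fun_prop
  rcases lt_or_gt_of_ne hne with hlt | hgt
  · have hev : (fun t => Complex.exp (-(2 * Real.pi * Complex.I * n *
        ((s / (t * (s ^ 2 + t ^ 2)) : ℝ) : ℂ))) *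
        φ (-(2 * Complex.arg ((s : ℂ) + t * Complex.I)))) =ᶠ[𝓝 t] fun t => profile A n φ t s := by
      filter_upwards [hcont.eventually_lt continuousAt_const hlt] with u hu
      rw [profile, if_pos hu.le]
    refine ContinuousAt.congr ?_ hev
    refine ContinuousAt.mul ?_ ?_
    · have : t * (s ^ 2 + t ^ 2) ≠ 0 := by positivity
      have h1 : ContinuousAt (fun t : ℝ => s / (t * (s ^ 2 + t ^ 2))) t :=
        ContinuousAt.div (by fun_prop) (by fun_prop) this
      have h2 := Complex.continuous_ofReal.continuousAt.comp h1
      exact Complex.continuous_exp.continuousAt.comp ((h2.const_mul _).neg)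
    · refine hφ.continuousAt.comp ?_
      refine ContinuousAt.neg (ContinuousAt.mul continuousAt_const ?_)
      have h3 : (s : ℂ) + t * Complex.I ∈ Complex.slitPlane := by
        right; simpa using ht.ne'
      exact (Complex.continuousAt_arg h3).comp (f := fun t : ℝ => (s : ℂ) + t * Complex.I)
        (by fun_prop)
  · have hev : (fun _ => (0 : ℂ)) =ᶠ[𝓝 t] fun t => profile A n φ t s := by
      filter_upwards [continuousAt_const.eventually_lt hcont hgt] with u hu
      rw [profile, if_neg (not_le.2 hu)]
    exact ContinuousAt.congr continuousAt_const hev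

lemma profile_zero_polar (A : ℝ) (φ : ℝ → ℂ) {r θ : ℝ} (hr : 0 < r) (hθ : θ ∈ Set.Ioo (-Real.pi) Real.pi) :
    profile A 0 φ (r * Real.sin θ) (r * Real.cos θ) = if r ^ 2 ≤ 1 / A then φ (-(2 * θ)) else 0 := by
  have h1 : (r * Real.cos θ) ^ 2 + (r * Real.sin θ) ^ 2 = r ^ 2 := by
    rw [mul_pow, mul_pow, ← mul_add, Real.cos_sq_add_sin_sq, mul_one]
  have h2 : Complex.arg (((r * Real.cos θ : ℝ) : ℂ) + ((r * Real.sin θ : ℝ) : ℂ) * Complex.I) = θ := by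
    have := Complex.arg_mul_cos_add_sin_mul_I hr ⟨hθ.1, hθ.2.le⟩
    refine Eq.trans ?_ this
    congr 1
    push_cast; ring
  rw [profile, h1, h2]
  simp

lemma integral_profile_zero {A : ℝ} (hA : 1 < A) {φ : ℝ → ℂ} (hφ : Continuous φ)
    (hper : ∀ θ, φ (θ + 2 * Real.pi) = φ θ) {M : ℝ} (hM : ∀ θ, ‖φ θ‖ ≤ M) :
    ∫ t in (0 : ℝ)..1, ∫ s, profile A 0 φ t s =
      ((1 / (4 * A) : ℝ) : ℂ) * ∫ θ in (0 : ℝ)..(2 * Real.pi), φ θ := by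
  have hA0 : 0 < A := by linarith
  set F : ℝ × ℝ → ℂ := fun p => if 0 < p.2 then profile A 0 φ p.2 p.1 else 0 with hF
  have hFm : Measurable F := by
    refine Measurable.ite (measurableSet_lt (by fun_prop) (by fun_prop)) ?_ (by fun_prop)
    exact (measurable_profile A 0 hφ.measurable).comp measurable_swap
  have hFi : Integrable F := by
    have hb : ∀ p : ℝ × ℝ, ‖F p‖ ≤ (Set.Icc (-1 : ℝ) 1 ×ˢ Set.Icc (-1 : ℝ) 1).indicator
        (fun _ => M) p := by
      rintro ⟨s, t⟩
      have hM0 : 0 ≤ M := (norm_nonneg _).trans (hM 0)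
      by_cases hp : (s, t) ∈ Set.Icc (-1 : ℝ) 1 ×ˢ Set.Icc (-1 : ℝ) 1
      · rw [Set.indicator_of_mem hp, hF]
        dsimp only
        split_ifs
        · exact norm_profile_le A 0 hM t s
        · simpa using hM0
      · rw [Set.indicator_of_notMem hp, hF]
        dsimp only
        rw [profile_eq_zero hA, ite_self, norm_zero]
        rw [Set.mem_prod, Set.mem_Icc, Set.mem_Icc, ← abs_le, ← abs_le, not_and_or, not_le,
          not_le] at hp
        rw [← sq_abs s, ← sq_abs t]
        rcases hp with hp | hp <;> dsimp only at hp <;> nlinarith [sq_nonneg |s|, sq_nonneg |t|]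
    refine Integrable.mono' (g := (Set.Icc (-1 : ℝ) 1 ×ˢ Set.Icc (-1 : ℝ) 1).indicator
        (fun _ => M)) ?_ hFm.aestronglyMeasurable (.of_forall hb)
    refine (integrable_indicator_iff (measurableSet_Icc.prod measurableSet_Icc)).2
      (integrableOn_const ?_)
    rw [Measure.volume_eq_prod, Measure.prod_prod]
    exact (ENNReal.mul_lt_top measure_Icc_lt_top measure_Icc_lt_top).ne
  have h1 : ∫ p, F p = ∫ t in (0 : ℝ)..1, ∫ s, profile A 0 φ t s := by
    rw [Measure.volume_eq_prod, integral_prod_symm _ hFi, intervalIntegral.integral_of_le zero_le_one,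
      ← integral_indicator measurableSet_Ioc]
    refine integral_congr_ae (.of_forall fun t => ?_)
    by_cases ht : 0 < t
    · by_cases ht1 : t ≤ 1
      · rw [Set.indicator_of_mem (show t ∈ Set.Ioc 0 1 from ⟨ht, ht1⟩)]
        simp [hF, ht]
      · rw [Set.indicator_of_notMem fun h => ht1 h.2]
        have : ∀ s, F (s, t) = 0 := fun s => by
          rw [hF]; dsimp only
          rw [profile_eq_zero hA, ite_self]
          nlinarith [sq_nonneg s]
        simp [this]
    · rw [Set.indicator_of_notMem fun h => ht h.1]
      simp [hF, ht]
  have h2 : ∫ p, F p = (∫ r in Set.Ioi (0 : ℝ), if r ^ 2 ≤ 1 / A then (r : ℂ) else 0) *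
      ∫ θ in Set.Ioo (-Real.pi) Real.pi, if 0 < θ then φ (-(2 * θ)) else 0 := by
    rw [← integral_comp_polarCoord_symm, ← setIntegral_prod_mul, ← Measure.volume_eq_prod]
    refine setIntegral_congr_fun (measurableSet_Ioi.prod measurableSet_Ioo) ?_
    rintro ⟨r, θ⟩ ⟨hr, hθ⟩
    simp only [Set.mem_Ioi] at hr
    dsimp only at hθ
    simp only [polarCoord_symm_apply, hF]
    rw [profile_zero_polar A φ hr hθ]
    have hsin : 0 < r * Real.sin θ ↔ 0 < θ := by
      rw [mul_pos_iff_of_pos_left hr]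
      refine ⟨fun h => ?_, fun h => Real.sin_pos_of_pos_of_lt_pi h hθ.2⟩
      by_contra hcon
      exact h.not_ge (Real.sin_nonpos_of_nonpos_of_neg_pi_le (not_lt.1 hcon) hθ.1.le)
    simp only [hsin]
    split_ifs <;> simp
  have h3 : (∫ r in Set.Ioi (0 : ℝ), if r ^ 2 ≤ 1 / A then (r : ℂ) else 0) =
      ((1 / (2 * A) : ℝ) : ℂ) := by
    have : ∀ r ∈ Set.Ioi (0 : ℝ), (if r ^ 2 ≤ 1 / A then (r : ℂ) else 0) =
        (Set.Ioc 0 √(1 / A)).indicator (fun r : ℝ => (r : ℂ)) r := by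
      intro r (hr : 0 < r)
      have : r ^ 2 ≤ 1 / A ↔ r ∈ Set.Ioc 0 √(1 / A) := by
        rw [Set.mem_Ioc, Real.le_sqrt hr.le (by positivity)]; simp [hr]
      simp only [this, Set.indicator_apply]
    rw [setIntegral_congr_fun measurableSet_Ioi this, setIntegral_indicator measurableSet_Ioc,
      Set.inter_eq_right.2 Set.Ioc_subset_Ioi_self,
      ← intervalIntegral.integral_of_le (Real.sqrt_nonneg _), intervalIntegral.integral_ofReal,
      integral_id, Real.sq_sqrt (by positivity)]
    congr 1
    field_simp
    ring
  have h4 : (∫ θ in Set.Ioo (-Real.pi) Real.pi, if 0 < θ then φ (-(2 * θ)) else 0) =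
      (1 / 2 : ℂ) * ∫ θ in (0 : ℝ)..(2 * Real.pi), φ θ := by
    have h5 : (∫ θ in Set.Ioo (-Real.pi) Real.pi, if 0 < θ then φ (-(2 * θ)) else 0) =
        ∫ θ in Set.Ioo 0 Real.pi, φ (-(2 * θ)) := by
      have : (fun θ : ℝ => if 0 < θ then φ (-(2 * θ)) else 0) =
          (Set.Ioi 0).indicator fun θ => φ (-(2 * θ)) := by
        ext θ; simp [Set.indicator_apply]
      rw [this, setIntegral_indicator measurableSet_Ioi]
      congr 2
      ext θ
      simp only [Set.mem_inter_iff, Set.mem_Ioo, Set.mem_Ioi]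
      constructor
      · rintro ⟨⟨-, h⟩, h'⟩; exact ⟨h', h⟩
      · rintro ⟨h', h⟩; exact ⟨⟨by linarith [Real.pi_pos], h⟩, h'⟩
    rw [h5, ← integral_Ioc_eq_integral_Ioo, ← intervalIntegral.integral_of_le Real.pi_pos.le]
    have h6 := intervalIntegral.integral_comp_mul_left φ (c := -2) (a := 0) (b := Real.pi) (by norm_num)
    simp only [neg_mul, mul_zero] at h6
    rw [h6, intervalIntegral.integral_symm]
    have hp : Function.Periodic φ (2 * Real.pi) := hper
    have h7 := hp.intervalIntegral_add_eq (-(2 * Real.pi)) 0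
    rw [neg_add_cancel, zero_add] at h7
    rw [h7, Complex.real_smul]
    push_cast
    ring
  rw [← h1, h2, h3, h4]
  push_cast
  ring

/-- The contribution of the bottom row `(c, d)` to the lift of `e(nx) φ(θ)` along a horocycle. -/
noncomputable def branch (A : ℝ) (n : ℤ) (φ : ℝ → ℂ) (y : ℝ) (c : ℕ) (d : ℤ) (x : ℝ) : ℂ :=
  intPhase n c d * profile A n φ (c * √y) ((c * x + d) / √y)

lemma of_branch_ne_zero {A : ℝ} (hA : 1 < A) {n : ℤ} {φ : ℝ → ℂ} {y : ℝ} (hy : 0 < y) {c : ℕ} {d : ℤ}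
    {x : ℝ} (h : branch A n φ y c d x ≠ 0) :
    Int.gcd c d = 1 ∧ ((c : ℝ) * x + d) ^ 2 + ((c : ℝ) * y) ^ 2 < y := by
  constructor
  · by_contra hcon
    exact h (by rw [branch, intPhase_of_gcd_ne_one hcon, zero_mul])
  · by_contra hcon
    refine h ?_
    rw [branch, profile_eq_zero hA, mul_zero]
    rw [div_pow, mul_pow, Real.sq_sqrt hy.le]
    have : (((c : ℝ) * x + d) ^ 2 + ((c : ℝ) * y) ^ 2) / y ≥ 1 := by
      rw [ge_iff_le, le_div_iff₀ hy]; linarith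
    calc 1 ≤ (((c : ℝ) * x + d) ^ 2 + ((c : ℝ) * y) ^ 2) / y := this
      _ = _ := by field_simp

lemma norm_branch_le (A : ℝ) (n : ℤ) {φ : ℝ → ℂ} {M : ℝ} (hM : ∀ θ, ‖φ θ‖ ≤ M) (y : ℝ) (c : ℕ)
    (d : ℤ) (x : ℝ) : ‖branch A n φ y c d x‖ ≤ M := by
  rw [branch, norm_mul]
  have h1 := norm_profile_le A n hM (c * √y) ((c * x + d) / √y)
  exact (mul_le_of_le_one_left (norm_nonneg _) (norm_intPhase_le n c d)).trans h1

lemma sum_norm_branch_le {A : ℝ} (hA : 1 < A) (n : ℤ) {φ : ℝ → ℂ} {M : ℝ} (hM : ∀ θ, ‖φ θ‖ ≤ M)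
    {y : ℝ} (hy : 0 < y) {S : Finset (ℕ × ℤ)} (hS : ∀ p ∈ S, 1 ≤ p.1) (x : ℝ) :
    ∑ p ∈ S, ‖branch A n φ y p.1 p.2 x‖ ≤ M := by
  by_cases h : ∃ p ∈ S, branch A n φ y p.1 p.2 x ≠ 0
  · obtain ⟨p, hp, hne⟩ := h
    rw [Finset.sum_eq_single_of_mem p hp]
    · exact norm_branch_le A n hM y _ _ x
    · intro q hq hqp
      by_contra hcon
      have h1 := of_branch_ne_zero hA hy hne
      have h2 := of_branch_ne_zero hA hy (norm_ne_zero_iff.1 hcon)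
      have := eq_of_sq_add_sq_lt hy (hS q hq) (hS p hp) h2.1 h1.1 h2.2 h1.2
      exact hqp (Prod.ext this.1 this.2)
  · push Not at h
    rw [Finset.sum_eq_zero fun p hp => by rw [h p hp, norm_zero]]
    exact (norm_nonneg _).trans (hM 0)

lemma lift_mode_eq_tsum {a b : ℕ → ℤ → ℤ} (hab : ∀ (c : ℕ) (d : ℤ), 1 ≤ c →
    Int.gcd (c : ℤ) d = 1 → a c d * d - b c d * (c : ℤ) = 1) {A : ℝ} (hA : 1 < A) (n : ℤ)
    (φ : ℝ → ℂ) {y : ℝ} (hy : 0 < y) (hy1 : y < 1) (x : ℝ) :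
    lift a b (fA A (mode n φ)) ((x : ℂ) + (y : ℂ) * Complex.I) 0 =
      ∑' c : ℕ, ∑' d : ℤ, if 1 ≤ c then branch A n φ y c d x else 0 := by
  have h0 : fA A (mode n φ) ((x : ℂ) + (y : ℂ) * Complex.I) 0 = 0 := by
    rw [fA, if_neg]
    simp only [Complex.add_im, Complex.ofReal_im, Complex.mul_im, Complex.ofReal_re, Complex.I_im,
      Complex.I_re]
    linarith
  rw [lift, h0, zero_add]
  refine tsum_congr fun c => tsum_congr fun d => ?_
  by_cases hc : 1 ≤ c
  · by_cases hd : Int.gcd (c : ℤ) d = 1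
    · rw [if_pos ⟨hc, hd⟩, if_pos hc, branch]
      exact fA_mode_moebius (by linarith) n φ hy x hc (hab c d hc hd)
    · rw [if_neg fun h => hd h.2, if_pos hc, branch, intPhase_of_gcd_ne_one hd, zero_mul]
  · rw [if_neg fun h => hc h.1, if_neg hc]

/-- The bottom rows that matter over a bounded interval. -/
noncomputable def rows (y α β : ℝ) : Finset (ℕ × ℤ) :=
  Finset.Ioc 0 ⌊1 / √y⌋₊ ×ˢ
    Finset.Icc (-⌈⌊1 / √y⌋₊ * (|α| + |β|) + 1⌉) ⌈⌊1 / √y⌋₊ * (|α| + |β|) + 1⌉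

lemma one_le_of_mem_rows {y α β : ℝ} {p : ℕ × ℤ} (h : p ∈ rows y α β) : 1 ≤ p.1 :=
  (Finset.mem_Ioc.1 (Finset.mem_product.1 h).1).1

lemma abs_lt_of_sq_add_sq_lt {y u v : ℝ} (h : u ^ 2 + v ^ 2 < y) : |u| < √y := by
  rw [← Real.sqrt_sq_eq_abs]
  exact Real.sqrt_lt_sqrt (sq_nonneg _) (by nlinarith [sq_nonneg v])

lemma mem_rows_of_branch_ne_zero {A : ℝ} (hA : 1 < A) {n : ℤ} {φ : ℝ → ℂ} {y : ℝ} (hy : 0 < y)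
    (hy1 : y < 1) {α β x : ℝ} (hx : x ∈ Set.Icc α β) {c : ℕ} (hc : 1 ≤ c) {d : ℤ}
    (h : branch A n φ y c d x ≠ 0) : (c, d) ∈ rows y α β := by
  have h1 := (of_branch_ne_zero hA hy h).2
  have hr : 0 < √y := Real.sqrt_pos.2 hy
  have hyr : √y * √y = y := Real.mul_self_sqrt hy.le
  have h2 := abs_lt_of_sq_add_sq_lt h1
  have h3 := abs_lt_of_sq_add_sq_lt (add_comm _ (((c : ℝ) * y) ^ 2) ▸ h1)
  rw [abs_of_nonneg (by positivity)] at h3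
  have hcX : c ≤ ⌊1 / √y⌋₊ := by
    refine Nat.le_floor ?_
    rw [le_div_iff₀ hr]
    nlinarith
  refine Finset.mem_product.2 ⟨Finset.mem_Ioc.2 ⟨hc, hcX⟩, ?_⟩
  have hcX' : (c : ℝ) ≤ ⌊1 / √y⌋₊ := by exact_mod_cast hcX
  have hx' : |x| ≤ |α| + |β| := by
    have := abs_nonneg α; have := abs_nonneg β
    have := neg_abs_le α; have := le_abs_self β
    rw [abs_le]; constructor <;> linarith [hx.1, hx.2]
  have hd : |(d : ℝ)| ≤ ⌊1 / √y⌋₊ * (|α| + |β|) + 1 := by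
    calc |(d : ℝ)| = |((c : ℝ) * x + d) - c * x| := by ring_nf
      _ ≤ |(c : ℝ) * x + d| + |c * x| := abs_sub _ _
      _ ≤ 1 + c * |x| := by
          rw [abs_mul, Nat.abs_cast]
          have := Real.sqrt_le_one.2 hy1.le
          linarith
      _ ≤ 1 + ⌊1 / √y⌋₊ * (|α| + |β|) := by gcongr
      _ = _ := by ring
  have hd2 : |(d : ℝ)| ≤ (⌈⌊1 / √y⌋₊ * (|α| + |β|) + 1⌉ : ℤ) := hd.trans (Int.le_ceil _)
  have hd3 : |d| ≤ ⌈⌊1 / √y⌋₊ * (|α| + |β|) + 1⌉ := by exact_mod_cast hd2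
  exact Finset.mem_Icc.2 (abs_le.1 hd3)

lemma lift_mode_eq_sum {a b : ℕ → ℤ → ℤ} (hab : ∀ (c : ℕ) (d : ℤ), 1 ≤ c →
    Int.gcd (c : ℤ) d = 1 → a c d * d - b c d * (c : ℤ) = 1) {A : ℝ} (hA : 1 < A) (n : ℤ)
    (φ : ℝ → ℂ) {y : ℝ} (hy : 0 < y) (hy1 : y < 1) {α β x : ℝ} (hx : x ∈ Set.Icc α β) :
    lift a b (fA A (mode n φ)) ((x : ℂ) + (y : ℂ) * Complex.I) 0 =
      ∑ p ∈ rows y α β, branch A n φ y p.1 p.2 x := by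
  rw [lift_mode_eq_tsum hab hA n φ hy hy1]
  have hz : ∀ c d, (c, d) ∉ rows y α β → (if 1 ≤ c then branch A n φ y c d x else 0) = 0 := by
    intro c d hcd
    split_ifs with hc
    · by_contra hne
      exact hcd (mem_rows_of_branch_ne_zero hA hy hy1 hx hc hne)
    · rfl
  rw [rows, Finset.sum_product, tsum_eq_sum]
  · refine Finset.sum_congr rfl fun c hc => ?_
    rw [tsum_eq_sum]
    · exact Finset.sum_congr rfl fun d _ => if_pos (Finset.mem_Ioc.1 hc).1
    · exact fun d hd => hz c d fun h => hd (Finset.mem_product.1 h).2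
  · intro c hc
    rw [tsum_congr fun d => hz c d fun h => hc (Finset.mem_product.1 h).1, tsum_zero]

lemma integral_branch (A : ℝ) (n : ℤ) (φ : ℝ → ℂ) {y : ℝ} (hy : 0 < y) {c : ℕ} (hc : 1 ≤ c) (d : ℤ) :
    ∫ x, branch A n φ y c d x =
      intPhase n c d * (((√y / c : ℝ) : ℂ) * ∫ s, profile A n φ (c * √y) s) := by
  have hr : 0 < √y := Real.sqrt_pos.2 hy
  have hc0 : (0 : ℝ) < c := by exact_mod_cast hc
  simp only [branch]
  rw [integral_const_mul]
  congr 1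
  have h1 : ∀ x : ℝ, (c * x + d) / √y = (c / √y) * (x + d / c) := fun x => by field_simp
  simp_rw [h1]
  rw [integral_add_right_eq_self (fun x => profile A n φ (c * √y) ((c / √y) * x)) ((d : ℝ) / c),
    Measure.integral_comp_mul_left, abs_of_pos (by positivity), inv_div, Complex.real_smul]

lemma integrable_branch {A : ℝ} (hA : 1 < A) (n : ℤ) {φ : ℝ → ℂ} (hφ : Measurable φ) {M : ℝ}
    (hM : ∀ θ, ‖φ θ‖ ≤ M) {y : ℝ} (hy : 0 < y) {c : ℕ} (hc : 1 ≤ c) (d : ℤ) :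
    Integrable (branch A n φ y c d) := by
  have hr : 0 < √y := Real.sqrt_pos.2 hy
  have hc0 : (0 : ℝ) < c := by exact_mod_cast hc
  have h1 : ∀ x : ℝ, (c * x + d) / √y = (c / √y) * (x + d / c) := fun x => by field_simp
  refine Integrable.const_mul ?_ _
  simp_rw [h1]
  exact ((integrable_profile hA n hφ hM (c * √y)).comp_mul_left' (by positivity)).comp_add_right _

lemma intervalIntegrable_lift_mode {a b : ℕ → ℤ → ℤ} (hab : ∀ (c : ℕ) (d : ℤ), 1 ≤ c →
    Int.gcd (c : ℤ) d = 1 → a c d * d - b c d * (c : ℤ) = 1) {A : ℝ} (hA : 1 < A) (n : ℤ)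
    {φ : ℝ → ℂ} (hφ : Measurable φ) {M : ℝ} (hM : ∀ θ, ‖φ θ‖ ≤ M) {y : ℝ} (hy : 0 < y) (hy1 : y < 1)
    {α β : ℝ} (h : α ≤ β) : IntervalIntegrable
      (fun x : ℝ => lift a b (fA A (mode n φ)) ((x : ℂ) + (y : ℂ) * Complex.I) 0) volume α β := by
  rw [intervalIntegrable_iff_integrableOn_Ioc_of_le h]
  have h1 : Integrable fun x => ∑ p ∈ rows y α β, branch A n φ y p.1 p.2 x :=
    integrable_finsetSum _ fun p hp => integrable_branch hA n hφ hM hy (one_le_of_mem_rows hp) p.2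
  exact h1.integrableOn.congr_fun
    (fun x hx => (lift_mode_eq_sum hab hA n φ hy hy1 (Set.Ioc_subset_Icc_self hx)).symm)
    measurableSet_Ioc

lemma mem_Ioc_iff_of_branch_ne_zero {A : ℝ} (hA : 1 < A) {n : ℤ} {φ : ℝ → ℂ} {y : ℝ} (hy : 0 < y)
    {α β x : ℝ} (hα : x ∉ Set.Icc (α - √y) (α + √y)) (hβ : x ∉ Set.Icc (β - √y) (β + √y))
    {c : ℕ} (hc : 1 ≤ c) {d : ℤ} (h : branch A n φ y c d x ≠ 0) :
    x ∈ Set.Ioc α β ↔ (c : ℝ) * α < -d ∧ -d ≤ (c : ℝ) * β := by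
  have h1 := abs_lt_of_sq_add_sq_lt (of_branch_ne_zero hA hy h).2
  have hc0 : (1 : ℝ) ≤ c := by exact_mod_cast hc
  have hr : 0 < √y := Real.sqrt_pos.2 hy
  rw [abs_lt] at h1
  have hcr : √y ≤ c * √y := by nlinarith
  rw [Set.mem_Icc, not_and_or, not_le, not_le] at hα hβ
  rw [Set.mem_Ioc]
  have key : ∀ γ : ℝ, (x < γ - √y ∨ γ + √y < x) → (γ < x → c * γ < -d) ∧ (x ≤ γ → -d ≤ c * γ) ∧
      (c * γ < -d → γ < x) ∧ (-d ≤ c * γ → x ≤ γ) := by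
    rintro γ (hγ | hγ)
    · have h2 : c * x < c * (γ - √y) := by gcongr
      refine ⟨fun _ => by linarith, fun _ => by linarith, fun _ => by linarith, fun _ => by linarith⟩
    · have h2 : c * (γ + √y) < c * x := by gcongr
      refine ⟨fun _ => by linarith, fun _ => by linarith, fun _ => by linarith, fun _ => by linarith⟩
  obtain ⟨a1, -, a3, -⟩ := key α hα
  obtain ⟨-, b2, -, b4⟩ := key β hβ
  exact ⟨fun h => ⟨a1 h.1, b2 h.2⟩, fun h => ⟨a3 h.1, b4 h.2⟩⟩

lemma sum_rows_integral_branch {A : ℝ} (n : ℤ) (φ : ℝ → ℂ) {y : ℝ} (hy : 0 < y) {α β : ℝ} :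
    ∑ p ∈ (rows y α β).filter (fun p => (p.1 : ℝ) * α < -p.2 ∧ -p.2 ≤ (p.1 : ℝ) * β),
      ∫ x, branch A n φ y p.1 p.2 x =
    ∑ c ∈ Finset.Ioc 0 ⌊1 / √y⌋₊, window (-n) α β c *
      (((√y / c : ℝ) : ℂ) * ∫ s, profile A n φ (c * √y) s) := by
  rw [Finset.sum_filter, rows, Finset.sum_product]
  refine Finset.sum_congr rfl fun c hc => ?_
  have hc1 : 1 ≤ c := (Finset.mem_Ioc.1 hc).1
  have hcX : (c : ℝ) ≤ ⌊1 / √y⌋₊ := by exact_mod_cast (Finset.mem_Ioc.1 hc).2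
  rw [← Finset.sum_filter, window, Finset.sum_mul]
  symm
  refine Finset.sum_nbij' (fun d => -d) (fun d => -d) ?_ ?_ (fun _ _ => neg_neg _)
    (fun _ _ => neg_neg _) ?_
  · intro d hd
    rw [mem_window] at hd
    simp only [Finset.mem_filter, Finset.mem_Icc, Int.cast_neg, neg_neg]
    refine ⟨?_, hd⟩
    have h1 : |(d : ℝ)| ≤ ⌊1 / √y⌋₊ * (|α| + |β|) + 1 := by
      have e1 : (c : ℝ) * |α| ≤ ⌊1 / √y⌋₊ * |α| := by gcongr
      have e2 : (c : ℝ) * |β| ≤ ⌊1 / √y⌋₊ * |β| := by gcongr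
      have e3 : -(c * |α|) ≤ c * α := by
        rw [← mul_neg]; exact mul_le_mul_of_nonneg_left (neg_abs_le α) (Nat.cast_nonneg c)
      have e4 : c * β ≤ c * |β| := mul_le_mul_of_nonneg_left (le_abs_self β) (Nat.cast_nonneg c)
      have e5 : 0 ≤ (⌊1 / √y⌋₊ : ℝ) * |α| := by positivity
      have e6 : 0 ≤ (⌊1 / √y⌋₊ : ℝ) * |β| := by positivity
      rw [abs_le]
      constructor <;> linarith [hd.1, hd.2]
    have hd2 : |(d : ℝ)| ≤ (⌈⌊1 / √y⌋₊ * (|α| + |β|) + 1⌉ : ℤ) := h1.trans (Int.le_ceil _)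
    have hd3 : |d| ≤ ⌈⌊1 / √y⌋₊ * (|α| + |β|) + 1⌉ := by exact_mod_cast hd2
    rw [abs_le] at hd3
    omega
  · intro d hd
    rw [mem_window, Int.cast_neg]
    exact (Finset.mem_filter.1 hd).2
  · intro d _
    rw [integral_branch A n φ hy hc1, intPhase_neg_right _ (by omega)]

lemma norm_integral_lift_mode_sub_le {a b : ℕ → ℤ → ℤ} (hab : ∀ (c : ℕ) (d : ℤ), 1 ≤ c →
    Int.gcd (c : ℤ) d = 1 → a c d * d - b c d * (c : ℤ) = 1) {A : ℝ} (hA : 1 < A) (n : ℤ)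
    {φ : ℝ → ℂ} (hφ : Measurable φ) {M : ℝ} (hM : ∀ θ, ‖φ θ‖ ≤ M) {y : ℝ} (hy : 0 < y) (hy1 : y < 1)
    {α β : ℝ} (h : α ≤ β) :
    ‖(∫ x in α..β, lift a b (fA A (mode n φ)) ((x : ℂ) + (y : ℂ) * Complex.I) 0) -
      ∑ c ∈ Finset.Ioc 0 ⌊1 / √y⌋₊, window (-n) α β c *
        (((√y / c : ℝ) : ℂ) * ∫ s, profile A n φ (c * √y) s)‖ ≤ 4 * M * √y := by
  have hM0 : 0 ≤ M := (norm_nonneg _).trans (hM 0)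
  have hI : ∀ p ∈ rows y α β, Integrable (branch A n φ y p.1 p.2) := fun p hp =>
    integrable_branch hA n hφ hM hy (one_le_of_mem_rows hp) p.2
  have h1 : Integrable fun x => ∑ p ∈ rows y α β, branch A n φ y p.1 p.2 x :=
    integrable_finsetSum _ hI
  have h2 : (∫ x in α..β, lift a b (fA A (mode n φ)) ((x : ℂ) + (y : ℂ) * Complex.I) 0) =
      ∫ x, (Set.Ioc α β).indicator (fun x => ∑ p ∈ rows y α β, branch A n φ y p.1 p.2 x) x := by
    rw [intervalIntegral.integral_of_le h, integral_indicator measurableSet_Ioc]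
    exact setIntegral_congr_fun measurableSet_Ioc fun x hx =>
      lift_mode_eq_sum hab hA n φ hy hy1 (Set.Ioc_subset_Icc_self hx)
  rw [h2, ← sum_rows_integral_branch n φ hy, ← integral_finsetSum _ fun p hp =>
    hI p (Finset.mem_filter.1 hp).1, ← integral_sub (h1.indicator measurableSet_Ioc)
    (integrable_finsetSum _ fun p hp => hI p (Finset.mem_filter.1 hp).1)]
  refine (norm_integral_le_of_norm_le
    ((integrable_indicator_Icc (α - √y) (α + √y) M).add
      (integrable_indicator_Icc (β - √y) (β + √y) M)) (.of_forall fun x => ?_)).trans_eq ?_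
  · rw [Finset.sum_filter]
    have h3 : (Set.Ioc α β).indicator (fun x => ∑ p ∈ rows y α β, branch A n φ y p.1 p.2 x) x =
        ∑ p ∈ rows y α β, (Set.Ioc α β).indicator (branch A n φ y p.1 p.2) x := by
      by_cases hx : x ∈ Set.Ioc α β <;> simp [hx]
    rw [h3, ← Finset.sum_sub_distrib]
    simp only [Pi.add_apply]
    by_cases hE : x ∉ Set.Icc (α - √y) (α + √y) ∧ x ∉ Set.Icc (β - √y) (β + √y)
    · rw [Set.indicator_of_notMem hE.1, Set.indicator_of_notMem hE.2, add_zero,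
        Finset.sum_eq_zero, norm_zero]
      intro p hp
      by_cases hne : branch A n φ y p.1 p.2 x = 0
      · simp [Set.indicator_apply, hne]
      · simp only [Set.indicator_apply, mem_Ioc_iff_of_branch_ne_zero hA hy hE.1 hE.2
          (one_le_of_mem_rows hp) hne, sub_self]
    · have h4 : M ≤ (Set.Icc (α - √y) (α + √y)).indicator (fun _ => M) x +
          (Set.Icc (β - √y) (β + √y)).indicator (fun _ => M) x := by
        have n1 := Set.indicator_nonneg (s := Set.Icc (α - √y) (α + √y)) (f := fun _ : ℝ => M)
          (fun _ _ => hM0) x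
        have n2 := Set.indicator_nonneg (s := Set.Icc (β - √y) (β + √y)) (f := fun _ : ℝ => M)
          (fun _ _ => hM0) x
        rw [not_and_or, not_not, not_not] at hE
        rcases hE with hE | hE
        · rw [Set.indicator_of_mem hE] at n1 ⊢; linarith
        · rw [Set.indicator_of_mem hE] at n2 ⊢; linarith
      refine le_trans ((norm_sum_le _ _).trans ?_) h4
      refine le_trans (Finset.sum_le_sum fun p _ => ?_)
        (sum_norm_branch_le hA n hM hy (fun p hp => one_le_of_mem_rows hp) x)
      rw [Set.indicator_apply]
      split_ifs <;> simp
  · have hr := Real.sqrt_nonneg y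
    rw [integral_add' (integrable_indicator_Icc _ _ _) (integrable_indicator_Icc _ _ _),
      integral_indicator measurableSet_Icc, integral_indicator measurableSet_Icc, setIntegral_const,
      setIntegral_const, Real.volume_real_Icc_of_le (by linarith),
      Real.volume_real_Icc_of_le (by linarith), smul_eq_mul, smul_eq_mul]
    ring

/-- The integral of a mode over its periods. -/
lemma integral_mode (n : ℤ) (φ : ℝ → ℂ) :
    ∫ θ in (0 : ℝ)..(2 * Real.pi), ∫ x in (0 : ℝ)..1, mode n φ x θ =
      if n = 0 then ∫ θ in (0 : ℝ)..(2 * Real.pi), φ θ else 0 := by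
  split_ifs with hn
  · simp [mode, hn]
  · have hc : 2 * Real.pi * Complex.I * n ≠ 0 := by
      have : (Real.pi : ℂ) ≠ 0 := by exact_mod_cast Real.pi_ne_zero
      have hn' : (n : ℂ) ≠ 0 := by exact_mod_cast hn
      simp [this, hn']
    have h1 : ∀ θ, ∫ x in (0 : ℝ)..1, mode n φ x θ = 0 := by
      intro θ
      simp only [mode]
      rw [intervalIntegral.integral_mul_const, integral_exp_mul_complex hc]
      have : Complex.exp (2 * Real.pi * Complex.I * n * (1 : ℝ)) = 1 :=
        Complex.exp_eq_one_iff.2 ⟨n, by push_cast; ring⟩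
      rw [this]
      simp
    simp [h1]

lemma density_mul_integral_profile {A : ℝ} (hA : 1 < A) (n : ℤ) {φ : ℝ → ℂ} (hφ : Continuous φ)
    (hper : ∀ θ, φ (θ + 2 * Real.pi) = φ θ) {M : ℝ} (hM : ∀ θ, ‖φ θ‖ ≤ M) :
    (density (-n) : ℂ) * ∫ p in (0 : ℝ)..1,
      (((p⁻¹ : ℝ) : ℂ) * ∫ s, profile A n φ p s) * ((2 * p : ℝ) : ℂ) =
    ((3 / (2 * Real.pi ^ 2 * A) : ℝ) : ℂ) *
      ∫ θ in (0 : ℝ)..(2 * Real.pi), ∫ x in (0 : ℝ)..1, mode n φ x θ := by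
  rw [integral_mode]
  by_cases hn : n = 0
  · subst hn
    have h1 : ∫ p in (0 : ℝ)..1, (((p⁻¹ : ℝ) : ℂ) * ∫ s, profile A 0 φ p s) * ((2 * p : ℝ) : ℂ) =
        ∫ p in (0 : ℝ)..1, 2 * ∫ s, profile A 0 φ p s := by
      refine intervalIntegral.integral_congr_ae (.of_forall fun p hp => ?_)
      rw [Set.uIoc_of_le zero_le_one] at hp
      have : (p : ℂ) ≠ 0 := by exact_mod_cast hp.1.ne'
      push_cast
      field_simp
    rw [h1, intervalIntegral.integral_const_mul, integral_profile_zero hA hφ hper hM, if_pos rfl,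
      density, if_pos neg_zero]
    have : (Real.pi : ℂ) ≠ 0 := by exact_mod_cast Real.pi_ne_zero
    have hA' : (A : ℂ) ≠ 0 := by exact_mod_cast (by linarith : A ≠ 0)
    push_cast
    field_simp
    ring
  · rw [if_neg hn, mul_zero, density, if_neg (neg_ne_zero.2 hn), Complex.ofReal_zero, zero_mul]

lemma eventually_norm_average_mode_sub_le {δ : ℝ} (hδ : 0 < δ) {A : ℝ} (hA : 1 < A) (n : ℤ)
    {φ : ℝ → ℂ} (hφ : Continuous φ) (hper : ∀ θ, φ (θ + 2 * Real.pi) = φ θ) {M : ℝ}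
    (hM : ∀ θ, ‖φ θ‖ ≤ M) {ε : ℝ} (hε : 0 < ε) :
    ∀ᶠ p in horo δ, ∀ a b : ℕ → ℤ → ℤ, (∀ (c : ℕ) (d : ℤ), 1 ≤ c → Int.gcd (c : ℤ) d = 1 →
      a c d * d - b c d * (c : ℤ) = 1) →
      ‖((1 / (p.2.2 - p.2.1) : ℝ) : ℂ) * (∫ x in p.2.1..p.2.2,
          lift a b (fA A (mode n φ)) ((x : ℂ) + (p.1 : ℂ) * Complex.I) 0) -
        ((3 / (2 * Real.pi ^ 2 * A) : ℝ) : ℂ) *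
          ∫ θ in (0 : ℝ)..(2 * Real.pi), ∫ x in (0 : ℝ)..1, mode n φ x θ‖ ≤ ε := by
  have hg : ContinuousOn (fun p : ℝ => ((p⁻¹ : ℝ) : ℂ) * ∫ s, profile A n φ p s) (Set.Ioi 0) := by
    refine ContinuousOn.mul ?_ (continuousOn_integral_profile hA n hφ hM)
    refine Complex.continuous_ofReal.comp_continuousOn (continuousOn_id.inv₀ fun p hp => ?_)
    exact (Set.mem_Ioi.1 hp).ne'
  have hgM : ∀ p : ℝ, 0 < p → ‖((p⁻¹ : ℝ) : ℂ) * ∫ s, profile A n φ p s‖ ≤ 2 * M / p := by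
    intro p hp
    rw [norm_mul, Complex.norm_real, Real.norm_eq_abs, abs_of_pos (by positivity), div_eq_mul_inv,
      mul_comm]
    gcongr
    exact norm_integral_profile_le hA n hM p
  have hT := tendsto_weighted_window_of_le_div hδ (-n) hg hgM
  rw [density_mul_integral_profile hA n hφ hper hM] at hT
  have hlim := (tendsto_sqrt_div hδ).const_mul (4 * M)
  rw [mul_zero] at hlim
  filter_upwards [eventually_horo δ, Metric.tendsto_nhds.1 hT (ε / 2) (half_pos hε),
    hlim.eventually_lt_const (half_pos hε)] with p ⟨h0, hs, h1, h2, h3, h4⟩ h5 h6 a b hab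
  rw [dist_eq_norm] at h5
  have h7 := norm_integral_lift_mode_sub_le hab hA n hφ.measurable hM h0 h1 (sub_pos.1 h3).le
  have h8 : ∑ c ∈ Finset.Ioc 0 ⌊1 / √p.1⌋₊, ((p.1 / (p.2.2 - p.2.1) : ℝ) : ℂ) *
      window (-n) p.2.1 p.2.2 c *
      ((((c * √p.1)⁻¹ : ℝ) : ℂ) * ∫ s, profile A n φ (c * √p.1) s) =
      ((1 / (p.2.2 - p.2.1) : ℝ) : ℂ) * ∑ c ∈ Finset.Ioc 0 ⌊1 / √p.1⌋₊, window (-n) p.2.1 p.2.2 c *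
        (((√p.1 / c : ℝ) : ℂ) * ∫ s, profile A n φ (c * √p.1) s) := by
    rw [Finset.mul_sum]
    refine Finset.sum_congr rfl fun c hc => ?_
    have hc0 : (0 : ℝ) < c := by exact_mod_cast (Finset.mem_Ioc.1 hc).1
    have e1 : p.1 / (p.2.2 - p.2.1) * (c * √p.1)⁻¹ = 1 / (p.2.2 - p.2.1) * (√p.1 / c) := by
      nth_rewrite 1 [← Real.mul_self_sqrt h0.le]
      field_simp
    have e2 : ((p.1 / (p.2.2 - p.2.1) : ℝ) : ℂ) * (((c * √p.1)⁻¹ : ℝ) : ℂ) =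
        ((1 / (p.2.2 - p.2.1) : ℝ) : ℂ) * ((√p.1 / c : ℝ) : ℂ) := by
      rw [← Complex.ofReal_mul, e1, Complex.ofReal_mul]
    linear_combination (window (-n) p.2.1 p.2.2 c * ∫ s, profile A n φ (c * √p.1) s) * e2
  rw [h8] at h5
  refine (norm_sub_le_norm_sub_add_norm_sub _ _ _).trans ((add_le_add ?_ h5.le).trans_eq
    (add_halves ε))
  rw [← mul_sub, norm_mul, Complex.norm_real, Real.norm_eq_abs, abs_of_pos (by positivity)]
  calc 1 / (p.2.2 - p.2.1) * _ ≤ 1 / (p.2.2 - p.2.1) * (4 * M * √p.1) := by gcongr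
    _ = 4 * M * (√p.1 / (p.2.2 - p.2.1)) := by ring
    _ ≤ ε / 2 := h6.le

/-- Trigonometric polynomials are uniformly dense among doubly periodic continuous functions. -/
lemma exists_norm_sub_sum_mode_le {h : ℝ → ℝ → ℂ} (hc : Continuous (Function.uncurry h))
    (hper1 : ∀ x θ, h (x + 1) θ = h x θ) (hper2 : ∀ x θ, h x (θ + 2 * Real.pi) = h x θ)
    {ε : ℝ} (hε : 0 < ε) :
    ∃ (s : Finset (Fin 2 → ℤ)) (φ : (Fin 2 → ℤ) → ℝ → ℂ), (∀ n, Continuous (φ n)) ∧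
      (∀ n θ, φ n (θ + 2 * Real.pi) = φ n θ) ∧ (∀ n, ∃ M, ∀ θ, ‖φ n θ‖ ≤ M) ∧
      ∀ x θ, ‖h x θ - ∑ n ∈ s, mode (n 0) (φ n) x θ‖ ≤ ε := by
  have hq : IsOpenQuotientMap
      (Pi.map (fun (_ : Fin 2) => ((↑) : ℝ → UnitAddCircle)) : (Fin 2 → ℝ) → UnitAddTorus (Fin 2)) :=
    IsOpenQuotientMap.piMap fun _ => QuotientAddGroup.isOpenQuotientMap_mk
  have hp1 : ∀ θ, Function.Periodic (fun x => h x θ) 1 := fun θ x => hper1 x θ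
  have hp2 : ∀ x, Function.Periodic (h x) (2 * Real.pi) := fun x θ => hper2 x θ
  let q : C(Fin 2 → ℝ, UnitAddTorus (Fin 2)) := ⟨_, hq.continuous⟩
  let g : C(Fin 2 → ℝ, ℂ) := ⟨fun u => h (u 0) (2 * Real.pi * u 1),
    hc.comp (by fun_prop : Continuous fun u : Fin 2 → ℝ => (u 0, 2 * Real.pi * u 1))⟩
  have hcongr : Function.FactorsThrough g q := by
    intro u v huv
    have hk : ∀ i, ∃ k : ℤ, u i = v i + k := by
      intro i
      have h1 : ((u i : ℝ) : UnitAddCircle) = ((v i : ℝ) : UnitAddCircle) := congrFun huv i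
      rw [← sub_eq_zero, ← AddCircle.coe_sub, AddCircle.coe_eq_zero_iff] at h1
      obtain ⟨k, hk⟩ := h1
      rw [zsmul_eq_mul, mul_one] at hk
      exact ⟨k, by linarith⟩
    obtain ⟨k, hk0⟩ := hk 0
    obtain ⟨l, hl⟩ := hk 1
    change h (u 0) (2 * Real.pi * u 1) = h (v 0) (2 * Real.pi * v 1)
    rw [hk0, hl, mul_add, mul_comm (2 * Real.pi) (l : ℝ), (hp2 _).int_mul l]
    simpa using (hp1 (2 * Real.pi * v 1)).int_mul k (v 0)
  let G : C(UnitAddTorus (Fin 2), ℂ) := Topology.IsQuotientMap.lift (f := q) hq.isQuotientMap g hcongr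
  have hG : ∀ u : Fin 2 → ℝ, G (fun i => (u i : UnitAddCircle)) = h (u 0) (2 * Real.pi * u 1) :=
    fun u => congrArg (fun F : C(Fin 2 → ℝ, ℂ) => F u) 
      (Topology.IsQuotientMap.lift_comp (f := q) hq.isQuotientMap g hcongr)
  have hmem : G ∈ (Submodule.span ℂ
      (Set.range <| UnitAddTorus.mFourier (d := Fin 2))).topologicalClosure := by
    rw [UnitAddTorus.span_mFourier_closure_eq_top]; trivial
  obtain ⟨F, hF, hGF⟩ := Metric.mem_closure_iff.1 hmem ε hε
  obtain ⟨c, rfl⟩ := Finsupp.mem_span_range_iff_exists_finsupp.1 hF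
  have hexp : ∀ (k : ℤ) (θ : ℝ), ‖Complex.exp (Complex.I * k * θ)‖ = 1 := fun k θ => by
    rw [show Complex.I * k * θ = ((k * θ : ℝ) : ℂ) * Complex.I by push_cast; ring,
      Complex.norm_exp_ofReal_mul_I]
  refine ⟨c.support, fun n θ => c n * Complex.exp (Complex.I * n 1 * θ), fun n => by fun_prop,
    fun n θ => ?_, fun n => ⟨‖c n‖, fun θ => by rw [norm_mul, hexp, mul_one]⟩, fun x θ => ?_⟩
  · refine congrArg (c n * ·) ?_
    rw [Complex.exp_eq_exp_iff_exists_int]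
    exact ⟨n 1, by push_cast; ring⟩
  · have h1 := ((ContinuousMap.dist_apply_le_dist
      (fun i => ((![x, θ / (2 * Real.pi)] i : ℝ) : UnitAddCircle))).trans_lt hGF).le
    rw [hG, dist_eq_norm] at h1
    have h2 : 2 * Real.pi * (θ / (2 * Real.pi)) = θ := by field_simp
    simp only [Matrix.cons_val_zero, Matrix.cons_val_one, h2] at h1
    rw [Finsupp.sum, ContinuousMap.coe_sum, Finset.sum_apply] at h1
    refine le_of_eq_of_le (congrArg (‖h x θ - ·‖) ?_) h1
    refine Finset.sum_congr rfl fun n _ => ?_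
    simp only [mode, ContinuousMap.coe_smul, Pi.smul_apply, smul_eq_mul, UnitAddTorus.mFourier,
      ContinuousMap.coe_mk, Fin.prod_univ_two, fourier_coe_apply, Matrix.cons_val_zero,
      Matrix.cons_val_one]
    have hpi : (Real.pi : ℂ) ≠ 0 := by exact_mod_cast Real.pi_ne_zero
    rw [mul_left_comm]
    congr 3
    · push_cast; ring
    · push_cast; field_simp

lemma norm_lift_sub_sum_le {a b : ℕ → ℤ → ℤ} (hab : ∀ (c : ℕ) (d : ℤ), 1 ≤ c →
    Int.gcd (c : ℤ) d = 1 → a c d * d - b c d * (c : ℤ) = 1) {A : ℝ} (hA : 1 < A) {z : ℂ}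
    (hz0 : 0 < z.im) (hzA : z.im < A) (θ : ℝ) {ι : Type*} {s : Finset ι} {h : ℝ → ℝ → ℂ}
    {k : ι → ℝ → ℝ → ℂ} {ε : ℝ} (hε : 0 ≤ ε) (H : ∀ x θ, ‖h x θ - ∑ n ∈ s, k n x θ‖ ≤ ε) :
    ‖lift a b (fA A h) z θ - ∑ n ∈ s, lift a b (fA A (k n)) z θ‖ ≤ ε := by
  obtain h0 | ⟨ξ, η, h0⟩ := lift_fA_cases hab hA hz0 hzA θ
  · simpa [h0] using hε
  · simpa only [h0] using H ξ η

lemma intervalIntegrable_finset_sum {ι : Type*} {s : Finset ι} {f : ι → ℝ → ℂ} {α β : ℝ}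
    (hf : ∀ n, IntervalIntegrable (f n) volume α β) :
    IntervalIntegrable (fun x => ∑ n ∈ s, f n x) volume α β := by
  simpa only [Finset.sum_fn] using IntervalIntegrable.sum s fun n _ => hf n

lemma intervalIntegrable_lift {a b : ℕ → ℤ → ℤ} (hab : ∀ (c : ℕ) (d : ℤ), 1 ≤ c →
    Int.gcd (c : ℤ) d = 1 → a c d * d - b c d * (c : ℤ) = 1) {A : ℝ} (hA : 1 < A)
    {h : ℝ → ℝ → ℂ} (hc : Continuous (Function.uncurry h))
    (hper1 : ∀ x θ, h (x + 1) θ = h x θ) (hper2 : ∀ x θ, h x (θ + 2 * Real.pi) = h x θ)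
    {y α β : ℝ} (hy : 0 < y) (hy1 : y < 1) (hαβ : α ≤ β) :
    IntervalIntegrable (fun x : ℝ => lift a b (fA A h) ((x : ℂ) + (y : ℂ) * Complex.I) 0)
      volume α β := by
  choose s φ hφ _ hM H using fun j : ℕ =>
    exists_norm_sub_sum_mode_le hc hper1 hper2 (Nat.one_div_pos_of_nat (α := ℝ) (n := j))
  have him : ∀ x : ℝ, ((x : ℂ) + (y : ℂ) * Complex.I).im = y := fun x => by simp
  have hF : ∀ j, IntervalIntegrable (fun x : ℝ => ∑ n ∈ s j,
      lift a b (fA A (mode (n 0) (φ j n))) ((x : ℂ) + (y : ℂ) * Complex.I) 0) volume α β :=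
    fun j => intervalIntegrable_finset_sum fun n => intervalIntegrable_lift_mode hab hA (n 0)
      (hφ j n).measurable (hM j n).choose_spec hy hy1 hαβ
  have hle : ∀ j (x : ℝ), ‖lift a b (fA A h) ((x : ℂ) + (y : ℂ) * Complex.I) 0 - ∑ n ∈ s j,
      lift a b (fA A (mode (n 0) (φ j n))) ((x : ℂ) + (y : ℂ) * Complex.I) 0‖ ≤
        1 / ((j : ℝ) + 1) := fun j x =>
    norm_lift_sub_sum_le hab hA (by rwa [him]) (by rw [him]; linarith) 0 (by positivity) (H j)
  rw [intervalIntegrable_iff_integrableOn_Ioc_of_le hαβ]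
  have hmeas : AEStronglyMeasurable
      (fun x : ℝ => lift a b (fA A h) ((x : ℂ) + (y : ℂ) * Complex.I) 0)
      (volume.restrict (Set.Ioc α β)) := by
    refine aestronglyMeasurable_of_tendsto_ae atTop
      (fun j => ((intervalIntegrable_iff_integrableOn_Ioc_of_le hαβ).1 (hF j)).1)
      (ae_of_all _ fun x => ?_)
    rw [tendsto_iff_norm_sub_tendsto_zero]
    refine squeeze_zero (fun _ => norm_nonneg _) (fun j => ?_)
      (tendsto_one_div_add_atTop_nhds_zero_nat (𝕜 := ℝ))
    rw [norm_sub_rev]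
    exact hle j x
  have h0 := (intervalIntegrable_iff_integrableOn_Ioc_of_le hαβ).1 (hF 0)
  refine Integrable.mono' (h0.norm.add (integrable_const (1 : ℝ))) hmeas (ae_of_all _ fun x => ?_)
  have h1 := hle 0 x
  rw [Nat.cast_zero, zero_add, div_one] at h1
  exact (norm_le_norm_add_norm_sub' _ _).trans (add_le_add_right h1 _)

lemma continuous_uncurry_mode (n : ℤ) {φ : ℝ → ℂ} (hφ : Continuous φ) :
    Continuous (Function.uncurry (mode n φ)) := by
  unfold mode Function.uncurry
  fun_prop

lemma norm_double_integral_sub_sum_le {h : ℝ → ℝ → ℂ} (hc : Continuous (Function.uncurry h))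
    {ι : Type*} {s : Finset ι} {k : ι → ℝ → ℝ → ℂ}
    (hk : ∀ n, Continuous (Function.uncurry (k n))) {ε : ℝ}
    (H : ∀ x θ, ‖h x θ - ∑ n ∈ s, k n x θ‖ ≤ ε) {T : ℝ} (hT : 0 ≤ T) :
    ‖(∫ θ in (0 : ℝ)..T, ∫ x in (0 : ℝ)..1, h x θ) -
      ∑ n ∈ s, ∫ θ in (0 : ℝ)..T, ∫ x in (0 : ℝ)..1, k n x θ‖ ≤ ε * T := by
  have hin : ∀ {f : ℝ → ℝ → ℂ}, Continuous (Function.uncurry f) → ∀ θ,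
      IntervalIntegrable (fun x => f x θ) volume 0 1 := fun hf θ =>
    (hf.comp (by fun_prop : Continuous fun x : ℝ => (x, θ))).intervalIntegrable _ _
  have hout : ∀ {f : ℝ → ℝ → ℂ}, Continuous (Function.uncurry f) →
      IntervalIntegrable (fun θ => ∫ x in (0 : ℝ)..1, f x θ) volume 0 T := fun {f} hf =>
    (intervalIntegral.continuous_parametric_intervalIntegral_of_continuous' (f := fun θ x => f x θ)
      (hf.comp continuous_swap) 0 1).intervalIntegrable _ _
  rw [← intervalIntegral.integral_finsetSum fun n _ => hout (hk n),
    ← intervalIntegral.integral_sub (hout hc)]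
  · refine (intervalIntegral.norm_integral_le_of_norm_le_const fun θ _ => ?_).trans_eq
      (by rw [sub_zero, abs_of_nonneg hT])
    rw [← intervalIntegral.integral_finsetSum fun n _ => hin (hk n) θ,
      ← intervalIntegral.integral_sub (hin hc θ)]
    · refine (intervalIntegral.norm_integral_le_of_norm_le_const fun x _ => H x θ).trans_eq ?_
      simp
    · exact intervalIntegrable_finset_sum fun n => hin (hk n) θ
  · exact intervalIntegrable_finset_sum fun n => hout (hk n)

lemma norm_sub_le_of_approx {C : ℝ} (hC : 0 ≤ C) {u v S T : ℂ} {r₁ r₂ r₃ : ℝ}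
    (h₁ : ‖u - S‖ ≤ r₁) (h₂ : ‖S - (C : ℂ) * T‖ ≤ r₂) (h₃ : ‖v - T‖ ≤ r₃) :
    ‖u - (C : ℂ) * v‖ ≤ r₁ + (r₂ + C * r₃) := by
  have h₄ : ‖(C : ℂ) * T - (C : ℂ) * v‖ ≤ C * r₃ := by
    rw [← mul_sub, norm_mul, Complex.norm_real, Real.norm_eq_abs, abs_of_nonneg hC, norm_sub_rev]
    gcongr
  exact (norm_sub_le_norm_sub_add_norm_sub _ _ _).trans (add_le_add h₁
    ((norm_sub_le_norm_sub_add_norm_sub _ _ _).trans (add_le_add h₂ h₄)))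

lemma eventually_norm_average_sub_le {δ : ℝ} (hδ : 0 < δ) {A : ℝ} (hA : 1 < A)
    {h : ℝ → ℝ → ℂ} (hc : Continuous (Function.uncurry h))
    (hper1 : ∀ x θ, h (x + 1) θ = h x θ) (hper2 : ∀ x θ, h x (θ + 2 * Real.pi) = h x θ)
    {ε : ℝ} (hε : 0 < ε) :
    ∀ᶠ p in horo δ, ∀ a b : ℕ → ℤ → ℤ, (∀ (c : ℕ) (d : ℤ), 1 ≤ c → Int.gcd (c : ℤ) d = 1 →
      a c d * d - b c d * (c : ℤ) = 1) →
      ‖((1 / (p.2.2 - p.2.1) : ℝ) : ℂ) * (∫ x in p.2.1..p.2.2,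
          lift a b (fA A h) ((x : ℂ) + (p.1 : ℂ) * Complex.I) 0) -
        ((3 / (2 * Real.pi ^ 2 * A) : ℝ) : ℂ) *
          ∫ θ in (0 : ℝ)..(2 * Real.pi), ∫ x in (0 : ℝ)..1, h x θ‖ ≤ ε := by
  have hmode := fun (n : ℤ) (φ : ℝ → ℂ) (hφ : Continuous φ)
    (hper : ∀ θ, φ (θ + 2 * Real.pi) = φ θ) (M : ℝ) (hM : ∀ θ, ‖φ θ‖ ≤ M) (η : ℝ) (hη : 0 < η) =>
    eventually_norm_average_mode_sub_le hδ hA n hφ hper hM hη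
  have hC0 : 0 < 3 / (2 * Real.pi ^ 2 * A) := by positivity
  generalize 3 / (2 * Real.pi ^ 2 * A) = C at hmode hC0 ⊢
  obtain ⟨ε', hε'⟩ : ∃ ε', ε' = ε / (2 * (1 + C * (2 * Real.pi))) := ⟨_, rfl⟩
  have hε'0 : 0 < ε' := by rw [hε']; positivity
  obtain ⟨s, φ, hφ, hper, hM, H⟩ := exists_norm_sub_sum_mode_le hc hper1 hper2 hε'0
  have hk : ∀ n : Fin 2 → ℤ, Continuous (Function.uncurry (mode (n 0) (φ n))) :=
    fun n => continuous_uncurry_mode (n 0) (hφ n)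
  have k2 : ‖(∫ θ in (0 : ℝ)..(2 * Real.pi), ∫ x in (0 : ℝ)..1, h x θ) - ∑ n ∈ s,
      ∫ θ in (0 : ℝ)..(2 * Real.pi), ∫ x in (0 : ℝ)..1, mode (n 0) (φ n) x θ‖ ≤
        ε' * (2 * Real.pi) :=
    norm_double_integral_sub_sum_le hc hk (s := s) (ε := ε') H (T := 2 * Real.pi)
      Real.two_pi_pos.le
  have hsum : ∀ᶠ p in horo δ, ∀ n ∈ s, ∀ a b : ℕ → ℤ → ℤ,
      (∀ (c : ℕ) (d : ℤ), 1 ≤ c → Int.gcd (c : ℤ) d = 1 →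
      a c d * d - b c d * (c : ℤ) = 1) →
      ‖((1 / (p.2.2 - p.2.1) : ℝ) : ℂ) * (∫ x in p.2.1..p.2.2,
          lift a b (fA A (mode (n 0) (φ n))) ((x : ℂ) + (p.1 : ℂ) * Complex.I) 0) -
        (C : ℂ) * ∫ θ in (0 : ℝ)..(2 * Real.pi), ∫ x in (0 : ℝ)..1, mode (n 0) (φ n) x θ‖ ≤
          ε / (2 * (s.card + 1)) :=
    (Filter.eventually_all_finset s).2 fun n _ =>
      hmode (n 0) (φ n) (hφ n) (hper n) _ (hM n).choose_spec _ (by positivity)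
  filter_upwards [eventually_horo δ, hsum] with p ⟨h0, _, h1, _, h3, _⟩ h5 a b hab
  have hle : p.2.1 ≤ p.2.2 := (sub_pos.1 h3).le
  have him : ∀ x : ℝ, ((x : ℂ) + (p.1 : ℂ) * Complex.I).im = p.1 := fun x => by simp
  have h_int : ∀ n, IntervalIntegrable (fun x : ℝ =>
      lift a b (fA A (mode (n 0) (φ n))) ((x : ℂ) + (p.1 : ℂ) * Complex.I) 0)
      volume p.2.1 p.2.2 := fun n =>
    intervalIntegrable_lift_mode hab hA (n 0) (hφ n).measurable (hM n).choose_spec h0 h1 hle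
  have k1 : ‖((1 / (p.2.2 - p.2.1) : ℝ) : ℂ) * (∫ x in p.2.1..p.2.2,
      lift a b (fA A h) ((x : ℂ) + (p.1 : ℂ) * Complex.I) 0) -
      ∑ n ∈ s, ((1 / (p.2.2 - p.2.1) : ℝ) : ℂ) * ∫ x in p.2.1..p.2.2,
        lift a b (fA A (mode (n 0) (φ n))) ((x : ℂ) + (p.1 : ℂ) * Complex.I) 0‖ ≤ ε' := by
    rw [← Finset.mul_sum, ← mul_sub, ← intervalIntegral.integral_finsetSum fun n _ => h_int n,
      ← intervalIntegral.integral_sub (intervalIntegrable_lift hab hA hc hper1 hper2 h0 h1 hle),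
      norm_mul, Complex.norm_real, Real.norm_eq_abs, abs_of_pos (by positivity)]
    · calc _ ≤ 1 / (p.2.2 - p.2.1) * (ε' * |p.2.2 - p.2.1|) := by
            gcongr
            exact intervalIntegral.norm_integral_le_of_norm_le_const fun x _ =>
              norm_lift_sub_sum_le hab hA (by rwa [him]) (by rw [him]; linarith) 0 hε'0.le H
        _ = ε' := by rw [abs_of_pos h3]; field_simp
    · exact intervalIntegrable_finset_sum h_int
  have k3 := norm_sum_le_of_le s fun n hn => h5 n hn a b hab
  have k3' := Finset.mul_sum s (fun n => ∫ θ in (0 : ℝ)..(2 * Real.pi), ∫ x in (0 : ℝ)..1,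
    mode (n 0) (φ n) x θ) (C : ℂ)
  rw [Finset.sum_const, nsmul_eq_mul, Finset.sum_sub_distrib, ← k3'] at k3
  have k4 : (s.card : ℝ) * (ε / (2 * (s.card + 1))) ≤ ε / 2 := by
    rw [mul_div_assoc', div_le_div_iff₀ (by positivity) (by positivity)]
    nlinarith
  have k5 : ε' + C * (ε' * (2 * Real.pi)) = ε / 2 := by
    rw [hε']; field_simp
  exact (norm_sub_le_of_approx hC0.le k1 k3 k2).trans (by linarith)

/-- Averages over long intervals inherit bounds valid for averages over intervals of length
between `1/2` and `1`. -/
lemma norm_average_sub_le_of_forall_short {F : ℝ → ℂ} {M : ℂ} {ε : ℝ}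
    (hF : ∀ α β, α ≤ β → IntervalIntegrable F volume α β)
    (H : ∀ α β : ℝ, 1 / 2 ≤ β - α → β - α ≤ 1 →
      ‖((1 / (β - α) : ℝ) : ℂ) * (∫ x in α..β, F x) - M‖ ≤ ε) {α β : ℝ} (h : 1 < β - α) :
    ‖((1 / (β - α) : ℝ) : ℂ) * (∫ x in α..β, F x) - M‖ ≤ ε := by
  set N := ⌈β - α⌉₊
  have hN1 : β - α ≤ N := Nat.le_ceil _
  have hN2 : (N : ℝ) < β - α + 1 := Nat.ceil_lt_add_one (by linarith)
  have hN0 : (0 : ℝ) < N := by linarith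
  obtain ⟨t, ht⟩ : ∃ t, t = (β - α) / N := ⟨_, rfl⟩
  have ht1 : t ≤ 1 := by rw [ht]; exact div_le_one_of_le₀ hN1 hN0.le
  have ht2 : 1 / 2 ≤ t := by rw [ht, div_le_div_iff₀ two_pos hN0]; linarith
  have hNt : N * t = β - α := by rw [ht]; field_simp
  have hstep : ∀ k : ℕ, (α + (k + 1 : ℕ) * t) - (α + k * t) = t := fun k => by push_cast; ring
  have h_int : ∫ x in α..β, F x = ∑ k ∈ Finset.range N, ∫ x in (α + k * t)..(α + (k + 1 : ℕ) * t),
      F x := by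
    rw [intervalIntegral.sum_integral_adjacent_intervals (a := fun k : ℕ => α + k * t) fun k _ =>
      hF _ _ (by linarith [hstep k]), hNt]
    simp
  have hk : ∀ k ∈ Finset.range N, ‖((1 / t : ℝ) : ℂ) *
      (∫ x in (α + k * t)..(α + (k + 1 : ℕ) * t), F x) - M‖ ≤ ε := by
    intro k _
    have := H (α + k * t) (α + (k + 1 : ℕ) * t)
    rw [hstep] at this
    exact this ht2 ht1
  have hsum := norm_sum_le_of_le _ hk
  rw [Finset.sum_sub_distrib, ← Finset.mul_sum, ← h_int, Finset.sum_const, Finset.sum_const,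
    Finset.card_range, nsmul_eq_mul, nsmul_eq_mul] at hsum
  have hNC : (N : ℂ) ≠ 0 := by exact_mod_cast hN0.ne'
  have htC : (t : ℂ) ≠ 0 := by exact_mod_cast (by linarith : t ≠ 0)
  have hfac : ((1 / t : ℝ) : ℂ) * (∫ x in α..β, F x) - N * M =
      N * (((1 / (β - α) : ℝ) : ℂ) * (∫ x in α..β, F x) - M) := by
    rw [← hNt]
    push_cast
    field_simp
  rw [hfac, norm_mul, Complex.norm_natCast] at hsum
  exact le_of_mul_le_mul_left hsum hN0

end Horocycle

/-- Horocycle equidistribution for the fixed cuspidal test function `Φ_{f_A}` on the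
modular surface (where `μ(Γ\G) = 2π²/3`). -/
theorem stmt_8 (h : ℝ → ℝ → ℂ) (hsm : ContDiff ℝ (⊤ : ℕ∞) (Function.uncurry h))
    (hper1 : ∀ x θ, h (x + 1) θ = h x θ)
    (hper2 : ∀ x θ, h x (θ + 2 * Real.pi) = h x θ)
    (A : ℝ) (hA : 1 < A)
    (δ : ℝ) (hδ0 : 0 < δ) (hδ1 : δ < 1/2) (ε : ℝ) (hε : 0 < ε) :
    ∃ y₀ > 0,
      ∀ (a b : ℕ → ℤ → ℤ),
        (∀ (c : ℕ) (d : ℤ), 1 ≤ c → Int.gcd (c : ℤ) d = 1 →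
          a c d * d - b c d * (c : ℤ) = 1) →
        ∀ y : ℝ, 0 < y → y ≤ y₀ →
          ∀ α β : ℝ, α < β → y ^ ((1:ℝ)/2 - δ) ≤ β - α →
            ‖((1 / (β - α) : ℝ) : ℂ) *
                (∫ x in α..β, lift a b (fA A h) ((x : ℂ) + (y : ℂ) * Complex.I) 0) -
              ((3 / (2 * Real.pi ^ 2 * A) : ℝ) : ℂ) *
                (∫ θ in (0:ℝ)..(2 * Real.pi), ∫ x in (0:ℝ)..1, h x θ)‖ ≤ ε := by
  have hc := hsm.continuous
  obtain ⟨y₁, hy₁, H⟩ := Horocycle.exists_of_eventually_horo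
    (Horocycle.eventually_norm_average_sub_le hδ0 hA hc hper1 hper2 hε)
  have hκ : 0 < (1 : ℝ) / 2 - δ := by linarith
  refine ⟨min y₁ ((1 / 2 : ℝ) ^ ((1 : ℝ) / 2 - δ)⁻¹), by positivity,
    fun a b hab y hy hle α β hαβ hlen => ?_⟩
  have hle₁ := hle.trans (min_le_left _ _)
  have hle₂ := hle.trans (min_le_right _ _)
  have hy1 : y < 1 := hle₂.trans_lt
    (Real.rpow_lt_one (by norm_num) (by norm_num) (inv_pos.2 hκ))
  have hpow : y ^ ((1 : ℝ) / 2 - δ) ≤ 1 / 2 := by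
    refine (Real.rpow_le_rpow hy.le hle₂ hκ.le).trans_eq ?_
    rw [← Real.rpow_mul (by norm_num), inv_mul_cancel₀ hκ.ne', Real.rpow_one]
  rcases le_or_gt (β - α) 1 with h1 | h1
  · exact H y hy hle₁ α β hlen h1 a b hab
  · exact Horocycle.norm_average_sub_le_of_forall_short
      (fun α' β' h' => Horocycle.intervalIntegrable_lift hab hA hc hper1 hper2 hy hy1 h')
      (fun α' β' h2 h3 => H y hy hle₁ α' β' (hpow.trans h2) h3 a b hab) h1
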